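/- Let k ≥ 3 be an integer. For every ε > 0 there exists a constant A > 0 such that for all real X ≥ 2, both the integral ∫_0^∞ P_k(t)² e^{−t/X} dt and the series ∑_{n=1}^∞ P_k(n)² e^{−n/X} converge, and |∫_0^∞ P_k(t)² e^{−t/X} dt − ∑_{n=1}^∞ P_k(n)² e^{−n/X} + (Γ(k−1) π^k/(6 Γ(k/2)²)) X^{k−1}| ≤ A X^{k−2+ε}. That is, the continuous Laplace transform of P_k(t)² differs from its discrete analogue by exactly −(Γ(k−1) π^k/(6 Γ(k/2)²)) X^{k−1} up to an error O(X^{k−2+ε}). -/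

import Mathlib

open scoped Real

/-- `rk k m` = number of ways to write `m` as a sum of `k` integer squares. -/
noncomputable def rk (k m : ℕ) : ℕ :=
  Nat.card {v : Fin k → ℤ // (∑ i, (v i) ^ 2) = (m : ℤ)}

/-- `Sk k t` = number of lattice points of `ℤ^k` in the closed ball of radius `√t`. -/
noncomputable def Sk (k : ℕ) (t : ℝ) : ℕ :=
  Nat.card {v : Fin k → ℤ // (∑ i, ((v i : ℝ)) ^ 2) ≤ t}

/-- `Vk k` = volume of the unit ball in `ℝ^k`. -/
noncomputable def Vk (k : ℕ) : ℝ :=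
  Real.pi ^ ((k : ℝ) / 2) / Real.Gamma ((k : ℝ) / 2 + 1)

/-- `Pk k t` = lattice point discrepancy of the `k`-dimensional ball of radius `√t`. -/
noncomputable def Pk (k : ℕ) (t : ℝ) : ℝ :=
  (Sk k t : ℝ) - Vk k * t ^ ((k : ℝ) / 2)

/-- Value of the (analytically continued) Riemann zeta function at a real point. -/
noncomputable def rzeta (x : ℝ) : ℝ := (riemannZeta (x : ℂ)).re

/-- The Riemann zeta function with its 2-factor removed. -/
noncomputable def rzeta2 (x : ℝ) : ℝ := (1 - (2 : ℝ) ^ (-x)) * rzeta x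

/-- The constant `C_k` for `k ≥ 4`. -/
noncomputable def Ck (k : ℕ) : ℝ :=
  ((k : ℝ) ^ 2 / 24) * (Vk k) ^ 2 +
    Real.pi ^ (k : ℝ) * rzeta ((k : ℝ) - 2) * (1 + (2 : ℝ) ^ ((3 : ℝ) - (k : ℝ))) /
      (12 * (Real.Gamma ((k : ℝ) / 2)) ^ 2 * rzeta2 (k : ℝ))

/-- The square of the Euclidean norm of a point of `ℤ²`. -/
def normSqTwo (A : ℤ × ℤ) : ℕ := A.1.natAbs ^ 2 + A.2.natAbs ^ 2

lemma normSqTwo_cast (A : ℤ × ℤ) : (normSqTwo A : ℤ) = A.1 ^ 2 + A.2 ^ 2 := by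
  simp [normSqTwo]

lemma normSqTwo_cast_real (A : ℤ × ℤ) : (normSqTwo A : ℝ) = (A.1 : ℝ) ^ 2 + (A.2 : ℝ) ^ 2 := by
  have := normSqTwo_cast A
  exact_mod_cast congrArg (Int.cast : ℤ → ℝ) this

/-- The four number theorem over `ℤ`. -/
lemma exists_four_number_factorization {p q r s : ℤ} (h : p * q = r * s) :
    ∃ g k x y : ℤ, p = g * x ∧ q = y * k ∧ r = g * y ∧ s = x * k := by
  by_cases hp : p = 0
  · subst hp
    rw [zero_mul, eq_comm, mul_eq_zero] at h
    rcases h with h | h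
    · exact ⟨0, 1, s, q, by simp, by simp, by simp [h], by simp⟩
    · exact ⟨r, q, 0, 1, by simp, by simp, by simp, by simp [h]⟩
  · obtain ⟨g, x, ⟨y, hy⟩, ⟨k, hk⟩, hgx⟩ := exists_dvd_and_dvd_of_dvd_mul (Dvd.intro q h)
    refine ⟨g, k, x, y, hgx, ?_, hy, hk⟩
    apply mul_left_cancel₀ hp
    rw [h, hy, hk, hgx]; ring

lemma one_add_abs_mul_le {g h : ℝ} (H : 1 ≤ g ^ 2 + h ^ 2) :
    (1 + |g|) * (1 + |h|) ≤ 4 * (g ^ 2 + h ^ 2) := by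
  have h1 := sq_abs g
  have h2 := sq_abs h
  nlinarith [sq_nonneg (|g| - |h|), sq_nonneg (|g| - 1), sq_nonneg (|h| - 1), abs_nonneg g,
    abs_nonneg h]

lemma one_le_sq_add_sq {g h : ℤ} (H : g ^ 2 + h ^ 2 ≠ 0) : (1 : ℝ) ≤ (g : ℝ) ^ 2 + (h : ℝ) ^ 2 := by
  have : 0 ≤ g ^ 2 + h ^ 2 := by positivity
  have : 1 ≤ g ^ 2 + h ^ 2 := by omega
  exact_mod_cast this

lemma exists_param_of_normSqTwo_eq (A B : ℤ × ℤ) (h : normSqTwo A = normSqTwo B) :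
    ∃ u : (ℤ × ℤ) × (ℤ × ℤ),
      A.1 - B.1 = u.1.1 * u.2.1 ∧ A.1 + B.1 = u.2.2 * u.1.2 ∧
      B.2 - A.2 = u.1.1 * u.2.2 ∧ B.2 + A.2 = u.2.1 * u.1.2 ∧
      ((1 + |(u.1.1 : ℝ)|) * (1 + |(u.1.2 : ℝ)|)) * ((1 + |(u.2.1 : ℝ)|) * (1 + |(u.2.2 : ℝ)|))
        ≤ 64 * (1 + normSqTwo A) := by
  have hA := normSqTwo_cast A
  have hB := normSqTwo_cast B
  rw [← h, hA] at hB
  by_cases h0 : normSqTwo A = 0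
  · have hb0 : normSqTwo B = 0 := h ▸ h0
    simp only [normSqTwo, Nat.add_eq_zero_iff, pow_eq_zero_iff, ne_eq, OfNat.ofNat_ne_zero,
      not_false_eq_true, Int.natAbs_eq_zero] at h0 hb0
    refine ⟨0, by simp [h0, hb0], by simp [h0, hb0], by simp [h0, hb0], by simp [h0, hb0], ?_⟩
    have : (0 : ℝ) ≤ normSqTwo A := by positivity
    simp; linarith
  obtain ⟨g, k, x, y, h1, h2, h3, h4⟩ :=
    exists_four_number_factorization (p := A.1 - B.1) (q := A.1 + B.1) (r := B.2 - A.2)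
      (s := B.2 + A.2) (by linarith)
  refine ⟨((g, k), (x, y)), h1, h2, h3, h4, ?_⟩
  have key : 4 * (normSqTwo A : ℤ) = (g ^ 2 + k ^ 2) * (x ^ 2 + y ^ 2) := by
    have : (g ^ 2 + k ^ 2) * (x ^ 2 + y ^ 2)
      = (g * x) ^ 2 + (y * k) ^ 2 + (g * y) ^ 2 + (x * k) ^ 2 := by ring
    rw [this, ← h1, ← h2, ← h3, ← h4, hA]
    linarith
  have hne : (g ^ 2 + k ^ 2) * (x ^ 2 + y ^ 2) ≠ 0 := by
    rw [← key]; positivity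
  have e1 := one_le_sq_add_sq (left_ne_zero_of_mul hne)
  have e2 := one_le_sq_add_sq (right_ne_zero_of_mul hne)
  have keyR : 4 * (normSqTwo A : ℝ) = ((g : ℝ) ^ 2 + (k : ℝ) ^ 2) * ((x : ℝ) ^ 2 + (y : ℝ) ^ 2) := by
    exact_mod_cast key
  calc _ ≤ (4 * ((g : ℝ) ^ 2 + (k : ℝ) ^ 2)) * (4 * ((x : ℝ) ^ 2 + (y : ℝ) ^ 2)) := by
        apply mul_le_mul (one_add_abs_mul_le e1) (one_add_abs_mul_le e2) <;> positivity
    _ = 16 * (4 * (normSqTwo A : ℝ)) := by rw [keyR]; ring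
    _ ≤ _ := by linarith

lemma summable_one_add_abs_int_rpow {p : ℝ} (hp : 1 < p) :
    Summable fun n : ℤ => (1 + |(n : ℝ)|) ^ (-p) := by
  have h1 : Summable fun n : ℕ => (1 + (n : ℝ)) ^ (-p) := by
    have := (summable_nat_add_iff 1).2 (Real.summable_nat_rpow.2 (by linarith : -p < -1))
    refine this.congr fun n => ?_
    push_cast; rw [add_comm]
  apply Summable.of_nat_of_neg <;> simpa using h1

/-- Off-diagonal energy: pairs of lattice points of equal norm. -/
lemma summable_equal_norm_pairs {p : ℝ} (hp : 1 < p) :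
    Summable fun q : {q : (ℤ × ℤ) × (ℤ × ℤ) // normSqTwo q.1 = normSqTwo q.2} =>
      (1 + (normSqTwo q.1.1 : ℝ)) ^ (-p) := by
  choose u h1 h2 h3 h4 h5 using fun q : {q : (ℤ × ℤ) × (ℤ × ℤ) // normSqTwo q.1 = normSqTwo q.2} =>
    exists_param_of_normSqTwo_eq q.1.1 q.1.2 q.2
  have hinj : Function.Injective u := by
    intro q q' hq
    have a1 := h1 q; have a2 := h2 q; have a3 := h3 q; have a4 := h4 q
    rw [hq] at a1 a2 a3 a4
    rw [← h1 q'] at a1; rw [← h2 q'] at a2; rw [← h3 q'] at a3; rw [← h4 q'] at a4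
    apply Subtype.ext
    apply Prod.ext <;> apply Prod.ext <;> omega
  have s1 := summable_one_add_abs_int_rpow hp
  have s2 := s1.mul_of_nonneg s1 (fun _ => by positivity) (fun _ => by positivity)
  have s4 := s2.mul_of_nonneg s2 (fun _ => by positivity) (fun _ => by positivity)
  refine Summable.of_nonneg_of_le (fun _ => by positivity) (fun q => ?_)
    ((s4.comp_injective hinj).mul_left ((64 : ℝ) ^ p))
  simp only [Function.comp]
  rw [← Real.mul_rpow (by positivity) (by positivity), ← Real.mul_rpow (by positivity)
    (by positivity), ← Real.mul_rpow (by positivity) (by positivity)]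
  set Z := ((1 + |((u q).1.1 : ℝ)|) * (1 + |((u q).1.2 : ℝ)|)) *
    ((1 + |((u q).2.1 : ℝ)|) * (1 + |((u q).2.2 : ℝ)|)) with hZ
  have hZ0 : 0 < Z := by positivity
  rw [Real.rpow_neg (by positivity), Real.rpow_neg hZ0.le, ← div_eq_mul_inv, ← one_div, div_le_div_iff₀
    (by positivity) (by positivity), one_mul, ← Real.mul_rpow (by positivity) (by positivity)]
  exact Real.rpow_le_rpow hZ0.le (h5 q) (by linarith)

/-- The number of points of `ℤ²` whose squared norm is `n`. -/
noncomputable def fiberCount (n : ℕ) : ENNReal := ∑' A : ℤ × ℤ, if normSqTwo A = n then 1 else 0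

lemma tsum_normSqTwo (F : ℕ → ENNReal) :
    ∑' A : ℤ × ℤ, F (normSqTwo A) = ∑' n, fiberCount n * F n := by
  have : ∀ A : ℤ × ℤ, F (normSqTwo A) = ∑' n, (if normSqTwo A = n then 1 else 0) * F n := by
    intro A
    rw [tsum_eq_single (normSqTwo A)]
    · simp
    · intro n hn; simp [hn.symm]
  simp_rw [this]
  rw [ENNReal.tsum_comm]
  congr 1; ext n
  rw [ENNReal.tsum_mul_right, fiberCount]

lemma tsum_fiberCount_sq_ne_top {p : ℝ} (hp : 1 < p) :
    ∑' n, fiberCount n * (fiberCount n * ENNReal.ofReal ((1 + (n : ℝ)) ^ (-p))) ≠ ⊤ := by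
  rw [← tsum_normSqTwo fun n => fiberCount n * ENNReal.ofReal ((1 + (n : ℝ)) ^ (-p))]
  have h := (summable_equal_norm_pairs hp).tsum_ofReal_ne_top
  have e : ∀ A : ℤ × ℤ, fiberCount (normSqTwo A) * ENNReal.ofReal ((1 + (normSqTwo A : ℝ)) ^ (-p))
      = ∑' B : ℤ × ℤ, Set.indicator {q : (ℤ × ℤ) × (ℤ × ℤ) | normSqTwo q.1 = normSqTwo q.2}
        (fun q => ENNReal.ofReal ((1 + (normSqTwo q.1 : ℝ)) ^ (-p))) (A, B) := by
    intro A
    rw [fiberCount, ← ENNReal.tsum_mul_right]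
    congr 1; ext B
    by_cases hAB : normSqTwo A = normSqTwo B
    · simp [Set.indicator, hAB]
    · simp [Set.indicator, hAB, Ne.symm hAB]
  simp_rw [e]
  rw [← ENNReal.tsum_prod (f := fun A B => Set.indicator _ _ (A, B)), ← tsum_subtype]
  exact h

/-- The weight attached to a pair of frequencies after integration by parts. -/
noncomputable def pairWeight (η : ℝ) (n m : ℕ) : ℝ :=
  (1 + (n : ℝ) + m) ^ (-(1 + η)) * (1 + |(n : ℝ) - m|)⁻¹

lemma pairWeight_nonneg (η : ℝ) (n m : ℕ) : 0 ≤ pairWeight η n m := by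
  unfold pairWeight; positivity

lemma pairWeight_comm (η : ℝ) (n m : ℕ) : pairWeight η n m = pairWeight η m n := by
  unfold pairWeight
  rw [abs_sub_comm, add_right_comm]

lemma pairWeight_le {η : ℝ} (hη : 0 < η) (n m : ℕ) :
    pairWeight η n m ≤ (1 + (n : ℝ)) ^ (-(1 + η / 2)) *
      (1 + |(((n : ℤ) - m : ℤ) : ℝ)|) ^ (-(1 + η / 2)) := by
  unfold pairWeight
  have hn : (0 : ℝ) ≤ n := by positivity
  have hm : (0 : ℝ) ≤ m := by positivity
  have e : -(1 + η) = -(1 + η / 2) + -(η / 2) := by ring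
  have e2 : -(1 + η / 2) = -(η / 2) + -1 := by ring
  push_cast
  rw [e, Real.rpow_add (by positivity), mul_assoc]
  apply mul_le_mul _ _ (by positivity) (by positivity)
  · exact Real.rpow_le_rpow_of_nonpos (by positivity) (by linarith) (by linarith)
  · rw [e2]
    rw [Real.rpow_add (by positivity), Real.rpow_neg_one]
    gcongr ?_ * _
    apply Real.rpow_le_rpow_of_nonpos (by positivity) _ (by linarith)
    have : |(n : ℝ) - m| ≤ n + m := by rw [abs_le]; constructor <;> linarith
    linarith

lemma tsum_pairWeight_le {η : ℝ} (hη : 0 < η) : ∃ K : ENNReal, K ≠ ⊤ ∧ ∀ n : ℕ,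
    ∑' m : ℕ, ENNReal.ofReal (pairWeight η n m) ≤
      ENNReal.ofReal ((1 + (n : ℝ)) ^ (-(1 + η / 2))) * K := by
  refine ⟨∑' N : ℤ, ENNReal.ofReal ((1 + |(N : ℝ)|) ^ (-(1 + η / 2))),
    (summable_one_add_abs_int_rpow (by linarith)).tsum_ofReal_ne_top, fun n => ?_⟩
  have hinj : Function.Injective fun m : ℕ => (n : ℤ) - m := by
    intro a b h; simpa using h
  calc _ ≤ ∑' m : ℕ, ENNReal.ofReal ((1 + (n : ℝ)) ^ (-(1 + η / 2))) *
        ENNReal.ofReal ((1 + |(((n : ℤ) - m : ℤ) : ℝ)|) ^ (-(1 + η / 2))) := by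
        apply ENNReal.tsum_le_tsum fun m => ?_
        rw [← ENNReal.ofReal_mul (by positivity)]
        exact ENNReal.ofReal_le_ofReal (pairWeight_le hη n m)
    _ = ENNReal.ofReal ((1 + (n : ℝ)) ^ (-(1 + η / 2))) * ∑' m : ℕ,
        ENNReal.ofReal ((1 + |(((n : ℤ) - m : ℤ) : ℝ)|) ^ (-(1 + η / 2))) := ENNReal.tsum_mul_left
    _ ≤ _ := by
        gcongr
        exact ENNReal.tsum_comp_le_tsum_of_injective hinj
          (fun N : ℤ => ENNReal.ofReal ((1 + |(N : ℝ)|) ^ (-(1 + η / 2))))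

lemma summable_pairWeight {η : ℝ} (hη : 0 < η) :
    Summable fun q : (ℤ × ℤ) × (ℤ × ℤ) => pairWeight η (normSqTwo q.1) (normSqTwo q.2) := by
  have hfin : ∑' q : (ℤ × ℤ) × (ℤ × ℤ),
      ENNReal.ofReal (pairWeight η (normSqTwo q.1) (normSqTwo q.2)) ≠ ⊤ := by
    rw [ENNReal.tsum_prod (f := fun A B => ENNReal.ofReal (pairWeight η (normSqTwo A) (normSqTwo B)))]
    rw [tsum_congr fun A => tsum_normSqTwo fun m => ENNReal.ofReal (pairWeight η (normSqTwo A) m)]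
    rw [tsum_normSqTwo fun n => ∑' m, fiberCount m * ENNReal.ofReal (pairWeight η n m)]
    obtain ⟨K, hK, hw⟩ := tsum_pairWeight_le hη
    set c := fiberCount
    set w := fun n m => ENNReal.ofReal (pairWeight η n m) with hwdef
    have hcomm : ∀ n m, w n m = w m n := fun n m => by simp only [hwdef, pairWeight_comm]
    have hdiag : ∑' n, ∑' m, c n * (c n * w n m) ≠ ⊤ := by
      have : ∑' n, ∑' m, c n * (c n * w n m) ≤
          (∑' n, c n * (c n * ENNReal.ofReal ((1 + (n : ℝ)) ^ (-(1 + η / 2))))) * K := by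
        rw [← ENNReal.tsum_mul_right]
        apply ENNReal.tsum_le_tsum fun n => ?_
        rw [ENNReal.tsum_mul_left, ENNReal.tsum_mul_left, mul_assoc, mul_assoc]
        gcongr
        exact hw n
      exact ne_top_of_le_ne_top
        (ENNReal.mul_ne_top (tsum_fiberCount_sq_ne_top (by linarith)) hK) this
    have hle : ∑' n, c n * ∑' m, c m * w n m ≤
        ∑' n, ∑' m, c n * (c n * w n m) + ∑' n, ∑' m, c n * (c n * w n m) := by
      calc _ = ∑' n, ∑' m, c n * (c m * w n m) := by simp_rw [ENNReal.tsum_mul_left]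
        _ ≤ ∑' n, ∑' m, (c n * (c n * w n m) + c m * (c m * w m n)) := by
          refine ENNReal.tsum_le_tsum fun n => ENNReal.tsum_le_tsum fun m => ?_
          rcases le_total (c n) (c m) with h | h
          · refine le_trans ?_ le_add_self
            rw [hcomm m n]; gcongr
          · refine le_trans ?_ le_self_add
            gcongr
        _ = _ := by
          simp_rw [ENNReal.tsum_add]
          congr 1
          exact ENNReal.tsum_comm
    exact ne_top_of_le_ne_top (ENNReal.add_ne_top.2 ⟨hdiag, hdiag⟩) hle
  refine (ENNReal.summable_toReal hfin).congr fun q => ?_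
  rw [ENNReal.toReal_ofReal (pairWeight_nonneg _ _ _)]

lemma exp_neg_le_rpow {p : ℝ} (hp : 0 < p) {x : ℝ} (hx : 0 < x) :
    Real.exp (-x) ≤ p ^ p * x ^ (-p) := by
  have h1 : x / p ≤ Real.exp (x / p) := by linarith [Real.add_one_le_exp (x / p)]
  have h2 : (x / p) ^ p ≤ Real.exp x := by
    calc (x / p) ^ p ≤ Real.exp (x / p) ^ p := Real.rpow_le_rpow (by positivity) h1 hp.le
      _ = Real.exp x := by rw [← Real.exp_mul]; congr 1; field_simp
  rw [Real.div_rpow hx.le hp.le, div_le_iff₀ (by positivity)] at h2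
  rw [Real.exp_neg, Real.rpow_neg hx.le, ← div_eq_mul_inv, inv_eq_one_div, div_le_div_iff₀
    (Real.exp_pos _) (by positivity)]
  linarith

/-- The theta series `∑ exp (-s n²)`. -/
noncomputable def thetaSum (s : ℂ) : ℂ := ∑' n : ℤ, Complex.exp (-s * (n : ℂ) ^ 2)

/-- The theta series at a real argument. -/
noncomputable def realTheta (a : ℝ) : ℝ := ∑' n : ℤ, Real.exp (-a * (n : ℝ) ^ 2)

lemma exp_neg_mul_sq_le {p : ℝ} (hp : 0 < p) {a : ℝ} (ha : 0 < a) {n : ℤ} (hn : n ≠ 0) :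
    Real.exp (-a * (n : ℝ) ^ 2) ≤
      (p ^ p * 4 ^ p * a ^ (-p)) * (1 + |(n : ℝ)|) ^ (-(2 * p)) := by
  have h1 : (1 : ℝ) ≤ |(n : ℝ)| := by
    have := Int.one_le_abs hn
    exact_mod_cast this
  have h2 : (1 + |(n : ℝ)|) ^ 2 / 4 ≤ (n : ℝ) ^ 2 := by
    rw [← sq_abs (n : ℝ)]; nlinarith
  have hx : 0 < a * ((1 + |(n : ℝ)|) ^ 2 / 4) := by positivity
  calc Real.exp (-a * (n : ℝ) ^ 2) ≤ Real.exp (-(a * ((1 + |(n : ℝ)|) ^ 2 / 4))) := by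
        apply Real.exp_le_exp.2
        nlinarith
    _ ≤ p ^ p * (a * ((1 + |(n : ℝ)|) ^ 2 / 4)) ^ (-p) := exp_neg_le_rpow hp hx
    _ = _ := by
        rw [Real.mul_rpow ha.le (by positivity), Real.div_rpow (by positivity) (by positivity),
          ← Real.rpow_natCast, ← Real.rpow_mul (by positivity), Real.rpow_neg (by norm_num : (0:ℝ) ≤ 4),
          div_inv_eq_mul]
        have : ((2 : ℕ) : ℝ) * -p = -(2 * p) := by push_cast; ring
        rw [this]; ring

lemma summable_realTheta {a : ℝ} (ha : 0 < a) : Summable fun n : ℤ => Real.exp (-a * (n : ℝ) ^ 2) := by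
  have h := ((summable_one_add_abs_int_rpow (p := 2) (by norm_num)).mul_left
    ((1 : ℝ) ^ (1 : ℝ) * 4 ^ (1 : ℝ) * a ^ (-(1 : ℝ))))
  refine Summable.of_norm_bounded_eventually h ?_
  rw [Filter.eventually_cofinite]
  refine (Set.finite_singleton (0 : ℤ)).subset fun n hn => ?_
  by_contra h0
  apply hn
  rw [Real.norm_of_nonneg (Real.exp_pos _).le]
  simpa using exp_neg_mul_sq_le one_pos ha h0

lemma norm_thetaSum_term (s : ℂ) (n : ℤ) :
    ‖Complex.exp (-s * (n : ℂ) ^ 2)‖ = Real.exp (-s.re * (n : ℝ) ^ 2) := by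
  rw [Complex.norm_exp]
  have : ((n : ℂ) ^ 2) = (((n : ℝ) ^ 2 : ℝ) : ℂ) := by push_cast; rfl
  rw [this, Complex.re_mul_ofReal, Complex.neg_re]

lemma summable_norm_thetaSum {s : ℂ} (hs : 0 < s.re) :
    Summable fun n : ℤ => ‖Complex.exp (-s * (n : ℂ) ^ 2)‖ := by
  simpa only [norm_thetaSum_term] using summable_realTheta hs

lemma norm_thetaSum_le {s : ℂ} (hs : 0 < s.re) : ‖thetaSum s‖ ≤ realTheta s.re := by
  have := norm_tsum_le_tsum_norm (summable_norm_thetaSum hs)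
  rw [thetaSum, realTheta]
  simpa only [norm_thetaSum_term] using this

lemma realTheta_sub_one {a : ℝ} (ha : 0 < a) :
    realTheta a - 1 = ∑' n : ℤ, if n = 0 then 0 else Real.exp (-a * (n : ℝ) ^ 2) := by
  rw [realTheta, (summable_realTheta ha).tsum_eq_add_tsum_ite 0]
  simp

lemma norm_thetaSum_sub_one_le {s : ℂ} (hs : 0 < s.re) :
    ‖thetaSum s - 1‖ ≤ realTheta s.re - 1 := by
  rw [realTheta_sub_one hs, thetaSum, (summable_norm_thetaSum hs).of_norm.tsum_eq_add_tsum_ite 0]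
  have e : ∀ n : ℤ, ‖(if n = 0 then 0 else Complex.exp (-s * (n : ℂ) ^ 2) : ℂ)‖ =
      if n = 0 then 0 else Real.exp (-s.re * (n : ℝ) ^ 2) := by
    intro n
    split_ifs
    · simp
    · exact norm_thetaSum_term s n
  have hsum : Summable fun n : ℤ => ‖(if n = 0 then 0 else Complex.exp (-s * (n : ℂ) ^ 2) : ℂ)‖ := by
    refine Summable.of_nonneg_of_le (fun _ => norm_nonneg _) (fun n => ?_) (summable_norm_thetaSum hs)
    split_ifs <;> simp
  have := norm_tsum_le_tsum_norm hsum
  simp_rw [e] at this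
  simpa using this

lemma one_le_realTheta {a : ℝ} (ha : 0 < a) : 1 ≤ realTheta a := by
  have : 0 ≤ realTheta a - 1 := by
    rw [realTheta_sub_one ha]
    exact tsum_nonneg fun n => by split_ifs <;> positivity
  linarith

lemma realTheta_anti {a b : ℝ} (ha : 0 < a) (hab : a ≤ b) : realTheta b ≤ realTheta a := by
  refine Summable.tsum_le_tsum (fun n => ?_) (summable_realTheta (ha.trans_le hab))
    (summable_realTheta ha)
  apply Real.exp_le_exp.2
  nlinarith [sq_nonneg (n : ℝ)]

lemma realTheta_sub_one_le {p : ℝ} (hp : 1 / 2 < p) :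
    ∃ C : ℝ, 0 < C ∧ ∀ a : ℝ, 0 < a → realTheta a - 1 ≤ C * a ^ (-p) := by
  have hs := summable_one_add_abs_int_rpow (p := 2 * p) (by linarith)
  have hp0 : 0 < p := by linarith
  refine ⟨p ^ p * 4 ^ p * ∑' n : ℤ, (1 + |(n : ℝ)|) ^ (-(2 * p)), ?_, fun a ha => ?_⟩
  · have : 0 < ∑' n : ℤ, (1 + |(n : ℝ)|) ^ (-(2 * p)) :=
      hs.tsum_pos (fun _ => by positivity) 0 (by positivity)
    positivity
  · rw [realTheta_sub_one ha]
    have e : p ^ p * 4 ^ p * (∑' n : ℤ, (1 + |(n : ℝ)|) ^ (-(2 * p))) * a ^ (-p) =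
        ∑' n : ℤ, (p ^ p * 4 ^ p * a ^ (-p)) * (1 + |(n : ℝ)|) ^ (-(2 * p)) := by
      rw [tsum_mul_left]; ring
    rw [e]
    have hb : ∀ n : ℤ, (if n = 0 then 0 else Real.exp (-a * (n : ℝ) ^ 2)) ≤
        (p ^ p * 4 ^ p * a ^ (-p)) * (1 + |(n : ℝ)|) ^ (-(2 * p)) := by
      intro n
      split_ifs with h
      · positivity
      · exact exp_neg_mul_sq_le hp0 ha h
    refine Summable.tsum_le_tsum hb (Summable.of_nonneg_of_le (fun n => ?_) hb (hs.mul_left _))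
      (hs.mul_left _)
    split_ifs <;> positivity

lemma thetaSum_functional_equation {s : ℂ} (hs : 0 < s.re) :
    thetaSum s = 1 / (s / π) ^ (1 / 2 : ℂ) * thetaSum (π ^ 2 / s) := by
  have hpi : (π : ℂ) ≠ 0 := by exact_mod_cast Real.pi_ne_zero
  have hs0 : s ≠ 0 := by rintro rfl; simp at hs
  have h : 0 < (s / π).re := by
    rw [Complex.div_ofReal_re]; positivity
  have := Complex.tsum_exp_neg_mul_int_sq h
  have e1 : -(π : ℂ) * (s / π) = -s := by field_simp
  have e2 : -(π : ℂ) / (s / π) = -(π ^ 2 / s) := by field_simp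
  rw [e1, e2] at this
  exact this

lemma norm_thetaSum_functional_equation {s : ℂ} (hs : 0 < s.re) :
    ‖thetaSum s‖ = (π / ‖s‖) ^ (1 / 2 : ℝ) * ‖thetaSum (π ^ 2 / s)‖ := by
  have hs0 : s ≠ 0 := by rintro rfl; simp at hs
  have hsn : 0 < ‖s‖ := norm_pos_iff.2 hs0
  have hpi : (π : ℂ) ≠ 0 := by exact_mod_cast Real.pi_ne_zero
  rw [thetaSum_functional_equation hs, norm_mul, norm_div, norm_one]
  have : ‖(s / π) ^ (1 / 2 : ℂ)‖ = (‖s‖ / π) ^ (1 / 2 : ℝ) := by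
    have e : (1 / 2 : ℂ) = ((1 / 2 : ℝ) : ℂ) := by push_cast; rfl
    rw [e, Complex.norm_cpow_real, norm_div, Complex.norm_real, Real.norm_of_nonneg Real.pi_pos.le]
  rw [this, one_div, ← Real.inv_rpow (by positivity), inv_div]

lemma thetaSum_ofReal (a : ℝ) : thetaSum a = realTheta a := by
  simp only [thetaSum, realTheta]
  push_cast; rfl

lemma realTheta_functional_equation {a : ℝ} (ha : 0 < a) :
    realTheta a = (π / a) ^ (1 / 2 : ℝ) * realTheta (π ^ 2 / a) := by
  have h := norm_thetaSum_functional_equation (s := a) (by simpa using ha)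
  have e : (π : ℂ) ^ 2 / a = ((π ^ 2 / a : ℝ) : ℂ) := by push_cast; rfl
  rw [e, thetaSum_ofReal, thetaSum_ofReal, Complex.norm_real, Complex.norm_real, Complex.norm_real,
    Real.norm_of_nonneg ha.le, Real.norm_of_nonneg (zero_le_one.trans (one_le_realTheta ha)),
    Real.norm_of_nonneg (zero_le_one.trans (one_le_realTheta (by positivity)))] at h
  exact h

lemma realTheta_le (A : ℝ) (hA : 0 < A) :
    ∃ C : ℝ, 0 < C ∧ ∀ a : ℝ, 0 < a → a ≤ A → realTheta a ≤ C * a ^ (-(1 / 2) : ℝ) := by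
  have h1 := one_le_realTheta (a := π ^ 2 / A) (by positivity)
  refine ⟨π ^ (1 / 2 : ℝ) * realTheta (π ^ 2 / A), by positivity, fun a ha haA => ?_⟩
  rw [realTheta_functional_equation ha, Real.div_rpow Real.pi_pos.le ha.le, Real.rpow_neg ha.le,
    div_eq_mul_inv]
  have : realTheta (π ^ 2 / a) ≤ realTheta (π ^ 2 / A) :=
    realTheta_anti (by positivity) (by gcongr)
  calc _ ≤ π ^ (1 / 2 : ℝ) * (a ^ (1 / 2 : ℝ))⁻¹ * realTheta (π ^ 2 / A) := by gcongr
    _ = _ := by ring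

lemma thetaSum_add_period (s : ℂ) (j : ℕ) :
    thetaSum (s + (2 * π * j : ℝ) * Complex.I) = thetaSum s := by
  unfold thetaSum
  congr 1; ext n
  rw [Complex.exp_eq_exp_iff_exists_int]
  refine ⟨-(j * n ^ 2), ?_⟩
  push_cast; ring

lemma thetaSum_conj (s : ℂ) :
    thetaSum ((starRingEnd ℂ) s) = (starRingEnd ℂ) (thetaSum s) := by
  unfold thetaSum
  rw [Complex.conj_tsum]
  congr 1; ext n
  rw [← Complex.exp_conj]
  simp

lemma thetaSum_eq_jacobiTheta (s : ℂ) : thetaSum s = jacobiTheta (Complex.I * s / π) := by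
  have hpi : (π : ℂ) ≠ 0 := by exact_mod_cast Real.pi_ne_zero
  unfold thetaSum jacobiTheta
  congr 1; ext n
  congr 1
  field_simp
  rw [Complex.I_sq]; ring

lemma differentiableAt_thetaSum {s : ℂ} (hs : 0 < s.re) : DifferentiableAt ℂ thetaSum s := by
  have e : thetaSum = jacobiTheta ∘ fun s => Complex.I * s / π := by
    ext s; exact thetaSum_eq_jacobiTheta s
  rw [e]
  apply DifferentiableAt.comp
  · apply differentiableAt_jacobiTheta
    rw [Complex.div_ofReal_im]
    simp only [Complex.mul_im, Complex.I_re, Complex.I_im]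
    simp only [zero_mul, one_mul, zero_add]
    positivity
  · fun_prop

lemma thetaSum_sq {z : ℂ} (hz : 0 < z.re) :
    thetaSum z ^ 2 = ∑' A : ℤ × ℤ, Complex.exp (-z * normSqTwo A) := by
  rw [sq, thetaSum, tsum_mul_tsum_of_summable_norm (summable_norm_thetaSum hz)
    (summable_norm_thetaSum hz)]
  congr 1; ext A
  rw [← Complex.exp_add, show (normSqTwo A : ℂ) = (A.1 : ℂ) ^ 2 + (A.2 : ℂ) ^ 2 by
    exact_mod_cast congrArg (Int.cast : ℤ → ℂ) (normSqTwo_cast A)]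
  congr 1; ring

lemma norm_exp_neg_mul_natCast (z : ℂ) (n : ℕ) :
    ‖Complex.exp (-z * n)‖ = Real.exp (-z.re * n) := by
  rw [Complex.norm_exp, ← Complex.ofReal_natCast, Complex.re_mul_ofReal, Complex.neg_re]

lemma summable_exp_neg_normSqTwo {a : ℝ} (ha : 0 < a) :
    Summable fun A : ℤ × ℤ => Real.exp (-a * normSqTwo A) := by
  refine ((summable_realTheta ha).mul_of_nonneg (summable_realTheta ha)
    (fun _ => (Real.exp_pos _).le) (fun _ => (Real.exp_pos _).le)).congr fun A => ?_
  rw [← Real.exp_add, normSqTwo_cast_real]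
  congr 1; ring

lemma norm_thetaSum_pow_four {z : ℂ} (hz : 0 < z.re) :
    ((‖thetaSum z‖ ^ 4 : ℝ) : ℂ) = ∑' q : (ℤ × ℤ) × (ℤ × ℤ),
      Complex.exp (-z * normSqTwo q.1) * Complex.exp (-(starRingEnd ℂ) z * normSqTwo q.2) := by
  have h1 : ((‖thetaSum z‖ ^ 4 : ℝ) : ℂ) = thetaSum z ^ 2 * thetaSum ((starRingEnd ℂ) z) ^ 2 := by
    rw [thetaSum_conj, ← mul_pow, Complex.mul_conj, Complex.normSq_eq_norm_sq]
    push_cast; ring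
  have hs : ∀ w : ℂ, 0 < w.re → Summable fun A : ℤ × ℤ => ‖Complex.exp (-w * normSqTwo A)‖ :=
    fun w hw => by simpa only [norm_exp_neg_mul_natCast] using summable_exp_neg_normSqTwo hw
  have hz' : 0 < ((starRingEnd ℂ) z).re := by simpa using hz
  rw [h1, thetaSum_sq hz, thetaSum_sq hz', tsum_mul_tsum_of_summable_norm (hs z hz) (hs _ hz')]

/-- The weight `(y² - σ²) / ((σ² + y²)² y)`, which is comparable with `‖σ + iy‖⁻³` for
`y ≥ √σ`. -/
noncomputable def oscWeight (σ y : ℝ) : ℝ := (y ^ 2 - σ ^ 2) / ((σ ^ 2 + y ^ 2) ^ 2 * y)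

/-- The oscillating integrand with weight `oscWeight`, decay `M` and frequency `N`. -/
noncomputable def oscTerm (σ M N y : ℝ) : ℂ :=
  (oscWeight σ y : ℂ) * ((Real.exp (-(M * σ / (σ ^ 2 + y ^ 2))) : ℂ) *
    Complex.exp ((N * (y / (σ ^ 2 + y ^ 2)) : ℝ) * Complex.I))

lemma norm_oscTerm (σ M N y : ℝ) :
    ‖oscTerm σ M N y‖ = |oscWeight σ y| * Real.exp (-(M * σ / (σ ^ 2 + y ^ 2))) := by
  rw [oscTerm, norm_mul, norm_mul, Complex.norm_exp_ofReal_mul_I, Complex.norm_real,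
    Complex.norm_real, Real.norm_eq_abs, Real.norm_of_nonneg (Real.exp_pos _).le, mul_one]

lemma continuousOn_oscTerm (σ M N : ℝ) : ContinuousOn (oscTerm σ M N) (Set.Ioi 0) := by
  have h : ∀ y ∈ Set.Ioi (0 : ℝ), σ ^ 2 + y ^ 2 ≠ 0 := fun y hy => by
    have : (0 : ℝ) < y := hy
    positivity
  have h2 : ∀ y ∈ Set.Ioi (0 : ℝ), (σ ^ 2 + y ^ 2) ^ 2 * y ≠ 0 := fun y hy => by
    have : (0 : ℝ) < y := hy
    positivity
  unfold oscTerm oscWeight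
  refine ContinuousOn.mul (Complex.continuous_ofReal.comp_continuousOn ?_) (ContinuousOn.mul
    (Complex.continuous_ofReal.comp_continuousOn ?_) ?_)
  · exact ContinuousOn.div (by fun_prop) (by fun_prop) h2
  · exact Real.continuous_exp.comp_continuousOn
      (ContinuousOn.div (by fun_prop) (by fun_prop) h).neg
  · refine Complex.continuous_exp.comp_continuousOn (ContinuousOn.mul
      (Complex.continuous_ofReal.comp_continuousOn ?_) (by fun_prop))
    exact ContinuousOn.mul (by fun_prop) (ContinuousOn.div (by fun_prop) (by fun_prop) h)

lemma sq_le_quarter_of_sqrt_le {σ y : ℝ} (h0 : 0 < σ) (h1 : σ ≤ 1 / 4) (hy : √σ ≤ y) :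
    0 < y ∧ σ ≤ y ^ 2 ∧ σ ^ 2 ≤ y ^ 2 / 4 := by
  have hs : 0 < √σ := Real.sqrt_pos.2 h0
  have hy0 : 0 < y := hs.trans_le hy
  have h2 : σ ≤ y ^ 2 := by
    calc σ = √σ ^ 2 := (Real.sq_sqrt h0.le).symm
      _ ≤ y ^ 2 := by gcongr
  exact ⟨hy0, h2, by nlinarith⟩

lemma oscWeight_nonneg {σ y : ℝ} (h0 : 0 < σ) (h1 : σ ≤ 1 / 4) (hy : √σ ≤ y) :
    0 ≤ oscWeight σ y := by
  obtain ⟨a, b, c⟩ := sq_le_quarter_of_sqrt_le h0 h1 hy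
  exact div_nonneg (by nlinarith) (by positivity)

lemma oscWeight_le {σ y : ℝ} (h0 : 0 < σ) (h1 : σ ≤ 1 / 4) (hy : √σ ≤ y) :
    oscWeight σ y ≤ 1 / y ^ 3 := by
  obtain ⟨a, b, c⟩ := sq_le_quarter_of_sqrt_le h0 h1 hy
  unfold oscWeight
  rw [div_le_div_iff₀ (by positivity) (by positivity)]
  have : y ^ 4 ≤ (σ ^ 2 + y ^ 2) ^ 2 := by nlinarith [sq_nonneg σ, sq_nonneg y, mul_nonneg (sq_nonneg σ) (sq_nonneg y)]
  nlinarith [mul_le_mul_of_nonneg_right this a.le, mul_nonneg (sq_nonneg σ) (pow_pos a 3).le]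

lemma one_div_norm_cube_le {σ y : ℝ} (h0 : 0 < σ) (h1 : σ ≤ 1 / 4) (hy : √σ ≤ y) :
    1 / ‖(σ + y * Complex.I : ℂ)‖ ^ 3 ≤ 2 * oscWeight σ y := by
  obtain ⟨a, b, c⟩ := sq_le_quarter_of_sqrt_le h0 h1 hy
  have hn : ‖(σ + y * Complex.I : ℂ)‖ ^ 2 = σ ^ 2 + y ^ 2 := by
    rw [← Complex.normSq_eq_norm_sq, Complex.normSq_add_mul_I]
  have hpos : 0 < ‖(σ + y * Complex.I : ℂ)‖ := by
    by_contra h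
    have : ‖(σ + y * Complex.I : ℂ)‖ = 0 := le_antisymm (not_lt.1 h) (norm_nonneg _)
    rw [this] at hn; nlinarith
  set r := ‖(σ + y * Complex.I : ℂ)‖
  have hr : r ≤ 3 / 2 * y := by
    refine (pow_le_pow_iff_left₀ hpos.le (by positivity) two_ne_zero).1 ?_
    rw [hn]; nlinarith
  unfold oscWeight
  rw [← hn, ← mul_div_assoc, div_le_div_iff₀ (by positivity) (by positivity)]
  have : r * y ≤ 2 * (y ^ 2 - σ ^ 2) := by nlinarith
  calc 1 * ((r ^ 2) ^ 2 * y) = r ^ 3 * (r * y) := by ring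
    _ ≤ r ^ 3 * (2 * (y ^ 2 - σ ^ 2)) := by gcongr
    _ = _ := by ring

lemma exists_add_mul_exp_neg_le {p : ℝ} (hp : 0 < p) :
    ∃ C : ℝ, 0 < C ∧ ∀ x : ℝ, 0 < x → (2 + 2 * x) * Real.exp (-x) ≤ C * x ^ (-p) := by
  refine ⟨2 * p ^ p + 2 * (p + 1) ^ (p + 1), by positivity, fun x hx => ?_⟩
  have h1 := exp_neg_le_rpow hp hx
  have h2 := exp_neg_le_rpow (by linarith : 0 < p + 1) hx
  have e : x * x ^ (-(p + 1)) = x ^ (-p) := by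
    rw [show -p = 1 + -(p + 1) by ring, Real.rpow_add hx, Real.rpow_one]
  calc (2 + 2 * x) * Real.exp (-x) = 2 * Real.exp (-x) + 2 * x * Real.exp (-x) := by ring
    _ ≤ 2 * (p ^ p * x ^ (-p)) + 2 * x * ((p + 1) ^ (p + 1) * x ^ (-(p + 1))) := by gcongr
    _ = 2 * (p ^ p * x ^ (-p)) + 2 * (p + 1) ^ (p + 1) * (x * x ^ (-(p + 1))) := by ring
    _ = _ := by rw [e]; ring

/-- Bound for `(2 + 2 x) e^{-x}` with `x = Mσ/q`. -/
lemma exists_add_mul_exp_neg_div_le {p : ℝ} (hp : 0 < p) :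
    ∃ C : ℝ, 0 < C ∧ ∀ x q : ℝ, 0 < x → 0 < q →
      (2 + 2 * (x / q)) * Real.exp (-(x / q)) ≤ C * x ^ (-p) * q ^ p := by
  obtain ⟨C, hC, h⟩ := exists_add_mul_exp_neg_le hp
  refine ⟨C, hC, fun x q hx hq => (h _ (div_pos hx hq)).trans_eq ?_⟩
  rw [Real.div_rpow hx.le hq.le, Real.rpow_neg hq.le, div_inv_eq_mul]; ring

/-- The amplitude of the oscillating integrand after integration by parts. -/
noncomputable def oscAmplitude (σ M y : ℝ) : ℝ := Real.exp (-(M * σ / (σ ^ 2 + y ^ 2))) / y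

lemma hasDerivAt_oscAmplitude {σ M y : ℝ} (hy : 0 < y) :
    HasDerivAt (oscAmplitude σ M) (Real.exp (-(M * σ / (σ ^ 2 + y ^ 2))) *
      (2 * (M * σ) / (σ ^ 2 + y ^ 2) ^ 2 - 1 / y ^ 2)) y := by
  have hq : σ ^ 2 + y ^ 2 ≠ 0 := by positivity
  have h1 : HasDerivAt (fun y : ℝ => σ ^ 2 + y ^ 2) (2 * y) y := by
    simpa using (hasDerivAt_pow 2 y).const_add (σ ^ 2)
  have h2 := (((hasDerivAt_const y (M * σ)).div h1 hq).neg.exp).div (hasDerivAt_id y) hy.ne'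
  refine h2.congr_deriv ?_
  simp only [Pi.neg_apply, Pi.div_apply, id]
  field_simp
  ring

lemma hasDerivAt_oscPhase {σ N y : ℝ} (hy : 0 < y) :
    HasDerivAt (fun y : ℝ => Complex.exp ((N * (y / (σ ^ 2 + y ^ 2)) : ℝ) * Complex.I))
      (Complex.exp ((N * (y / (σ ^ 2 + y ^ 2)) : ℝ) * Complex.I) *
        ((N * ((σ ^ 2 - y ^ 2) / (σ ^ 2 + y ^ 2) ^ 2) : ℝ) * Complex.I)) y := by
  have hq : σ ^ 2 + y ^ 2 ≠ 0 := by positivity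
  have h1 : HasDerivAt (fun y : ℝ => σ ^ 2 + y ^ 2) (2 * y) y := by
    simpa using (hasDerivAt_pow 2 y).const_add (σ ^ 2)
  have h2 : HasDerivAt (fun y : ℝ => N * (y / (σ ^ 2 + y ^ 2)))
      (N * ((σ ^ 2 - y ^ 2) / (σ ^ 2 + y ^ 2) ^ 2)) y := by
    refine (((hasDerivAt_id y).div h1 hq).const_mul N).congr_deriv ?_
    simp only [id]
    congr 2; ring
  exact (h2.ofReal_comp.mul_const Complex.I).cexp

lemma oscTerm_eq {σ M N y : ℝ} (hN : N ≠ 0) (hy : 0 < y) :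
    oscTerm σ M N y = (Complex.I / N) * ((oscAmplitude σ M y : ℂ) *
      (Complex.exp ((N * (y / (σ ^ 2 + y ^ 2)) : ℝ) * Complex.I) *
        ((N * ((σ ^ 2 - y ^ 2) / (σ ^ 2 + y ^ 2) ^ 2) : ℝ) * Complex.I))) := by
  have hq : (σ : ℂ) ^ 2 + (y : ℂ) ^ 2 ≠ 0 := by
    have : σ ^ 2 + y ^ 2 ≠ 0 := by positivity
    exact_mod_cast this
  have hN' : (N : ℂ) ≠ 0 := by exact_mod_cast hN
  have hy' : (y : ℂ) ≠ 0 := by exact_mod_cast hy.ne'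
  unfold oscTerm oscAmplitude oscWeight
  generalize Complex.exp ((N * (y / (σ ^ 2 + y ^ 2)) : ℝ) * Complex.I) = E
  generalize Real.exp (-(M * σ / (σ ^ 2 + y ^ 2))) = E'
  push_cast
  field_simp
  rw [Complex.I_sq]; ring

lemma norm_integral_oscTerm_le_of_ne {p : ℝ} (hp : 1 ≤ p) :
    ∃ C : ℝ, 0 < C ∧ ∀ σ M N : ℝ, 0 < σ → σ ≤ 1 / 4 → 0 < M → N ≠ 0 →
      ‖∫ y in (√σ)..9, oscTerm σ M N y‖ ≤ C * (M * σ) ^ (-p) / |N| := by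
  obtain ⟨C, hC, hb⟩ := exists_add_mul_exp_neg_div_le (by linarith : 0 < p)
  set K := C * 82 ^ (p - 1) with hK
  have hK0 : 0 < K := by positivity
  refine ⟨50 * K, by positivity, fun σ M N h0 h1 hM hN => ?_⟩
  have hMσ : 0 < M * σ := by positivity
  set B := K * (M * σ) ^ (-p) with hB
  have hB0 : 0 < B := by positivity
  have hle : √σ ≤ 9 := by
    rw [Real.sqrt_le_left (by norm_num)]; linarith
  have huIcc : Set.uIcc (√σ) 9 = Set.Icc (√σ) 9 := Set.uIcc_of_le hle
  have key : ∀ y ∈ Set.Icc (√σ) 9, (2 + 2 * (M * σ / (σ ^ 2 + y ^ 2))) *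
      Real.exp (-(M * σ / (σ ^ 2 + y ^ 2))) ≤ B * (σ ^ 2 + y ^ 2) := by
    intro y hy
    obtain ⟨a, b, c⟩ := sq_le_quarter_of_sqrt_le h0 h1 hy.1
    have hq : 0 < σ ^ 2 + y ^ 2 := by positivity
    have hq' : σ ^ 2 + y ^ 2 ≤ 82 := by nlinarith [hy.2]
    refine (hb _ _ hMσ hq).trans ?_
    calc C * (M * σ) ^ (-p) * (σ ^ 2 + y ^ 2) ^ p
        = C * (M * σ) ^ (-p) * ((σ ^ 2 + y ^ 2) ^ (p - 1) * (σ ^ 2 + y ^ 2)) := by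
          rw [← Real.rpow_add_one hq.ne', sub_add_cancel]
      _ ≤ C * (M * σ) ^ (-p) * (82 ^ (p - 1) * (σ ^ 2 + y ^ 2)) := by
          gcongr
      _ = _ := by rw [hB, hK]; ring
  have hamp : ∀ y ∈ Set.Icc (√σ) 9, |oscAmplitude σ M y| ≤ 12 * B := by
    intro y hy
    obtain ⟨a, b, c⟩ := sq_le_quarter_of_sqrt_le h0 h1 hy.1
    unfold oscAmplitude
    rw [abs_of_nonneg (by positivity), div_le_iff₀ a]
    have hx : 0 < M * σ / (σ ^ 2 + y ^ 2) := by positivity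
    have := key y hy
    have hE := Real.exp_pos (-(M * σ / (σ ^ 2 + y ^ 2)))
    have h3 : B * (σ ^ 2 + y ^ 2) ≤ B * (12 * y) := by
      gcongr; nlinarith [hy.2]
    nlinarith [mul_pos hx hE]
  have hder : ∀ y ∈ Set.Icc (√σ) 9, |Real.exp (-(M * σ / (σ ^ 2 + y ^ 2))) *
      (2 * (M * σ) / (σ ^ 2 + y ^ 2) ^ 2 - 1 / y ^ 2)| ≤ B := by
    intro y hy
    obtain ⟨a, b, c⟩ := sq_le_quarter_of_sqrt_le h0 h1 hy.1
    have hq : 0 < σ ^ 2 + y ^ 2 := by positivity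
    have hE := Real.exp_pos (-(M * σ / (σ ^ 2 + y ^ 2)))
    rw [abs_mul, abs_of_pos hE]
    have h4 : |2 * (M * σ) / (σ ^ 2 + y ^ 2) ^ 2 - 1 / y ^ 2| ≤
        (2 + 2 * (M * σ / (σ ^ 2 + y ^ 2))) / (σ ^ 2 + y ^ 2) := by
      refine (abs_sub _ _).trans ?_
      rw [abs_of_nonneg (by positivity), abs_of_nonneg (by positivity), add_div, add_comm]
      refine add_le_add ?_ (le_of_eq (by field_simp))
      rw [div_le_div_iff₀ (by positivity) hq]; nlinarith
    calc _ ≤ Real.exp (-(M * σ / (σ ^ 2 + y ^ 2))) *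
          ((2 + 2 * (M * σ / (σ ^ 2 + y ^ 2))) / (σ ^ 2 + y ^ 2)) := by gcongr
      _ = ((2 + 2 * (M * σ / (σ ^ 2 + y ^ 2))) *
        Real.exp (-(M * σ / (σ ^ 2 + y ^ 2)))) / (σ ^ 2 + y ^ 2) := by ring
      _ ≤ B := by rw [div_le_iff₀ hq]; exact key y hy
  have hpos : ∀ y ∈ Set.uIcc (√σ) 9, 0 < y := fun y hy => by
    rw [huIcc] at hy
    exact (sq_le_quarter_of_sqrt_le h0 h1 hy.1).1
  have hcongr : ∫ y in (√σ)..9, oscTerm σ M N y = (Complex.I / N) * ∫ y in (√σ)..9,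
      (oscAmplitude σ M y : ℂ) *
      (Complex.exp ((N * (y / (σ ^ 2 + y ^ 2)) : ℝ) * Complex.I) *
        ((N * ((σ ^ 2 - y ^ 2) / (σ ^ 2 + y ^ 2) ^ 2) : ℝ) * Complex.I)) := by
    rw [← intervalIntegral.integral_const_mul]
    exact intervalIntegral.integral_congr fun y hy => oscTerm_eq hN (hpos y hy)
  have hqne : ∀ y ∈ Set.uIcc (√σ) 9, σ ^ 2 + y ^ 2 ≠ 0 := fun y hy => by
    have := hpos y hy; positivity
  have hparts := intervalIntegral.integral_mul_deriv_eq_deriv_mul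
    (a := √σ) (b := 9)
    (u := fun y => (oscAmplitude σ M y : ℂ))
    (v := fun y : ℝ => Complex.exp ((N * (y / (σ ^ 2 + y ^ 2)) : ℝ) * Complex.I))
    (fun y hy => (hasDerivAt_oscAmplitude (hpos y hy)).ofReal_comp)
    (fun y hy => hasDerivAt_oscPhase (hpos y hy))
    (ContinuousOn.intervalIntegrable (Complex.continuous_ofReal.comp_continuousOn (by
      refine ContinuousOn.mul (Real.continuous_exp.comp_continuousOn
        (ContinuousOn.div (by fun_prop) (by fun_prop) hqne).neg) (ContinuousOn.sub
        (ContinuousOn.div (by fun_prop) (by fun_prop) fun y hy => pow_ne_zero _ (hqne y hy))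
        (ContinuousOn.div (by fun_prop) (by fun_prop) fun y hy =>
          pow_ne_zero _ (hpos y hy).ne')))))
    (ContinuousOn.intervalIntegrable (by
      refine ContinuousOn.mul (Complex.continuous_exp.comp_continuousOn (ContinuousOn.mul
        (Complex.continuous_ofReal.comp_continuousOn (ContinuousOn.mul (by fun_prop)
          (ContinuousOn.div (by fun_prop) (by fun_prop) hqne))) (by fun_prop)))
        (ContinuousOn.mul (Complex.continuous_ofReal.comp_continuousOn (ContinuousOn.mul
          (by fun_prop) (ContinuousOn.div (by fun_prop) (by fun_prop)
            fun y hy => pow_ne_zero _ (hqne y hy)))) (by fun_prop))))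
  rw [hcongr, hparts, norm_mul, norm_div, Complex.norm_I, Complex.norm_real, Real.norm_eq_abs]
  have hmem1 : (9 : ℝ) ∈ Set.Icc (√σ) 9 := ⟨hle, le_rfl⟩
  have hmem2 : √σ ∈ Set.Icc (√σ) 9 := ⟨le_rfl, hle⟩
  have hInt := intervalIntegral.norm_integral_le_of_norm_le_const (a := √σ) (b := 9) (C := B)
    (f := fun y => ((Real.exp (-(M * σ / (σ ^ 2 + y ^ 2))) *
      (2 * (M * σ) / (σ ^ 2 + y ^ 2) ^ 2 - 1 / y ^ 2) : ℝ) : ℂ) *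
      Complex.exp ((N * (y / (σ ^ 2 + y ^ 2)) : ℝ) * Complex.I)) (fun y hy => by
        rw [Set.uIoc_of_le hle] at hy
        rw [norm_mul, Complex.norm_exp_ofReal_mul_I, mul_one, Complex.norm_real]
        exact hder y ⟨hy.1.le, hy.2⟩)
  have h9 : |9 - √σ| ≤ 9 := by
    rw [abs_of_nonneg (by linarith)]; linarith [Real.sqrt_nonneg σ]
  have hfin : ∀ a b c : ℂ, ‖a‖ ≤ 12 * B → ‖b‖ ≤ 12 * B → ‖c‖ ≤ B * |9 - √σ| →
      ‖a - b - c‖ ≤ 50 * B := by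
    intro a b c ha hb' hc
    have := norm_sub_le (a - b) c
    have := norm_sub_le a b
    have : B * |9 - √σ| ≤ B * 9 := by gcongr
    linarith
  have hA : ∀ y ∈ Set.Icc (√σ) 9, ∀ w : ℝ,
      ‖(oscAmplitude σ M y : ℂ) * Complex.exp (w * Complex.I)‖ ≤ 12 * B := fun y hy w => by
    rw [norm_mul, Complex.norm_exp_ofReal_mul_I, mul_one, Complex.norm_real]
    exact hamp y hy
  calc 1 / |N| * _ ≤ 1 / |N| * (50 * B) :=
        mul_le_mul_of_nonneg_left (hfin _ _ _ (hA 9 hmem1 _) (hA _ hmem2 _) hInt) (by positivity)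
    _ = _ := by rw [hB]; ring

lemma integral_sqrt_pow_neg_three_le {σ : ℝ} (h0 : 0 < σ) (h1 : σ ≤ 1 / 4) :
    ∫ y in (√σ)..9, 1 / y ^ 3 ≤ σ⁻¹ := by
  have hs : 0 < √σ := Real.sqrt_pos.2 h0
  have hle : √σ ≤ 9 := by
    rw [Real.sqrt_le_left (by norm_num)]; linarith
  have hpos : ∀ y ∈ Set.uIcc (√σ) 9, 0 < y := fun y hy => by
    rw [Set.uIcc_of_le hle] at hy
    exact hs.trans_le hy.1
  rw [intervalIntegral.integral_eq_sub_of_hasDerivAt (f := fun y => -(1 / (2 * y ^ 2)))]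
  · have e : (√σ) ^ 2 = σ := Real.sq_sqrt h0.le
    rw [e]
    have : 1 / (2 * σ) ≤ σ⁻¹ := by
      rw [one_div]; exact inv_anti₀ h0 (by linarith)
    norm_num
    norm_num at this
    linarith
  · intro y hy
    have hy := hpos y hy
    refine (((hasDerivAt_const y (1 : ℝ)).div ((hasDerivAt_pow 2 y).const_mul 2)
      (by positivity)).neg).congr_deriv ?_
    simp only [Nat.cast_ofNat]
    field_simp
    ring
  · refine ContinuousOn.intervalIntegrable (ContinuousOn.div (by fun_prop) (by fun_prop) fun y hy =>
      pow_ne_zero _ (hpos y hy).ne')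

lemma norm_integral_oscTerm_le_of_zero {p : ℝ} (hp : 1 < p) :
    ∃ C : ℝ, 0 < C ∧ ∀ σ M : ℝ, 0 < σ → σ ≤ 1 / 4 → 0 < M →
      ‖∫ y in (√σ)..9, oscTerm σ M 0 y‖ ≤ C * (M * σ) ^ (-p) := by
  obtain ⟨C, hC, hb⟩ := exists_add_mul_exp_neg_div_le (by linarith : 0 < p)
  have hI : IntervalIntegrable (fun y : ℝ => y ^ (2 * p - 3)) MeasureTheory.volume 0 9 :=
    intervalIntegral.intervalIntegrable_rpow' (by linarith)
  have hI0 : 0 ≤ ∫ y in (0 : ℝ)..9, y ^ (2 * p - 3) :=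
    intervalIntegral.integral_nonneg (by norm_num) fun y hy => by
      have := hy.1; positivity
  refine ⟨C * (2 ^ p) * ((∫ y in (0 : ℝ)..9, y ^ (2 * p - 3)) + 1), by positivity,
    fun σ M h0 h1 hM => ?_⟩
  have hMσ : 0 < M * σ := by positivity
  have hs : 0 < √σ := Real.sqrt_pos.2 h0
  have hle : √σ ≤ 9 := by
    rw [Real.sqrt_le_left (by norm_num)]; linarith
  have hb' : ∀ y ∈ Set.Icc (√σ) 9, ‖oscTerm σ M 0 y‖ ≤
      C * 2 ^ p * (M * σ) ^ (-p) * y ^ (2 * p - 3) := by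
    intro y hy
    obtain ⟨a, b, c⟩ := sq_le_quarter_of_sqrt_le h0 h1 hy.1
    have hq : 0 < σ ^ 2 + y ^ 2 := by positivity
    rw [norm_oscTerm, abs_of_nonneg (oscWeight_nonneg h0 h1 hy.1)]
    have hE := Real.exp_pos (-(M * σ / (σ ^ 2 + y ^ 2)))
    have hx : 0 < M * σ / (σ ^ 2 + y ^ 2) := by positivity
    have h2 : (σ ^ 2 + y ^ 2) ^ p ≤ 2 ^ p * (y ^ p * y ^ p) := by
      rw [← Real.mul_rpow a.le a.le, ← Real.mul_rpow (by norm_num) (by positivity)]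
      exact Real.rpow_le_rpow hq.le (by nlinarith) (by linarith)
    have h3 : Real.exp (-(M * σ / (σ ^ 2 + y ^ 2))) ≤ C * (M * σ) ^ (-p) * (2 ^ p * (y ^ p * y ^ p)) := by
      refine le_trans ?_ ((hb _ _ hMσ hq).trans (by gcongr))
      nlinarith [mul_pos hx hE]
    calc _ ≤ 1 / y ^ 3 * (C * (M * σ) ^ (-p) * (2 ^ p * (y ^ p * y ^ p))) := by
          gcongr
          exact oscWeight_le h0 h1 hy.1
      _ = C * 2 ^ p * (M * σ) ^ (-p) * (y ^ p * y ^ p / y ^ 3) := by ring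
      _ = _ := by
          rw [← Real.rpow_add a, ← Real.rpow_natCast y 3, ← Real.rpow_sub a]
          congr 2; push_cast; ring
  have hsub : Set.uIcc (√σ) 9 ⊆ Set.uIcc 0 9 := by
    rw [Set.uIcc_of_le hle, Set.uIcc_of_le (by norm_num)]
    exact Set.Icc_subset_Icc_left hs.le
  refine (intervalIntegral.norm_integral_le_of_norm_le hle
    (Filter.Eventually.of_forall fun y hy => hb' y ⟨hy.1.le, hy.2⟩)
    ((hI.mono_set hsub).const_mul _)).trans ?_
  rw [intervalIntegral.integral_const_mul]
  have h4 : ∫ y in (√σ)..9, y ^ (2 * p - 3) ≤ ∫ y in (0 : ℝ)..9, y ^ (2 * p - 3) := by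
    refine intervalIntegral.integral_mono_interval hs.le hle le_rfl ?_ hI
    filter_upwards [MeasureTheory.ae_restrict_mem measurableSet_Ioc] with y hy
    have := hy.1
    simp only [Pi.zero_apply]
    positivity
  calc _ ≤ C * 2 ^ p * (M * σ) ^ (-p) * ((∫ y in (0 : ℝ)..9, y ^ (2 * p - 3)) + 1) := by
        gcongr; linarith
    _ = _ := by ring

lemma norm_integral_oscTerm_zero_zero_le {σ : ℝ} (h0 : 0 < σ) (h1 : σ ≤ 1 / 4) :
    ‖∫ y in (√σ)..9, oscTerm σ 0 0 y‖ ≤ σ⁻¹ := by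
  have hs : 0 < √σ := Real.sqrt_pos.2 h0
  have hle : √σ ≤ 9 := by
    rw [Real.sqrt_le_left (by norm_num)]; linarith
  refine (intervalIntegral.norm_integral_le_of_norm_le hle (g := fun y => 1 / y ^ 3)
    (Filter.Eventually.of_forall fun y hy => ?_) ?_).trans (integral_sqrt_pow_neg_three_le h0 h1)
  · rw [norm_oscTerm, abs_of_nonneg (oscWeight_nonneg h0 h1 hy.1.le)]
    simpa using oscWeight_le h0 h1 hy.1.le
  · refine ContinuousOn.intervalIntegrable (ContinuousOn.div (by fun_prop) (by fun_prop)
      fun y hy => ?_)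
    rw [Set.uIcc_of_le hle] at hy
    exact pow_ne_zero _ (hs.trans_le hy.1).ne'

lemma norm_integral_oscTerm_le {η : ℝ} (hη : 0 < η) :
    ∃ C : ℝ, 0 < C ∧ ∀ σ : ℝ, 0 < σ → σ ≤ 1 / 4 → ∀ n m : ℕ,
      ‖∫ y in (√σ)..9, oscTerm σ (π ^ 2 * (n + m)) (π ^ 2 * ((n : ℝ) - m)) y‖ ≤
        C * σ ^ (-(1 + η)) * pairWeight η n m := by
  obtain ⟨C1, hC1, hb1⟩ := norm_integral_oscTerm_le_of_ne (p := 1 + η) (by linarith)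
  obtain ⟨C2, hC2, hb2⟩ := norm_integral_oscTerm_le_of_zero (p := 1 + η) (by linarith)
  refine ⟨C1 + C2 + 1, by positivity, fun σ h0 h1 n m => ?_⟩
  have hpi : (2 : ℝ) ≤ π ^ 2 := by nlinarith [Real.pi_gt_three]
  have hσp : 0 < σ ^ (-(1 + η)) := by positivity
  rcases Nat.eq_zero_or_pos (n + m) with h | h
  · obtain ⟨rfl, rfl⟩ : n = 0 ∧ m = 0 := by omega
    have e : pairWeight η 0 0 = 1 := by simp [pairWeight]
    rw [e]
    have h3 := norm_integral_oscTerm_zero_zero_le h0 h1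
    simp only [Nat.cast_zero, add_zero, sub_zero, mul_zero]
    refine h3.trans ?_
    have : σ⁻¹ ≤ σ ^ (-(1 + η)) := by
      rw [← Real.rpow_neg_one]
      exact Real.rpow_le_rpow_of_exponent_ge h0 (by linarith) (by linarith)
    nlinarith
  · have hnm : (1 : ℝ) ≤ n + m := by exact_mod_cast h
    have hM : 1 + (n : ℝ) + m ≤ π ^ 2 * (n + m) := by nlinarith
    have hM0 : 0 < 1 + (n : ℝ) + m := by linarith
    have hMσ : (π ^ 2 * (n + m) * σ) ^ (-(1 + η)) ≤ (1 + (n : ℝ) + m) ^ (-(1 + η)) * σ ^ (-(1 + η)) := by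
      rw [Real.mul_rpow (by linarith) h0.le]
      gcongr ?_ * _
      exact Real.rpow_le_rpow_of_nonpos hM0 hM (by linarith)
    by_cases hne : n = m
    · subst hne
      have h3 := hb2 σ (π ^ 2 * (n + n)) h0 h1 (by linarith)
      rw [sub_self, mul_zero]
      refine h3.trans ?_
      have e : pairWeight η n n = (1 + (n : ℝ) + n) ^ (-(1 + η)) := by simp [pairWeight]
      rw [e]
      calc _ ≤ C2 * ((1 + (n : ℝ) + n) ^ (-(1 + η)) * σ ^ (-(1 + η))) := by gcongr
        _ ≤ (C1 + C2 + 1) * ((1 + (n : ℝ) + n) ^ (-(1 + η)) * σ ^ (-(1 + η))) := by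
          gcongr; linarith
        _ = _ := by ring
    · have hd : (1 : ℝ) ≤ |(n : ℝ) - m| := by
        have : (1 : ℤ) ≤ |(n : ℤ) - m| := Int.one_le_abs (by omega)
        exact_mod_cast this
      have hN : π ^ 2 * ((n : ℝ) - m) ≠ 0 := by
        intro h4
        rw [mul_eq_zero] at h4
        rcases h4 with h4 | h4
        · linarith
        · rw [h4] at hd; norm_num at hd
      have h3 := hb1 σ (π ^ 2 * (n + m)) (π ^ 2 * ((n : ℝ) - m)) h0 h1 (by linarith) hN
      refine h3.trans ?_
      have hN2 : 1 + |(n : ℝ) - m| ≤ |π ^ 2 * ((n : ℝ) - m)| := by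
        rw [abs_mul, abs_of_nonneg (sq_nonneg π)]; nlinarith
      unfold pairWeight
      calc _ ≤ C1 * ((1 + (n : ℝ) + m) ^ (-(1 + η)) * σ ^ (-(1 + η))) / (1 + |(n : ℝ) - m|) := by
            gcongr
        _ ≤ (C1 + C2 + 1) * ((1 + (n : ℝ) + m) ^ (-(1 + η)) * σ ^ (-(1 + η))) /
            (1 + |(n : ℝ) - m|) := by
          gcongr; linarith
        _ = _ := by ring

lemma re_pi_sq_div (σ y : ℝ) :
    ((π : ℂ) ^ 2 / (σ + y * Complex.I)).re = π ^ 2 * σ / (σ ^ 2 + y ^ 2) := by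
  have e : ((π : ℂ) ^ 2) = ((π ^ 2 : ℝ) : ℂ) := by push_cast; rfl
  rw [e, Complex.div_re, Complex.normSq_add_mul_I]
  generalize π ^ 2 = c
  simp

lemma im_pi_sq_div (σ y : ℝ) :
    ((π : ℂ) ^ 2 / (σ + y * Complex.I)).im = -(π ^ 2 * y / (σ ^ 2 + y ^ 2)) := by
  have e : ((π : ℂ) ^ 2) = ((π ^ 2 : ℝ) : ℂ) := by push_cast; rfl
  rw [e, Complex.div_im, Complex.normSq_add_mul_I]
  generalize π ^ 2 = c
  simp

lemma oscWeight_mul_exp_mul_exp (σ y : ℝ) (n m : ℕ) :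
    (oscWeight σ y : ℂ) * (Complex.exp (-((π : ℂ) ^ 2 / (σ + y * Complex.I)) * n) *
      Complex.exp (-(starRingEnd ℂ) ((π : ℂ) ^ 2 / (σ + y * Complex.I)) * m)) =
    oscTerm σ (π ^ 2 * (n + m)) (π ^ 2 * ((n : ℝ) - m)) y := by
  rw [oscTerm, ← Complex.exp_add, Complex.ofReal_exp, ← Complex.exp_add]
  congr 2
  have h1 := re_pi_sq_div σ y
  have h2 := im_pi_sq_div σ y
  generalize (π : ℂ) ^ 2 / (σ + y * Complex.I) = z at h1 h2
  generalize hA : π ^ 2 * (n + m) * σ / (σ ^ 2 + y ^ 2) = A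
  generalize hB : π ^ 2 * ((n : ℝ) - m) * (y / (σ ^ 2 + y ^ 2)) = B
  apply Complex.ext
  · simp [h1]
    rw [← hA]; ring
  · simp [h2]
    rw [← hB]; ring

lemma norm_oscTerm_le {σ y : ℝ} (h0 : 0 < σ) (h1 : σ ≤ 1 / 4) (hy : y ∈ Set.Ioc (√σ) 9)
    (n m : ℕ) :
    ‖oscTerm σ (π ^ 2 * (n + m)) (π ^ 2 * ((n : ℝ) - m)) y‖ ≤ (1 / (√σ) ^ 3) *
      (Real.exp (-(π ^ 2 * σ / 82) * n) * Real.exp (-(π ^ 2 * σ / 82) * m)) := by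
  have hs : 0 < √σ := Real.sqrt_pos.2 h0
  obtain ⟨a, b, d⟩ := sq_le_quarter_of_sqrt_le h0 h1 hy.1.le
  rw [norm_oscTerm, abs_of_nonneg (oscWeight_nonneg h0 h1 hy.1.le), ← Real.exp_add]
  have h2 : 1 / y ^ 3 ≤ 1 / (√σ) ^ 3 := by
    gcongr
    exact hy.1.le
  have h3 : σ ^ 2 + y ^ 2 ≤ 82 := by nlinarith [hy.2]
  have hnn : (0 : ℝ) ≤ (n : ℝ) + m := by positivity
  have h4 : π ^ 2 * ((n : ℝ) + m) * σ / 82 ≤ π ^ 2 * ((n : ℝ) + m) * σ / (σ ^ 2 + y ^ 2) :=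
    div_le_div_of_nonneg_left (by positivity) (by positivity) h3
  refine mul_le_mul ((oscWeight_le h0 h1 hy.1.le).trans h2) (Real.exp_le_exp.2 ?_)
    (Real.exp_pos _).le (by positivity)
  calc _ ≤ -(π ^ 2 * ((n : ℝ) + m) * σ / 82) := neg_le_neg h4
    _ = _ := by ring

lemma summable_exp_mul_exp_conj {z : ℂ} (hz : 0 < z.re) :
    Summable fun q : (ℤ × ℤ) × (ℤ × ℤ) =>
      Complex.exp (-z * normSqTwo q.1) * Complex.exp (-(starRingEnd ℂ) z * normSqTwo q.2) := by
  have h : ∀ w : ℂ, 0 < w.re → Summable fun A : ℤ × ℤ => ‖Complex.exp (-w * normSqTwo A)‖ :=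
    fun w hw => by simpa only [norm_exp_neg_mul_natCast] using summable_exp_neg_normSqTwo hw
  have hz' : 0 < ((starRingEnd ℂ) z).re := by simpa using hz
  exact summable_mul_of_summable_norm (f := fun A : ℤ × ℤ => Complex.exp (-z * normSqTwo A))
    (g := fun A : ℤ × ℤ => Complex.exp (-(starRingEnd ℂ) z * normSqTwo A)) (h z hz) (h _ hz')

lemma hasSum_integral_oscTerm {σ : ℝ} (h0 : 0 < σ) (h1 : σ ≤ 1 / 4) :
    HasSum (fun q : (ℤ × ℤ) × (ℤ × ℤ) => ∫ y in (√σ)..9, oscTerm σ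
      (π ^ 2 * (normSqTwo q.1 + normSqTwo q.2)) (π ^ 2 * ((normSqTwo q.1 : ℝ) - normSqTwo q.2)) y)
      (∫ y in (√σ)..9, (oscWeight σ y : ℂ) *
        ((‖thetaSum (π ^ 2 / (σ + y * Complex.I))‖ ^ 4 : ℝ) : ℂ)) := by
  have hs : 0 < √σ := Real.sqrt_pos.2 h0
  have hle : √σ ≤ 9 := by
    rw [Real.sqrt_le_left (by norm_num)]; linarith
  set c := π ^ 2 * σ / 82 with hc
  have hc0 : 0 < c := by positivity
  have hsum : Summable fun q : (ℤ × ℤ) × (ℤ × ℤ) =>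
      (1 / (√σ) ^ 3) * (Real.exp (-c * normSqTwo q.1) * Real.exp (-c * normSqTwo q.2)) :=
    ((summable_exp_neg_normSqTwo hc0).mul_of_nonneg (summable_exp_neg_normSqTwo hc0)
      (fun _ => (Real.exp_pos _).le) (fun _ => (Real.exp_pos _).le)).mul_left _
  have hz : ∀ y ∈ Set.uIoc (√σ) 9, 0 < ((π : ℂ) ^ 2 / (σ + y * Complex.I)).re := fun y hy => by
    rw [re_pi_sq_div]; positivity
  refine intervalIntegral.hasSum_integral_of_dominated_convergence
    (fun q _ => (1 / (√σ) ^ 3) *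
      (Real.exp (-c * normSqTwo q.1) * Real.exp (-c * normSqTwo q.2))) ?_ ?_ ?_ ?_ ?_
  · intro q
    refine (ContinuousOn.mono (continuousOn_oscTerm _ _ _) fun y hy => ?_).aestronglyMeasurable
      measurableSet_uIoc
    rw [Set.uIoc_of_le hle] at hy
    exact hs.trans hy.1
  · refine fun q => Filter.Eventually.of_forall fun y hy => ?_
    rw [Set.uIoc_of_le hle] at hy
    exact norm_oscTerm_le h0 h1 hy _ _
  · exact Filter.Eventually.of_forall fun y hy => hsum
  · exact intervalIntegrable_const
  · refine Filter.Eventually.of_forall fun y hy => ?_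
    rw [norm_thetaSum_pow_four (hz y hy)]
    have := (summable_exp_mul_exp_conj (hz y hy)).hasSum.mul_left (oscWeight σ y : ℂ)
    simpa only [oscWeight_mul_exp_mul_exp] using this

lemma continuous_thetaSum_vertical {σ : ℝ} (h0 : 0 < σ) :
    Continuous fun y : ℝ => thetaSum (σ + y * Complex.I) := by
  rw [continuous_iff_continuousAt]
  intro y
  refine ContinuousAt.comp (f := fun y : ℝ => (σ + y * Complex.I : ℂ))
    (differentiableAt_thetaSum (by simpa using h0)).continuousAt (by fun_prop)

/-- Local fourth moment bound for the theta function on a vertical line close to the boundary. -/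
lemma integral_thetaSum_pow_four_le {η : ℝ} (hη : 0 < η) :
    ∃ C : ℝ, 0 < C ∧ ∀ σ : ℝ, 0 < σ → σ ≤ 1 / 4 →
      ∫ y in (√σ)..9, ‖thetaSum (σ + y * Complex.I)‖ ^ 4 / ‖(σ + y * Complex.I : ℂ)‖ ≤
        C * σ ^ (-(1 + η)) := by
  obtain ⟨C, hC, hb⟩ := norm_integral_oscTerm_le hη
  have hS := summable_pairWeight hη
  set S := ∑' q : (ℤ × ℤ) × (ℤ × ℤ), pairWeight η (normSqTwo q.1) (normSqTwo q.2)
  have hS0 : 0 ≤ S := tsum_nonneg fun q => pairWeight_nonneg _ _ _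
  refine ⟨2 * π ^ 2 * (C * (S + 1)), by positivity, fun σ h0 h1 => ?_⟩
  have hs : 0 < √σ := Real.sqrt_pos.2 h0
  have hle : √σ ≤ 9 := by
    rw [Real.sqrt_le_left (by norm_num)]; linarith
  have hsum := hasSum_integral_oscTerm h0 h1
  set J := ∫ y in (√σ)..9, (oscWeight σ y : ℂ) *
        ((‖thetaSum (π ^ 2 / (σ + y * Complex.I))‖ ^ 4 : ℝ) : ℂ) with hJ
  have hJle : ‖J‖ ≤ C * σ ^ (-(1 + η)) * S := by
    rw [← hsum.tsum_eq]
    exact tsum_of_norm_bounded (hS.hasSum.mul_left _) fun q => hb σ h0 h1 _ _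
  have hJ2 : J = ((∫ y in (√σ)..9, oscWeight σ y *
        ‖thetaSum (π ^ 2 / (σ + y * Complex.I))‖ ^ 4 : ℝ) : ℂ) := by
    rw [hJ, ← intervalIntegral.integral_ofReal]
    congr 1; ext y; push_cast; rfl
  have hpt : ∀ y ∈ Set.Icc (√σ) 9, ‖thetaSum (σ + y * Complex.I)‖ ^ 4 /
      ‖(σ + y * Complex.I : ℂ)‖ ≤ 2 * π ^ 2 * (oscWeight σ y *
        ‖thetaSum (π ^ 2 / (σ + y * Complex.I))‖ ^ 4) := by
    intro y hy
    have hre : 0 < (σ + y * Complex.I : ℂ).re := by simpa using h0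
    have hn : 0 < ‖(σ + y * Complex.I : ℂ)‖ := norm_pos_iff.2 fun h => by simp [h] at hre
    have h3 := one_div_norm_cube_le h0 h1 hy.1
    rw [norm_thetaSum_functional_equation hre, mul_pow, ← Real.rpow_natCast _ 4,
      ← Real.rpow_mul (by positivity)]
    norm_num
    calc _ = π ^ 2 * (1 / ‖(σ + y * Complex.I : ℂ)‖ ^ 3) *
          ‖thetaSum (π ^ 2 / (σ + y * Complex.I))‖ ^ 4 := by
          field_simp
      _ ≤ π ^ 2 * (2 * oscWeight σ y) * ‖thetaSum (π ^ 2 / (σ + y * Complex.I))‖ ^ 4 := by gcongr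
      _ = _ := by ring
  have hcT := continuous_thetaSum_vertical h0
  have hnorm : ∀ y : ℝ, ‖(σ + y * Complex.I : ℂ)‖ ≠ 0 := fun y => by
    rw [norm_ne_zero_iff]
    intro h
    have := congrArg Complex.re h
    simp at this
    exact h0.ne' this
  have hcz : ∀ y : ℝ, (σ + y * Complex.I : ℂ) ≠ 0 := fun y => norm_ne_zero_iff.1 (hnorm y)
  have hcT2 : Continuous fun y : ℝ => thetaSum (π ^ 2 / (σ + y * Complex.I)) := by
    rw [continuous_iff_continuousAt]
    intro y
    refine ContinuousAt.comp (f := fun y : ℝ => (π ^ 2 / (σ + y * Complex.I) : ℂ))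
      (differentiableAt_thetaSum ?_).continuousAt
      (ContinuousAt.div (by fun_prop) (by fun_prop) (hcz y))
    rw [re_pi_sq_div]; positivity
  have hcw : ContinuousOn (oscWeight σ) (Set.uIcc (√σ) 9) := by
    unfold oscWeight
    refine ContinuousOn.div (by fun_prop) (by fun_prop) fun y hy => ?_
    rw [Set.uIcc_of_le hle] at hy
    have : 0 < y := hs.trans_le hy.1
    positivity
  have hi1 : IntervalIntegrable (fun y : ℝ => ‖thetaSum (σ + y * Complex.I)‖ ^ 4 /
      ‖(σ + y * Complex.I : ℂ)‖) MeasureTheory.volume (√σ) 9 :=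
    ((hcT.norm.pow 4).div (by fun_prop) hnorm).intervalIntegrable _ _
  have hi2 : IntervalIntegrable (fun y : ℝ => 2 * π ^ 2 * (oscWeight σ y *
      ‖thetaSum (π ^ 2 / (σ + y * Complex.I))‖ ^ 4)) MeasureTheory.volume (√σ) 9 :=
    (hcw.mul (hcT2.norm.pow 4).continuousOn).intervalIntegrable.const_mul _
  have hmono := intervalIntegral.integral_mono_on hle hi1 hi2 hpt
  refine hmono.trans ?_
  rw [intervalIntegral.integral_const_mul]
  have h7 : ∫ y in (√σ)..9, oscWeight σ y * ‖thetaSum (π ^ 2 / (σ + y * Complex.I))‖ ^ 4 ≤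
      C * σ ^ (-(1 + η)) * S := by
    refine le_trans (le_abs_self _) ?_
    rw [hJ2, Complex.norm_real] at hJle
    exact hJle
  calc _ ≤ 2 * π ^ 2 * (C * σ ^ (-(1 + η)) * (S + 1)) := by
        have : 0 < C * σ ^ (-(1 + η)) := by positivity
        gcongr
        nlinarith
    _ = _ := by ring

lemma abs_coord_le {k : ℕ} {t : ℝ} {v : Fin k → ℤ} (h : ∑ i, ((v i : ℝ)) ^ 2 ≤ t) (i : Fin k) :
    |v i| ≤ ⌊t⌋ := by
  rw [Int.le_floor]
  have h1 : (|v i| : ℤ) ≤ (v i) ^ 2 := by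
    rw [← sq_abs]
    rcases (abs_nonneg (v i)).eq_or_lt with h | h
    · rw [← h]; norm_num
    · nlinarith
  have h2 : ((|v i| : ℤ) : ℝ) ≤ (v i : ℝ) ^ 2 := by exact_mod_cast h1
  exact h2.trans ((Finset.single_le_sum (f := fun i => ((v i : ℝ)) ^ 2)
    (fun _ _ => sq_nonneg _) (Finset.mem_univ i)).trans h)

lemma setOf_sum_sq_le_subset (k : ℕ) (t : ℝ) :
    {v : Fin k → ℤ | ∑ i, ((v i : ℝ)) ^ 2 ≤ t} ⊆
      (Fintype.piFinset fun _ : Fin k => Finset.Icc (-⌊t⌋) ⌊t⌋ : Finset (Fin k → ℤ)) := by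
  intro v hv
  rw [Finset.mem_coe, Fintype.mem_piFinset]
  intro i
  rw [Finset.mem_Icc, ← abs_le]
  exact abs_coord_le hv i

lemma finite_setOf_sum_sq_le (k : ℕ) (t : ℝ) :
    {v : Fin k → ℤ | ∑ i, ((v i : ℝ)) ^ 2 ≤ t}.Finite :=
  (Finset.finite_toSet _).subset (setOf_sum_sq_le_subset k t)

lemma monotone_Sk (k : ℕ) : Monotone (Sk k) := fun s t hst => by
  have := (finite_setOf_sum_sq_le k t).to_subtype
  exact Nat.card_mono (finite_setOf_sum_sq_le k t) fun v (hv : _ ≤ s) => hv.trans hst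

lemma Sk_le (k : ℕ) {t : ℝ} (ht : 0 ≤ t) : (Sk k t : ℝ) ≤ 2 ^ k * (1 + t) ^ k := by
  have h1 : Sk k t ≤ (2 * ⌊t⌋₊ + 1) ^ k := by
    have := Nat.card_mono (Finset.finite_toSet _) (setOf_sum_sq_le_subset k t)
    refine this.trans_eq ?_
    rw [Nat.card_coe_set_eq, Set.ncard_coe_finset, Fintype.card_piFinset]
    simp only [Int.card_Icc, Finset.prod_const, Finset.card_univ, Fintype.card_fin]
    congr 1
    have : ((⌊t⌋₊ : ℕ) : ℤ) = ⌊t⌋ := Int.natCast_floor_eq_floor ht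
    omega
  have h2 : (⌊t⌋₊ : ℝ) ≤ t := Nat.floor_le ht
  calc (Sk k t : ℝ) ≤ ((2 * ⌊t⌋₊ + 1) ^ k : ℕ) := by exact_mod_cast h1
    _ = (2 * (⌊t⌋₊ : ℝ) + 1) ^ k := by push_cast; rfl
    _ ≤ (2 * (1 + t)) ^ k := by gcongr; linarith
    _ = _ := mul_pow _ _ _

lemma Sk_floor (k : ℕ) (t : ℝ) : Sk k (⌊t⌋ : ℝ) = Sk k t := by
  unfold Sk
  refine Nat.card_congr (Equiv.subtypeEquivRight fun v => ?_)
  have e : (∑ i, ((v i : ℝ)) ^ 2) = ((∑ i, (v i) ^ 2 : ℤ) : ℝ) := by push_cast; rfl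
  rw [e, Int.cast_le, ← Int.le_floor]

lemma Vk_nonneg (k : ℕ) : 0 ≤ Vk k := by
  unfold Vk
  have : 0 < Real.Gamma ((k : ℝ) / 2 + 1) := Real.Gamma_pos_of_pos (by positivity)
  positivity

lemma measurable_Sk (k : ℕ) : Measurable fun t => (Sk k t : ℝ) :=
  (Nat.mono_cast.comp (monotone_Sk k)).measurable

lemma measurable_Pk (k : ℕ) : Measurable (Pk k) :=
  (measurable_Sk k).sub ((measurable_id.pow_const _).const_mul _)

lemma abs_Pk_le (k : ℕ) {t : ℝ} (ht : 0 ≤ t) : |Pk k t| ≤ (2 ^ k + Vk k) * (1 + t) ^ k := by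
  have h1 := Sk_le k ht
  have hV := Vk_nonneg k
  have h2 : t ^ ((k : ℝ) / 2) ≤ (1 + t) ^ k := by
    calc t ^ ((k : ℝ) / 2) ≤ (1 + t) ^ ((k : ℝ) / 2) := by gcongr; linarith
      _ ≤ (1 + t) ^ (k : ℝ) := Real.rpow_le_rpow_of_exponent_le (by linarith)
          (by linarith [k.cast_nonneg (α := ℝ)])
      _ = _ := Real.rpow_natCast _ _
  have h3 : (0 : ℝ) ≤ t ^ ((k : ℝ) / 2) := by positivity
  unfold Pk
  refine (abs_sub _ _).trans ?_
  rw [abs_of_nonneg (Nat.cast_nonneg _), abs_of_nonneg (by positivity), add_mul]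
  gcongr

/-- Polynomially bounded measurable functions on the positive half-line. -/
def PolyBounded (g : ℝ → ℝ) : Prop :=
  Measurable g ∧ ∃ C : ℝ, ∃ m : ℕ, 0 ≤ C ∧ ∀ t : ℝ, 0 < t → |g t| ≤ C * (1 + t) ^ m

lemma polyBounded_Pk (k : ℕ) : PolyBounded (Pk k) :=
  ⟨measurable_Pk k, 2 ^ k + Vk k, k, by have := Vk_nonneg k; positivity,
    fun _ ht => abs_Pk_le k ht.le⟩

lemma PolyBounded.mul {f g : ℝ → ℝ} (hf : PolyBounded f) (hg : PolyBounded g) :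
    PolyBounded fun t => f t * g t := by
  obtain ⟨hf, C, m, hC, h⟩ := hf
  obtain ⟨hg, C', m', hC', h'⟩ := hg
  refine ⟨hf.mul hg, C * C', m + m', by positivity, fun t ht => ?_⟩
  rw [abs_mul]
  calc _ ≤ (C * (1 + t) ^ m) * (C' * (1 + t) ^ m') :=
        mul_le_mul (h t ht) (h' t ht) (abs_nonneg _) (by positivity)
    _ = _ := by rw [pow_add]; ring

lemma PolyBounded.add {f g : ℝ → ℝ} (hf : PolyBounded f) (hg : PolyBounded g) :
    PolyBounded fun t => f t + g t := by
  obtain ⟨hf, C, m, hC, h⟩ := hf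
  obtain ⟨hg, C', m', hC', h'⟩ := hg
  refine ⟨hf.add hg, C + C', m + m', by positivity, fun t ht => ?_⟩
  have h1 : (1 + t) ^ m ≤ (1 + t) ^ (m + m') := pow_le_pow_right₀ (by linarith) (by omega)
  have h2 : (1 + t) ^ m' ≤ (1 + t) ^ (m + m') := pow_le_pow_right₀ (by linarith) (by omega)
  calc |f t + g t| ≤ |f t| + |g t| := abs_add_le _ _
    _ ≤ C * (1 + t) ^ m + C' * (1 + t) ^ m' := add_le_add (h t ht) (h' t ht)
    _ ≤ C * (1 + t) ^ (m + m') + C' * (1 + t) ^ (m + m') := by gcongr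
    _ = _ := by ring

lemma polyBounded_const (c : ℝ) : PolyBounded fun _ => c :=
  ⟨measurable_const, |c|, 0, abs_nonneg _, fun _ _ => by simp⟩

lemma PolyBounded.neg {f : ℝ → ℝ} (hf : PolyBounded f) : PolyBounded fun t => -f t := by
  simpa using (polyBounded_const (-1)).mul hf

lemma PolyBounded.sub {f g : ℝ → ℝ} (hf : PolyBounded f) (hg : PolyBounded g) :
    PolyBounded fun t => f t - g t := by
  simpa [sub_eq_add_neg] using hf.add hg.neg

lemma PolyBounded.pow {f : ℝ → ℝ} (hf : PolyBounded f) (n : ℕ) :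
    PolyBounded fun t => f t ^ n := by
  induction n with
  | zero => simpa using polyBounded_const 1
  | succ n ih => simpa only [pow_succ] using ih.mul hf

lemma polyBounded_id : PolyBounded fun t => t :=
  ⟨measurable_id, 1, 1, zero_le_one, fun t ht => by rw [abs_of_pos ht]; linarith⟩

lemma polyBounded_rpow {p : ℝ} (hp : 0 ≤ p) : PolyBounded fun t => t ^ p := by
  refine ⟨measurable_id.pow_const p, 1, ⌈p⌉₊, zero_le_one, fun t ht => ?_⟩
  rw [abs_of_nonneg (by positivity), one_mul, ← Real.rpow_natCast]
  calc t ^ p ≤ (1 + t) ^ p := by gcongr; linarith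
    _ ≤ _ := Real.rpow_le_rpow_of_exponent_le (by linarith) (Nat.le_ceil p)

lemma PolyBounded.exists_exp_bound {g : ℝ → ℝ} (hg : PolyBounded g) {σ : ℝ} (hσ : 0 < σ) :
    ∃ K : ℝ, 0 ≤ K ∧ ∀ t : ℝ, 0 < t → |g t| ≤ K * Real.exp (σ * t) := by
  obtain ⟨-, C, m, hC, h⟩ := hg
  refine ⟨C * ((m.factorial : ℝ) / σ ^ m * Real.exp σ), by positivity, fun t ht => (h t ht).trans ?_⟩
  have := Real.pow_div_factorial_le_exp (σ * (1 + t)) (by positivity) m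
  rw [div_le_iff₀ (by positivity), mul_pow, mul_add, mul_one, Real.exp_add] at this
  have h2 : (1 + t) ^ m ≤ (m.factorial : ℝ) / σ ^ m * Real.exp σ * Real.exp (σ * t) := by
    rw [div_mul_eq_mul_div, div_mul_eq_mul_div, le_div_iff₀ (by positivity)]
    linarith
  calc C * (1 + t) ^ m ≤ C * ((m.factorial : ℝ) / σ ^ m * Real.exp σ * Real.exp (σ * t)) := by gcongr
    _ = _ := by ring

lemma norm_ofReal_mul_cexp (x : ℝ) (s : ℂ) (t : ℝ) :
    ‖(x : ℂ) * Complex.exp (-s * t)‖ = |x| * Real.exp (-(s.re * t)) := by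
  rw [norm_mul, Complex.norm_real, Complex.norm_exp, Complex.re_mul_ofReal, Complex.neg_re,
    Real.norm_eq_abs, neg_mul]

lemma integrableOn_exp_neg_mul {σ : ℝ} (hσ : 0 < σ) :
    MeasureTheory.IntegrableOn (fun t : ℝ => Real.exp (-(σ * t))) (Set.Ioi 0) := by
  simpa using integrableOn_exp_mul_Ioi (neg_neg_of_pos hσ) 0

lemma PolyBounded.integrableOn_exp {g : ℝ → ℝ} (hg : PolyBounded g) {s : ℂ} (hs : 0 < s.re) :
    MeasureTheory.IntegrableOn (fun t : ℝ => (g t : ℂ) * Complex.exp (-s * t)) (Set.Ioi 0) := by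
  obtain ⟨K, hK, h⟩ := hg.exists_exp_bound (half_pos hs)
  refine MeasureTheory.Integrable.mono' ((integrableOn_exp_neg_mul (half_pos hs)).const_mul K) ?_ ?_
  · exact ((Complex.measurable_ofReal.comp hg.1).mul (by fun_prop)).aestronglyMeasurable
  · filter_upwards [MeasureTheory.ae_restrict_mem measurableSet_Ioi] with t ht
    rw [norm_ofReal_mul_cexp]
    calc _ ≤ (K * Real.exp (s.re / 2 * t)) * Real.exp (-(s.re * t)) := by gcongr; exact h t ht
      _ = _ := by
        rw [mul_assoc, ← Real.exp_add]
        congr 2; ring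

lemma PolyBounded.integrableOn_exp_real {g : ℝ → ℝ} (hg : PolyBounded g) {δ : ℝ} (hδ : 0 < δ) :
    MeasureTheory.IntegrableOn (fun t : ℝ => g t * Real.exp (-(δ * t))) (Set.Ioi 0) := by
  have := (hg.integrableOn_exp (s := δ) (by simpa using hδ)).re
  refine this.congr (Filter.Eventually.of_forall fun t => ?_)
  have e : (g t : ℂ) * Complex.exp (-(δ : ℂ) * t) = ((g t * Real.exp (-(δ * t)) : ℝ) : ℂ) := by
    push_cast; ring_nf
  simp only [e]
  exact Complex.ofReal_re _

/-- The Laplace transform of `g` at the complex number `s`. -/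
noncomputable def laplaceIntegral (g : ℝ → ℝ) (s : ℂ) : ℂ :=
  ∫ t in Set.Ioi (0 : ℝ), (g t : ℂ) * Complex.exp (-s * t)

lemma laplaceIntegral_ofReal (g : ℝ → ℝ) (δ : ℝ) :
    laplaceIntegral g δ = ((∫ t in Set.Ioi (0 : ℝ), g t * Real.exp (-(δ * t)) : ℝ) : ℂ) := by
  rw [laplaceIntegral, ← integral_complex_ofReal]
  congr 1; ext t
  push_cast; ring_nf

lemma hasDerivAt_laplaceIntegral {g : ℝ → ℝ} (hg : PolyBounded g) {s : ℂ} (hs : 0 < s.re) :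
    HasDerivAt (laplaceIntegral g) (laplaceIntegral (fun t => -t * g t) s) s := by
  have hg' : PolyBounded fun t => -t * g t := polyBounded_id.neg.mul hg
  obtain ⟨K, hK, h⟩ := hg'.exists_exp_bound (σ := s.re / 4) (by linarith)
  have hnear : ∀ᶠ z in nhds s, 3 * s.re / 4 < z.re :=
    Complex.continuous_re.continuousAt.eventually (lt_mem_nhds (by linarith))
  refine (hasDerivAt_integral_of_dominated_loc_of_deriv_le (μ := MeasureTheory.volume.restrict (Set.Ioi 0))
    (F := fun z (t : ℝ) => (g t : ℂ) * Complex.exp (-z * t))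
    (F' := fun z (t : ℝ) => ((-t * g t : ℝ) : ℂ) * Complex.exp (-z * t))
    (bound := fun t => K * Real.exp (-(s.re / 2 * t))) hnear ?_ (hg.integrableOn_exp hs) ?_ ?_ ?_ ?_).2
  · exact Filter.Eventually.of_forall fun z =>
      ((Complex.measurable_ofReal.comp hg.1).mul (by fun_prop)).aestronglyMeasurable
  · exact ((Complex.measurable_ofReal.comp hg'.1).mul (by fun_prop)).aestronglyMeasurable
  · filter_upwards [MeasureTheory.ae_restrict_mem measurableSet_Ioi] with t ht z hz
    have ht : 0 < t := ht
    have hz : 3 * s.re / 4 < z.re := hz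
    rw [norm_ofReal_mul_cexp]
    calc _ ≤ (K * Real.exp (s.re / 4 * t)) * Real.exp (-(z.re * t)) := by gcongr; exact h t ht
      _ = K * Real.exp (s.re / 4 * t - z.re * t) := by
        rw [mul_assoc, ← Real.exp_add]; rfl
      _ ≤ _ := by gcongr; nlinarith
  · exact (integrableOn_exp_neg_mul (half_pos hs)).const_mul K
  · refine Filter.Eventually.of_forall fun t z _ => ?_
    have h1 : HasDerivAt (fun z : ℂ => -z * t) (-1 * t) z := ((hasDerivAt_id z).neg).mul_const _
    refine (h1.cexp.const_mul _).congr_deriv ?_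
    push_cast; ring

lemma isOpen_re_pos : IsOpen {s : ℂ | 0 < s.re} := isOpen_lt continuous_const Complex.continuous_re

lemma iteratedDeriv_laplaceIntegral {g : ℝ → ℝ} (hg : PolyBounded g) (j : ℕ) :
    ∀ s : ℂ, 0 < s.re →
      iteratedDeriv j (laplaceIntegral g) s = laplaceIntegral (fun t => (-t) ^ j * g t) s := by
  induction j with
  | zero => intro s _; simp
  | succ j ih =>
    intro s hs
    rw [iteratedDeriv_succ]
    have he : iteratedDeriv j (laplaceIntegral g) =ᶠ[nhds s]
        laplaceIntegral (fun t => (-t) ^ j * g t) := by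
      filter_upwards [isOpen_re_pos.mem_nhds hs] with z hz using ih z hz
    rw [he.deriv_eq, (hasDerivAt_laplaceIntegral ((polyBounded_id.neg.pow j).mul hg) hs).deriv]
    congr 1; ext t; ring

lemma ENNReal.tsum_prod_fin_eq_pow (f : ℤ → ENNReal) (k : ℕ) :
    ∑' v : Fin k → ℤ, ∏ i, f (v i) = (∑' n, f n) ^ k := by
  induction k with
  | zero => simp
  | succ k ih =>
    have h : ∑' v : Fin (k + 1) → ℤ, ∏ i, f (v i) =
        ∑' p : ℤ × (Fin k → ℤ), f p.1 * ∏ i, f (p.2 i) := by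
      rw [← (Fin.consEquiv fun _ => ℤ).tsum_eq]
      simp [Fin.consEquiv, Fin.prod_univ_succ]
    rw [h, ENNReal.tsum_prod (f := fun a (b : Fin k → ℤ) => f a * ∏ i, f (b i))]
    simp only [ENNReal.tsum_mul_left, ih, ENNReal.tsum_mul_right]
    rw [pow_succ']

lemma Sk_eq_tsum (k : ℕ) (t : ℝ) :
    ((Sk k t : ℕ) : ENNReal) =
      ∑' v : Fin k → ℤ, (Set.Ici (∑ i, ((v i : ℝ)) ^ 2)).indicator (fun _ => (1 : ENNReal)) t := by
  have hf := (finite_setOf_sum_sq_le k t).to_subtype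
  have h : (∑' v : Fin k → ℤ, (Set.Ici (∑ i, ((v i : ℝ)) ^ 2)).indicator (fun _ => (1 : ENNReal)) t)
      = ∑' v : Fin k → ℤ, {v : Fin k → ℤ | ∑ i, ((v i : ℝ)) ^ 2 ≤ t}.indicator
          (fun _ => (1 : ENNReal)) v := rfl
  rw [h, ← tsum_subtype, ENNReal.tsum_const, mul_one, ENat.card_eq_coe_natCard]
  rfl

lemma lintegral_Ici_exp {δ q : ℝ} (hδ : 0 < δ) :
    ∫⁻ t in Set.Ici q, ENNReal.ofReal (Real.exp (-(δ * t))) =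
      ENNReal.ofReal (Real.exp (-(δ * q)) / δ) := by
  have hi : MeasureTheory.IntegrableOn (fun t : ℝ => Real.exp (-(δ * t))) (Set.Ioi q) := by
    simpa using integrableOn_exp_mul_Ioi (neg_neg_of_pos hδ) q
  rw [MeasureTheory.Measure.restrict_congr_set MeasureTheory.Ioi_ae_eq_Ici.symm,
    ← MeasureTheory.ofReal_integral_eq_lintegral_ofReal hi
      (Filter.Eventually.of_forall fun _ => (Real.exp_pos _).le)]
  congr 1
  have := integral_exp_mul_Ioi (neg_neg_of_pos hδ) q
  simp only [neg_mul] at this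
  rw [this, neg_div_neg_eq]

lemma lintegral_Sk_mul_exp (k : ℕ) {δ : ℝ} (hδ : 0 < δ) :
    ∫⁻ t in Set.Ioi (0 : ℝ), (Sk k t : ENNReal) * ENNReal.ofReal (Real.exp (-(δ * t))) =
      ENNReal.ofReal (realTheta δ ^ k / δ) := by
  have hm : Measurable fun t : ℝ => ENNReal.ofReal (Real.exp (-(δ * t))) := by fun_prop
  have h1 : ∀ t : ℝ, (Sk k t : ENNReal) * ENNReal.ofReal (Real.exp (-(δ * t))) =
      ∑' v : Fin k → ℤ, (Set.Ici (∑ i, ((v i : ℝ)) ^ 2)).indicator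
        (fun t => ENNReal.ofReal (Real.exp (-(δ * t)))) t := by
    intro t
    rw [Sk_eq_tsum, ← ENNReal.tsum_mul_right]
    congr 1; ext v
    by_cases h : t ∈ Set.Ici (∑ i, ((v i : ℝ)) ^ 2) <;> simp [h]
  simp only [h1]
  rw [MeasureTheory.lintegral_tsum fun v => (hm.indicator measurableSet_Ici).aemeasurable]
  have h2 : ∀ v : Fin k → ℤ, ∫⁻ t in Set.Ioi (0 : ℝ), (Set.Ici (∑ i, ((v i : ℝ)) ^ 2)).indicator
      (fun t => ENNReal.ofReal (Real.exp (-(δ * t)))) t =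
      (∏ i, ENNReal.ofReal (Real.exp (-δ * ((v i : ℤ) : ℝ) ^ 2))) * ENNReal.ofReal δ⁻¹ := by
    intro v
    have hq : 0 ≤ ∑ i, ((v i : ℝ)) ^ 2 := Finset.sum_nonneg fun _ _ => sq_nonneg _
    rw [MeasureTheory.Measure.restrict_congr_set MeasureTheory.Ioi_ae_eq_Ici,
      MeasureTheory.setLIntegral_indicator measurableSet_Ici,
      Set.inter_eq_left.2 (Set.Ici_subset_Ici.2 hq), lintegral_Ici_exp hδ, div_eq_mul_inv,
      ENNReal.ofReal_mul (Real.exp_pos _).le, ← ENNReal.ofReal_prod_of_nonneg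
        (fun _ _ => (Real.exp_pos _).le), ← Real.exp_sum, ← Finset.mul_sum, neg_mul]
  simp only [h2]
  rw [ENNReal.tsum_mul_right, ENNReal.tsum_prod_fin_eq_pow (fun n : ℤ => ENNReal.ofReal (Real.exp (-δ * (n : ℝ) ^ 2))),
    ← ENNReal.ofReal_tsum_of_nonneg (fun _ => (Real.exp_pos _).le) (summable_realTheta hδ),
    ← ENNReal.ofReal_pow (tsum_nonneg fun _ => (Real.exp_pos _).le), ← ENNReal.ofReal_mul
    (pow_nonneg (tsum_nonneg fun _ => (Real.exp_pos _).le) _), div_eq_mul_inv]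
  rfl

lemma integral_Sk_mul_exp (k : ℕ) {δ : ℝ} (hδ : 0 < δ) :
    ∫ t in Set.Ioi (0 : ℝ), (Sk k t : ℝ) * Real.exp (-(δ * t)) = realTheta δ ^ k / δ := by
  rw [MeasureTheory.integral_eq_lintegral_of_nonneg_ae
    (Filter.Eventually.of_forall fun _ => by positivity)
    (by have := measurable_Sk k; exact (this.mul (by fun_prop)).aestronglyMeasurable)]
  have : ∀ t : ℝ, ENNReal.ofReal ((Sk k t : ℝ) * Real.exp (-(δ * t))) =
      (Sk k t : ENNReal) * ENNReal.ofReal (Real.exp (-(δ * t))) := fun t => by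
    rw [ENNReal.ofReal_mul (Nat.cast_nonneg _), ENNReal.ofReal_natCast]
  simp only [this]
  rw [lintegral_Sk_mul_exp k hδ, ENNReal.toReal_ofReal]
  have := one_le_realTheta hδ
  positivity

lemma integral_rpow_mul_exp {p δ : ℝ} (hp : -1 < p) (hδ : 0 < δ) :
    ∫ t in Set.Ioi (0 : ℝ), t ^ p * Real.exp (-(δ * t)) = (1 / δ) ^ (p + 1) * Real.Gamma (p + 1) := by
  have := Real.integral_rpow_mul_exp_neg_mul_Ioi (a := p + 1) (by linarith) hδ
  simpa using this

lemma polyBounded_Sk (k : ℕ) : PolyBounded fun t => (Sk k t : ℝ) :=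
  ⟨measurable_Sk k, 2 ^ k, k, by positivity, fun t ht => by
    rw [abs_of_nonneg (Nat.cast_nonneg _)]; exact Sk_le k ht.le⟩

lemma integral_Pk_mul_exp (k : ℕ) {δ : ℝ} (hδ : 0 < δ) :
    ∫ t in Set.Ioi (0 : ℝ), Pk k t * Real.exp (-(δ * t)) =
      (realTheta δ ^ k - (π / δ) ^ ((k : ℝ) / 2)) / δ := by
  have h0 : (0 : ℝ) ≤ (k : ℝ) / 2 := by positivity
  have h : ∀ t : ℝ, Pk k t * Real.exp (-(δ * t)) =
      (Sk k t : ℝ) * Real.exp (-(δ * t)) - Vk k * (t ^ ((k : ℝ) / 2) * Real.exp (-(δ * t))) :=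
    fun t => by unfold Pk; ring
  simp only [h]
  rw [MeasureTheory.integral_sub ((polyBounded_Sk k).integrableOn_exp_real hδ)
    (((polyBounded_rpow h0).integrableOn_exp_real hδ).const_mul _), integral_Sk_mul_exp k hδ,
    MeasureTheory.integral_const_mul, integral_rpow_mul_exp (by linarith) hδ, Vk]
  have hG : Real.Gamma ((k : ℝ) / 2 + 1) ≠ 0 := (Real.Gamma_pos_of_pos (by linarith)).ne'
  rw [Real.div_rpow Real.pi_pos.le hδ.le, one_div, Real.inv_rpow hδ.le, Real.rpow_add hδ,
    Real.rpow_one]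
  field_simp

/-- The factor `(π / s) ^ (1 / 2)` on the right half-plane. -/
noncomputable def thetaFactor (s : ℂ) : ℂ := 1 / (s / π) ^ (1 / 2 : ℂ)

lemma div_pi_mem_slitPlane {s : ℂ} (hs : 0 < s.re) : s / π ∈ Complex.slitPlane := by
  left
  rw [Complex.div_ofReal_re]
  exact div_pos hs Real.pi_pos

lemma differentiableAt_thetaFactor {s : ℂ} (hs : 0 < s.re) : DifferentiableAt ℂ thetaFactor s := by
  unfold thetaFactor
  have h := div_pi_mem_slitPlane hs
  refine (differentiableAt_const _).div ((differentiableAt_id.div_const _).cpow_const h) ?_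
  rw [Complex.cpow_ne_zero_iff]
  exact Or.inl (Complex.slitPlane_ne_zero h)

lemma norm_thetaFactor {s : ℂ} (hs : 0 < s.re) : ‖thetaFactor s‖ = (π / ‖s‖) ^ (1 / 2 : ℝ) := by
  have h := Complex.slitPlane_ne_zero (div_pi_mem_slitPlane hs)
  unfold thetaFactor
  rw [norm_div, norm_one, show (1 / 2 : ℂ) = ((1 / 2 : ℝ) : ℂ) by push_cast; rfl,
    Complex.norm_cpow_real, norm_div, Complex.norm_real, Real.norm_of_nonneg Real.pi_pos.le,
    one_div, ← Real.inv_rpow (by positivity), inv_div]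

lemma thetaFactor_ofReal_pow (k : ℕ) {δ : ℝ} (hδ : 0 < δ) :
    thetaFactor δ ^ k = (((π / δ) ^ ((k : ℝ) / 2) : ℝ) : ℂ) := by
  unfold thetaFactor
  rw [show (δ : ℂ) / π = ((δ / π : ℝ) : ℂ) by push_cast; rfl,
    show (1 / 2 : ℂ) = ((1 / 2 : ℝ) : ℂ) by push_cast; rfl,
    ← Complex.ofReal_cpow (by positivity)]
  norm_cast
  rw [one_div ((δ / π) ^ (1 / 2 : ℝ)), ← Real.inv_rpow (by positivity), inv_div, ← Real.rpow_natCast,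
    ← Real.rpow_mul (by positivity)]
  congr 1; ring

lemma laplaceIntegral_Pk (k : ℕ) {s : ℂ} (hs : 0 < s.re) :
    laplaceIntegral (Pk k) s = (thetaSum s ^ k - thetaFactor s ^ k) / s := by
  have hne : ∀ z : ℂ, 0 < z.re → z ≠ 0 := by rintro z hz rfl; simp at hz
  have h1 : AnalyticOnNhd ℂ (laplaceIntegral (Pk k)) {s : ℂ | 0 < s.re} :=
    DifferentiableOn.analyticOnNhd (fun z hz =>
      (hasDerivAt_laplaceIntegral (polyBounded_Pk k) hz).differentiableAt.differentiableWithinAt)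
      isOpen_re_pos
  have h2 : AnalyticOnNhd ℂ (fun s => (thetaSum s ^ k - thetaFactor s ^ k) / s) {s : ℂ | 0 < s.re} :=
    DifferentiableOn.analyticOnNhd (fun z hz =>
      ((((differentiableAt_thetaSum hz).pow k).sub ((differentiableAt_thetaFactor hz).pow k)).div
        differentiableAt_id (hne z hz)).differentiableWithinAt) isOpen_re_pos
  have hpre : IsPreconnected {s : ℂ | 0 < s.re} := (convex_halfSpace_re_gt 0).isPreconnected
  refine h1.eqOn_of_preconnected_of_frequently_eq h2 hpre (z₀ := 1) (by simp) ?_ hs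
  have hreal : ∀ δ : ℝ, 0 < δ →
      laplaceIntegral (Pk k) δ = (thetaSum δ ^ k - thetaFactor δ ^ k) / (δ : ℂ) := fun δ hδ => by
    rw [laplaceIntegral_ofReal, integral_Pk_mul_exp k hδ, thetaSum_ofReal,
      thetaFactor_ofReal_pow k hδ]
    push_cast; rfl
  have ht : Filter.Tendsto (fun n : ℕ => ((1 + 1 / ((n : ℝ) + 1) : ℝ) : ℂ)) Filter.atTop
      (nhdsWithin 1 {1}ᶜ) := by
    refine tendsto_nhdsWithin_iff.2 ⟨?_, Filter.Eventually.of_forall fun n => ?_⟩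
    · have := (tendsto_one_div_add_atTop_nhds_zero_nat (𝕜 := ℝ)).const_add 1
      rw [add_zero] at this
      have h := (Complex.continuous_ofReal.tendsto _).comp this
      rwa [Complex.ofReal_one] at h
    · simp only [Set.mem_compl_iff, Set.mem_singleton_iff]
      intro h
      have : (1 + 1 / ((n : ℝ) + 1) : ℝ) = 1 := by exact_mod_cast h
      have hp : (0 : ℝ) < 1 / ((n : ℝ) + 1) := by positivity
      linarith
  exact ht.frequently (Filter.Frequently.of_forall fun n => hreal _ (by positivity))

lemma laplaceIntegral_Pk_eq_factor (k : ℕ) {s : ℂ} (hs : 0 < s.re) :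
    laplaceIntegral (Pk k) s = thetaFactor s ^ k * (thetaSum (π ^ 2 / s) ^ k - 1) / s := by
  rw [laplaceIntegral_Pk k hs, thetaSum_functional_equation hs]
  unfold thetaFactor
  ring

open scoped FourierTransform SchwartzMap ContDiff in
/-- The `L²` Fourier transform of a function in `L¹ ∩ L²` is given by the Fourier integral. -/
lemma Lp_fourier_ae_eq {f : ℝ → ℂ} (hf1 : MeasureTheory.Integrable f)
    (hf2 : MeasureTheory.MemLp f 2) :
    (𝓕 (hf2.toLp f) : MeasureTheory.Lp (α := ℝ) ℂ 2) =ᵐ[MeasureTheory.volume] 𝓕 f := by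
  have hcont : Continuous (𝓕 f) :=
    VectorFourier.fourierIntegral_continuous Real.continuous_fourierChar
      (by exact continuous_inner) hf1
  refine ae_eq_of_integral_contDiff_smul_eq
    ((MeasureTheory.Lp.memLp _).locallyIntegrable (by norm_num)) hcont.locallyIntegrable ?_
  intro g hg hgc
  have hG : HasCompactSupport fun x => (g x : ℂ) := hgc.comp_left (g := fun x : ℝ => (x : ℂ)) (by simp)
  have hG' : ContDiff ℝ ∞ fun x => (g x : ℂ) := Complex.ofRealCLM.contDiff.comp hg
  set φ : 𝓢(ℝ, ℂ) := hG.toSchwartzMap hG' with hφ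
  have hφc : ∀ x, φ x = (g x : ℂ) := fun x => rfl
  have h1 := congrArg (fun T : 𝓢'(ℝ, ℂ) => T φ)
    (MeasureTheory.Lp.fourier_toTemperedDistribution_eq (hf2.toLp f))
  simp only [TemperedDistribution.fourier_apply,
    MeasureTheory.Lp.toTemperedDistribution_apply] at h1
  have h2 : ∫ x, (𝓕 φ) x • (hf2.toLp f) x = ∫ x, (𝓕 φ) x • f x := by
    refine MeasureTheory.integral_congr_ae ?_
    filter_upwards [hf2.coeFn_toLp] with x hx
    rw [hx]
  have h3 : ∫ x, (𝓕 φ) x • f x = ∫ x, φ x • (𝓕 f) x := by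
    rw [SchwartzMap.fourier_coe]
    have := VectorFourier.integral_fourierIntegral_smul_eq_flip (L := innerₗ ℝ) (f := (φ : ℝ → ℂ))
      (g := f) (μ := MeasureTheory.volume) (ν := MeasureTheory.volume)
      Real.continuous_fourierChar continuous_inner φ.integrable hf1
    simpa using! this
  rw [h2, h3] at h1
  simpa [hφc] using h1.symm

open scoped FourierTransform in
/-- Plancherel's identity for functions in `L¹ ∩ L²`. -/
lemma memLp_fourier_and_integral_norm_sq {f : ℝ → ℂ} (hf1 : MeasureTheory.Integrable f)
    (hf2 : MeasureTheory.MemLp f 2) :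
    MeasureTheory.MemLp (𝓕 f) 2 ∧ ∫ w, ‖(𝓕 f) w‖ ^ 2 = ∫ t, ‖f t‖ ^ 2 := by
  have hae := Lp_fourier_ae_eq hf1 hf2
  have hmem : MeasureTheory.MemLp (𝓕 f) 2 := (MeasureTheory.memLp_congr_ae hae).1
    (MeasureTheory.Lp.memLp _)
  refine ⟨hmem, ?_⟩
  have hn : MeasureTheory.eLpNorm (𝓕 f) 2 MeasureTheory.volume =
      MeasureTheory.eLpNorm f 2 MeasureTheory.volume := by
    rw [← MeasureTheory.eLpNorm_congr_ae hae, ← MeasureTheory.Lp.enorm_def,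
      ← MeasureTheory.eLpNorm_congr_ae hf2.coeFn_toLp, ← MeasureTheory.Lp.enorm_def]
    rw [enorm_eq_iff_norm_eq]
    exact MeasureTheory.Lp.norm_fourier_eq _
  rw [hmem.eLpNorm_eq_integral_rpow_norm (by norm_num) (by norm_num),
    hf2.eLpNorm_eq_integral_rpow_norm (by norm_num) (by norm_num)] at hn
  have h0 : ∀ g : ℝ → ℂ, 0 ≤ ∫ w, ‖g w‖ ^ 2 := fun g =>
    MeasureTheory.integral_nonneg fun _ => by positivity
  simp only [ENNReal.toReal_ofNat, Real.rpow_two] at hn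
  rw [ENNReal.ofReal_eq_ofReal_iff (by have := h0 (𝓕 f); positivity) (by have := h0 f; positivity)]
    at hn
  exact (Real.rpow_left_inj (h0 _) (h0 _) (by norm_num)).1 hn

open scoped FourierTransform in
/-- Plancherel's identity for Laplace transforms. -/
lemma integral_norm_laplaceIntegral_sq {g : ℝ → ℝ} (hg : PolyBounded g) {σ : ℝ} (hσ : 0 < σ) :
    MeasureTheory.Integrable (fun y : ℝ => ‖laplaceIntegral g (σ + y * Complex.I)‖ ^ 2) ∧
    ∫ t in Set.Ioi (0 : ℝ), g t ^ 2 * Real.exp (-(2 * σ * t)) =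
      (2 * π)⁻¹ * ∫ y : ℝ, ‖laplaceIntegral g (σ + y * Complex.I)‖ ^ 2 := by
  set f : ℝ → ℂ := (Set.Ioi (0 : ℝ)).indicator
    (fun t => (g t : ℂ) * Complex.exp (-(σ : ℂ) * t)) with hfdef
  have hf1 : MeasureTheory.Integrable f :=
    (MeasureTheory.integrable_indicator_iff measurableSet_Ioi).2
      (hg.integrableOn_exp (by simpa using hσ))
  have hnf : ∀ t, ‖f t‖ ^ 2 =
      (Set.Ioi (0 : ℝ)).indicator (fun t => g t ^ 2 * Real.exp (-(2 * σ * t))) t := fun t => by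
    by_cases ht : t ∈ Set.Ioi (0 : ℝ)
    · simp only [hfdef, Set.indicator_of_mem ht]
      rw [norm_ofReal_mul_cexp, mul_pow, sq_abs, ← Real.exp_nat_mul, Complex.ofReal_re]
      congr 2; push_cast; ring
    · simp [hfdef, Set.indicator_of_notMem ht]
  have hf2 : MeasureTheory.MemLp f 2 := by
    rw [MeasureTheory.memLp_two_iff_integrable_sq_norm hf1.aestronglyMeasurable]
    simp only [hnf]
    exact (MeasureTheory.integrable_indicator_iff measurableSet_Ioi).2
      ((hg.pow 2).integrableOn_exp_real (by positivity))
  obtain ⟨hm, he⟩ := memLp_fourier_and_integral_norm_sq hf1 hf2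
  have hF : ∀ w : ℝ, (𝓕 f) w = laplaceIntegral g (σ + ((2 * π * w : ℝ) : ℂ) * Complex.I) := by
    intro w
    rw [Real.fourier_real_eq_integral_exp_smul, laplaceIntegral,
      ← MeasureTheory.integral_indicator measurableSet_Ioi]
    congr 1; ext t
    by_cases ht : t ∈ Set.Ioi (0 : ℝ)
    · simp only [hfdef, Set.indicator_of_mem ht, smul_eq_mul]
      rw [mul_left_comm, ← Complex.exp_add]
      congr 2; push_cast; ring
    · simp [hfdef, Set.indicator_of_notMem ht]
  have hpi : (2 * π : ℝ) ≠ 0 := by positivity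
  have hi := (MeasureTheory.memLp_two_iff_integrable_sq_norm hm.1).1 hm
  simp only [hF] at hi he
  constructor
  · exact (MeasureTheory.integrable_comp_mul_left_iff
      (fun y : ℝ => ‖laplaceIntegral g (σ + y * Complex.I)‖ ^ 2) hpi).1 hi
  · have h := MeasureTheory.Measure.integral_comp_mul_left
      (fun y : ℝ => ‖laplaceIntegral g (σ + y * Complex.I)‖ ^ 2) (2 * π)
    rw [he, smul_eq_mul, abs_of_pos (by positivity)] at h
    rw [← h]
    simp only [hnf]
    rw [MeasureTheory.integral_indicator measurableSet_Ioi]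

lemma norm_pow_sub_one_le {z : ℂ} {B : ℝ} (hB : 1 ≤ B) (hz : ‖z‖ ≤ B) (k : ℕ) :
    ‖z ^ k - 1‖ ≤ k * B ^ k * ‖z - 1‖ := by
  rw [← geom_sum_mul, norm_mul]
  gcongr
  refine (norm_sum_le _ _).trans ?_
  calc ∑ i ∈ Finset.range k, ‖z ^ i‖ ≤ ∑ i ∈ Finset.range k, B ^ k := by
        refine Finset.sum_le_sum fun i hi => ?_
        rw [norm_pow]
        exact (pow_le_pow_left₀ (norm_nonneg _) hz i).trans
          (pow_le_pow_right₀ hB (Finset.mem_range.1 hi).le)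
    _ = _ := by simp

lemma re_pi_sq_div_eq (s : ℂ) : ((π : ℂ) ^ 2 / s).re = π ^ 2 * (s.re / ‖s‖ ^ 2) := by
  have := re_pi_sq_div s.re s.im
  rw [Complex.re_add_im] at this
  rw [this, Complex.sq_norm, Complex.normSq_apply, ← sq, ← sq, mul_div_assoc]

lemma re_pos_of_pi_sq_div {s : ℂ} (hs : 0 < s.re) : 0 < s.re / ‖s‖ ^ 2 := by
  have : s ≠ 0 := by rintro rfl; simp at hs
  have := norm_pos_iff.2 this
  positivity

lemma norm_thetaFactor_pow (k : ℕ) {s : ℂ} (hs : 0 < s.re) :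
    ‖thetaFactor s ^ k‖ = π ^ ((k : ℝ) / 2) * ‖s‖ ^ (-((k : ℝ) / 2)) := by
  have hsn : 0 < ‖s‖ := norm_pos_iff.2 (by rintro rfl; simp at hs)
  rw [norm_pow, norm_thetaFactor hs, ← Real.rpow_natCast, ← Real.rpow_mul (by positivity),
    one_div_mul_eq_div, Real.div_rpow Real.pi_pos.le hsn.le, Real.rpow_neg hsn.le, div_eq_mul_inv]

/-- Bound for the Laplace transform of the discrepancy close to the origin. -/
lemma norm_laplaceIntegral_Pk_le (k : ℕ) {p : ℝ} (hp : 1 / 2 < p) :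
    ∃ C : ℝ, 0 < C ∧ ∀ s : ℂ, 0 < s.re → ‖s‖ ^ 2 ≤ π ^ 2 * s.re →
      ‖laplaceIntegral (Pk k) s‖ ≤ C * ‖s‖ ^ (-((k : ℝ) / 2 + 1)) * (‖s‖ ^ 2 / s.re) ^ p := by
  obtain ⟨C, hC, h⟩ := realTheta_sub_one_le hp
  have hB := one_le_realTheta one_pos
  have hB0 : 0 < realTheta 1 := by linarith
  refine ⟨π ^ ((k : ℝ) / 2) * ((k + 1) * realTheta 1 ^ k * (C * (π ^ 2) ^ (-p))), by positivity,
    fun s hs hle => ?_⟩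
  have hs0 : s ≠ 0 := by rintro rfl; simp at hs
  have hsn : 0 < ‖s‖ := norm_pos_iff.2 hs0
  have ha := re_pi_sq_div_eq s
  set a := ((π : ℂ) ^ 2 / s).re with hadef
  have ha1 : 1 ≤ a := by
    rw [ha, ← mul_div_assoc, le_div_iff₀ (by positivity)]; linarith
  have h1 : ‖thetaSum (π ^ 2 / s)‖ ≤ realTheta 1 :=
    (norm_thetaSum_le (by rw [← hadef]; linarith)).trans (realTheta_anti one_pos ha1)
  have h2 : ‖thetaSum (π ^ 2 / s) - 1‖ ≤ C * a ^ (-p) :=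
    (norm_thetaSum_sub_one_le (by rw [← hadef]; linarith)).trans (h a (by linarith))
  have h3 : a ^ (-p) = (π ^ 2) ^ (-p) * (‖s‖ ^ 2 / s.re) ^ p := by
    rw [ha, Real.mul_rpow (by positivity) (by positivity), Real.rpow_neg (x := s.re / _) (by positivity),
      ← Real.inv_rpow (by positivity), inv_div]
  rw [laplaceIntegral_Pk_eq_factor k hs, norm_div, norm_mul, norm_thetaFactor_pow k hs]
  have h4 : ‖thetaSum (π ^ 2 / s) ^ k - 1‖ ≤
      (k + 1) * realTheta 1 ^ k * (C * ((π ^ 2) ^ (-p) * (‖s‖ ^ 2 / s.re) ^ p)) := by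
    refine (norm_pow_sub_one_le hB h1 k).trans ?_
    rw [← h3]
    gcongr
    linarith
  rw [div_le_iff₀ hsn]
  have h5 : ‖s‖ ^ (-((k : ℝ) / 2 + 1)) * ‖s‖ = ‖s‖ ^ (-((k : ℝ) / 2)) := by
    rw [← Real.rpow_add_one hsn.ne']; congr 1; ring
  calc _ ≤ π ^ ((k : ℝ) / 2) * ‖s‖ ^ (-((k : ℝ) / 2)) *
        ((k + 1) * realTheta 1 ^ k * (C * ((π ^ 2) ^ (-p) * (‖s‖ ^ 2 / s.re) ^ p))) := by gcongr
    _ = _ := by rw [← h5]; ring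

lemma thetaSum_norm_sq_le : ∃ C : ℝ, 0 < C ∧ ∀ s : ℂ, 0 < s.re → s.re ≤ 1 → s.re ≤ ‖s‖ ^ 2 →
    ‖thetaSum s‖ ^ 2 ≤ C / s.re ∧ ‖thetaSum s‖ ^ 2 ≤ C / s.re * ‖s‖ := by
  obtain ⟨C, hC, h⟩ := realTheta_le (π ^ 2) (by positivity)
  have hpi := Real.pi_gt_three
  refine ⟨C ^ 2, by positivity, fun s hs hs1 hle => ?_⟩
  have hsn : 0 < ‖s‖ := norm_pos_iff.2 (by rintro rfl; simp at hs)
  have hsq : ∀ x : ℝ, 0 < x → (x ^ (-(1 / 2) : ℝ)) ^ 2 = x⁻¹ := fun x hx => by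
    rw [← Real.rpow_natCast, ← Real.rpow_mul hx.le, ← Real.rpow_neg_one]; norm_num
  constructor
  · calc ‖thetaSum s‖ ^ 2 ≤ (C * s.re ^ (-(1 / 2) : ℝ)) ^ 2 := by
          gcongr
          exact (norm_thetaSum_le hs).trans (h _ hs (by nlinarith))
      _ = _ := by rw [mul_pow, hsq _ hs]; rfl
  · have ha := re_pi_sq_div_eq s
    have hpos := re_pos_of_pi_sq_div hs
    have ha0 : 0 < ((π : ℂ) ^ 2 / s).re := by rw [ha]; positivity
    have ha1 : ((π : ℂ) ^ 2 / s).re ≤ π ^ 2 := by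
      rw [ha]
      have : s.re / ‖s‖ ^ 2 ≤ 1 := by rw [div_le_one (by positivity)]; exact hle
      nlinarith
    have e1 : ((π / ‖s‖) ^ (1 / 2 : ℝ)) ^ 2 = π / ‖s‖ := by
      rw [← Real.rpow_natCast, ← Real.rpow_mul (by positivity)]; norm_num
    rw [norm_thetaSum_functional_equation hs, mul_pow, e1]
    calc π / ‖s‖ * ‖thetaSum (π ^ 2 / s)‖ ^ 2
        ≤ π / ‖s‖ * (C * ((π : ℂ) ^ 2 / s).re ^ (-(1 / 2) : ℝ)) ^ 2 := by
          gcongr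
          exact (norm_thetaSum_le ha0).trans (h _ ha0 ha1)
      _ = C ^ 2 / s.re * ‖s‖ / π := by
          rw [mul_pow, hsq _ ha0, ha]; field_simp
      _ ≤ C ^ 2 / s.re * ‖s‖ := by
          apply div_le_self (by positivity); linarith

lemma laplaceIntegral_conj (g : ℝ → ℝ) (s : ℂ) :
    laplaceIntegral g ((starRingEnd ℂ) s) = (starRingEnd ℂ) (laplaceIntegral g s) := by
  unfold laplaceIntegral
  rw [← integral_conj]
  congr 1; ext t
  rw [map_mul, Complex.conj_ofReal, ← Complex.exp_conj, map_mul, map_neg, Complex.conj_ofReal]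

lemma norm_laplaceIntegral_neg (g : ℝ → ℝ) (σ y : ℝ) :
    ‖laplaceIntegral g (σ + |y| * Complex.I)‖ = ‖laplaceIntegral g (σ + y * Complex.I)‖ := by
  rcases abs_choice y with h | h
  · rw [h]
  · rw [h, ← Complex.norm_conj, ← laplaceIntegral_conj]
    congr 2; simp

lemma norm_add_mul_I_sq (σ y : ℝ) : ‖(σ + y * Complex.I : ℂ)‖ ^ 2 = σ ^ 2 + y ^ 2 := by
  rw [Complex.sq_norm, Complex.normSq_add_mul_I]

lemma re_add_mul_I (σ y : ℝ) : (σ + y * Complex.I : ℂ).re = σ := by simp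

lemma le_norm_add_mul_I (σ y : ℝ) : y ≤ ‖(σ + y * Complex.I : ℂ)‖ := by
  have := (le_abs_self _).trans (Complex.abs_im_le_norm (σ + y * Complex.I))
  simpa using this

/-- The contribution of small frequencies. -/
lemma norm_laplaceIntegral_Pk_sq_le_low {k : ℕ} (hk : 3 ≤ k) :
    ∃ C : ℝ, 0 < C ∧ ∀ σ y : ℝ, 0 < σ → σ ≤ 1 / 4 → 0 ≤ y → y ≤ √σ →
      ‖laplaceIntegral (Pk k) (σ + y * Complex.I)‖ ^ 2 ≤ C * σ ^ (-((k : ℝ) / 2 + 1)) := by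
  have hk' : (3 : ℝ) ≤ k := by exact_mod_cast hk
  obtain ⟨C, hC, h⟩ := norm_laplaceIntegral_Pk_le k (p := ((k : ℝ) / 2 + 1) / 2) (by linarith)
  have hpi := Real.pi_gt_three
  refine ⟨C ^ 2, by positivity, fun σ y hσ hσ1 hy hyσ => ?_⟩
  have hy2 : y ^ 2 ≤ σ := by
    have := pow_le_pow_left₀ hy hyσ 2
    rwa [Real.sq_sqrt hσ.le] at this
  have h1 := h (σ + y * Complex.I) (by simpa using hσ) (by
    rw [norm_add_mul_I_sq, re_add_mul_I]
    have : 9 * σ ≤ π ^ 2 * σ := by gcongr; nlinarith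
    nlinarith)
  set n := ‖(σ + y * Complex.I : ℂ)‖ with hn
  have hn0 : 0 < n := by
    have := norm_add_mul_I_sq σ y
    rw [← hn] at this
    have h0 : 0 ≤ n := norm_nonneg _
    rcases h0.eq_or_lt with h | h
    · rw [← h] at this; nlinarith [sq_nonneg y]
    · exact h
  have e : n ^ (-((k : ℝ) / 2 + 1)) * (n ^ 2 / σ) ^ (((k : ℝ) / 2 + 1) / 2) =
      σ ^ (-(((k : ℝ) / 2 + 1) / 2)) := by
    rw [Real.div_rpow (by positivity) hσ.le, ← Real.rpow_natCast n 2, ← Real.rpow_mul hn0.le,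
      mul_div_assoc', ← Real.rpow_add hn0, Real.rpow_neg hσ.le, div_eq_mul_inv]
    have : -((k : ℝ) / 2 + 1) + ((2 : ℕ) : ℝ) * (((k : ℝ) / 2 + 1) / 2) = 0 := by push_cast; ring
    rw [this, Real.rpow_zero, one_mul]
  rw [re_add_mul_I, mul_assoc, e] at h1
  calc _ ≤ (C * σ ^ (-(((k : ℝ) / 2 + 1) / 2))) ^ 2 := by gcongr
    _ = _ := by
      rw [mul_pow, ← Real.rpow_natCast (σ ^ _), ← Real.rpow_mul hσ.le]
      congr 2; push_cast; ring

lemma norm_laplaceIntegral_Pk_sq_le_high {k : ℕ} (hk : 3 ≤ k) :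
    ∃ C : ℝ, 0 < C ∧ ∀ σ y : ℝ, 0 < σ → σ ≤ 1 / 4 → √σ ≤ y →
      ‖laplaceIntegral (Pk k) (σ + y * Complex.I)‖ ^ 2 ≤
        C * σ ^ (-((k : ℝ) - 2)) * (‖thetaSum (σ + y * Complex.I)‖ ^ 4 / ‖(σ + y * Complex.I : ℂ)‖) +
        C * σ ^ (-((k : ℝ) / 2)) * y ^ (-2 : ℝ) ∧
      ‖laplaceIntegral (Pk k) (σ + y * Complex.I)‖ ^ 2 ≤
        C * σ ^ (-((k : ℝ) - 2)) * (‖thetaSum (σ + y * Complex.I)‖ ^ 4 * y ^ (-2 : ℝ)) +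
        C * σ ^ (-((k : ℝ) / 2)) * y ^ (-2 : ℝ) := by
  obtain ⟨C, hC, h⟩ := thetaSum_norm_sq_le
  obtain ⟨m, rfl⟩ : ∃ m, k = m + 3 := ⟨k - 3, by omega⟩
  refine ⟨max (2 * C ^ (m + 1)) (2 * π ^ (m + 3)), by positivity, fun σ y hσ hσ1 hy => ?_⟩
  set M := max (2 * C ^ (m + 1)) (2 * π ^ (m + 3)) with hM
  have hM1 : 2 * C ^ (m + 1) ≤ M := le_max_left _ _
  have hM2 : 2 * π ^ (m + 3) ≤ M := le_max_right _ _
  have hsq0 : 0 < √σ := Real.sqrt_pos.2 hσ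
  have hy0 : 0 < y := hsq0.trans_le hy
  have hy2 : σ ≤ y ^ 2 := by
    have := pow_le_pow_left₀ hsq0.le hy 2
    rwa [Real.sq_sqrt hσ.le] at this
  obtain ⟨h1, h2⟩ := h (σ + y * Complex.I) (by simpa using hσ) (by rw [re_add_mul_I]; linarith) (by
    rw [norm_add_mul_I_sq, re_add_mul_I]; nlinarith)
  have hyn := le_norm_add_mul_I σ y
  have hs : 0 < (σ + y * Complex.I : ℂ).re := by simpa using hσ
  have hfac := norm_thetaFactor_pow (m + 3) hs
  have hL := laplaceIntegral_Pk (m + 3) hs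
  rw [re_add_mul_I] at h1 h2
  set s : ℂ := σ + y * Complex.I with hsdef
  set n := ‖s‖ with hn
  set θ := ‖thetaSum s‖ with hθ
  have hθ0 : 0 ≤ θ := norm_nonneg _
  have hn0 : 0 < n := hy0.trans_le hyn
  have hLn : ‖laplaceIntegral (Pk (m + 3)) s‖ ^ 2 ≤
      2 * ((θ ^ 2) ^ (m + 3) / n ^ 2) + 2 * (π ^ (m + 3) * n ^ (-((m + 3 : ℕ) : ℝ)) / n ^ 2) := by
    have e1 : ‖thetaFactor s ^ (m + 3)‖ ^ 2 = π ^ (m + 3) * n ^ (-((m + 3 : ℕ) : ℝ)) := by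
      rw [hfac, mul_pow, ← Real.rpow_natCast (π ^ _), ← Real.rpow_mul Real.pi_pos.le,
        ← Real.rpow_natCast (n ^ _), ← Real.rpow_mul hn0.le, ← Real.rpow_natCast π]
      congr 2 <;> push_cast <;> ring
    have h3 : ‖thetaSum s ^ (m + 3) - thetaFactor s ^ (m + 3)‖ ≤
        θ ^ (m + 3) + ‖thetaFactor s ^ (m + 3)‖ := by
      refine (norm_sub_le _ _).trans_eq ?_
      rw [norm_pow (thetaSum s)]
    rw [hL, norm_div, div_pow, ← mul_div_assoc, ← mul_div_assoc, ← add_div]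
    gcongr
    rw [← e1]
    calc _ ≤ (θ ^ (m + 3) + ‖thetaFactor s ^ (m + 3)‖) ^ 2 := by gcongr
      _ ≤ _ := by
        rw [← pow_mul, mul_comm 2 (m + 3), pow_mul]
        nlinarith [sq_nonneg (θ ^ (m + 3) - ‖thetaFactor s ^ (m + 3)‖)]
  have hyinv : y ^ (-2 : ℝ) = (y ^ 2)⁻¹ := by
    rw [Real.rpow_neg hy0.le, Real.rpow_two]
  have hninv : (n ^ 2)⁻¹ ≤ y ^ (-2 : ℝ) := by rw [hyinv]; gcongr
  have hsecond : 2 * (π ^ (m + 3) * n ^ (-((m + 3 : ℕ) : ℝ)) / n ^ 2) ≤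
      M * σ ^ (-(((m + 3 : ℕ) : ℝ) / 2)) * y ^ (-2 : ℝ) := by
    have e2 : n ^ (-((m + 3 : ℕ) : ℝ)) ≤ σ ^ (-(((m + 3 : ℕ) : ℝ) / 2)) := by
      have : σ ^ (-(((m + 3 : ℕ) : ℝ) / 2)) = (√σ) ^ (-((m + 3 : ℕ) : ℝ)) := by
        rw [Real.sqrt_eq_rpow, ← Real.rpow_mul hσ.le]; congr 1; ring
      rw [this]
      exact Real.rpow_le_rpow_of_nonpos hsq0 (hy.trans hyn) (neg_nonpos.2 (Nat.cast_nonneg _))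
    calc _ = 2 * π ^ (m + 3) * n ^ (-((m + 3 : ℕ) : ℝ)) * (n ^ 2)⁻¹ := by ring
      _ ≤ _ := by gcongr
  have eσ : σ ^ (-(((m + 3 : ℕ) : ℝ) - 2)) = (σ⁻¹) ^ (m + 1) := by
    rw [← Real.rpow_natCast, Real.inv_rpow hσ.le, ← Real.rpow_neg hσ.le]
    congr 1; push_cast; ring
  rw [eσ]
  constructor
  · refine hLn.trans (add_le_add ?_ hsecond)
    calc 2 * ((θ ^ 2) ^ (m + 3) / n ^ 2) = 2 * ((θ ^ 2) ^ m * θ ^ 2 * θ ^ 4 / n ^ 2) := by ring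
      _ ≤ 2 * ((C / σ) ^ m * (C / σ * n) * θ ^ 4 / n ^ 2) := by gcongr
      _ = (2 * C ^ (m + 1)) * (σ⁻¹) ^ (m + 1) * (θ ^ 4 / n) := by
        rw [div_eq_mul_inv C σ]
        generalize σ⁻¹ = τ
        field_simp
        ring
      _ ≤ _ := by gcongr
  · refine hLn.trans (add_le_add ?_ hsecond)
    calc 2 * ((θ ^ 2) ^ (m + 3) / n ^ 2) = 2 * ((θ ^ 2) ^ (m + 1) * θ ^ 4 * (n ^ 2)⁻¹) := by ring
      _ ≤ 2 * ((C / σ) ^ (m + 1) * θ ^ 4 * y ^ (-2 : ℝ)) := by gcongr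
      _ = (2 * C ^ (m + 1)) * (σ⁻¹) ^ (m + 1) * (θ ^ 4 * y ^ (-2 : ℝ)) := by
        rw [div_eq_mul_inv]; ring
      _ ≤ _ := by gcongr

lemma norm_thetaSum_pow_four_le {σ : ℝ} (hσ : 0 < σ) (y : ℝ) :
    ‖thetaSum (σ + y * Complex.I)‖ ^ 4 ≤ realTheta σ ^ 4 := by
  have h := norm_thetaSum_le (s := σ + y * Complex.I) (by simpa using hσ)
  rw [re_add_mul_I] at h
  gcongr

lemma integrableOn_thetaSum_tail {σ : ℝ} (hσ : 0 < σ) :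
    MeasureTheory.IntegrableOn
      (fun y : ℝ => ‖thetaSum (σ + y * Complex.I)‖ ^ 4 * y ^ (-2 : ℝ)) (Set.Ioi 2) := by
  refine MeasureTheory.Integrable.mono' ((integrableOn_Ioi_rpow_of_lt (a := -2) (by norm_num)
    (c := 2) (by norm_num)).const_mul (realTheta σ ^ 4)) ?_ ?_
  · exact (((continuous_thetaSum_vertical hσ).norm.pow 4).measurable.mul
      (measurable_id.pow_const _)).aestronglyMeasurable
  · filter_upwards [MeasureTheory.ae_restrict_mem measurableSet_Ioi] with y hy
    have hy0 : (0 : ℝ) < y := lt_trans (by norm_num) hy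
    rw [Real.norm_of_nonneg (by positivity)]
    exact mul_le_mul_of_nonneg_right (norm_thetaSum_pow_four_le hσ y) (by positivity)

lemma integral_thetaSum_tail_le {η : ℝ} (hη : 0 < η) :
    ∃ C : ℝ, 0 < C ∧ ∀ σ : ℝ, 0 < σ → σ ≤ 1 / 4 →
      ∫ y in Set.Ioi (2 : ℝ), ‖thetaSum (σ + y * Complex.I)‖ ^ 4 * y ^ (-2 : ℝ) ≤
        C * σ ^ (-(1 + η)) := by
  obtain ⟨C, hC, h⟩ := integral_thetaSum_pow_four_le hη
  have hsum : Summable fun j : ℕ => (1 : ℝ) / ((j : ℝ) + 1) ^ 2 := by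
    simpa using (summable_nat_add_iff 1).2 (Real.summable_one_div_nat_pow.2 (by norm_num : 1 < 2))
  set S := ∑' j : ℕ, (1 : ℝ) / ((j : ℝ) + 1) ^ 2 with hS
  have hS0 : 0 ≤ S := tsum_nonneg fun _ => by positivity
  have hpi := Real.pi_pos
  have hpi3 := Real.pi_gt_three
  have hpi4 := Real.pi_lt_d2
  refine ⟨(S + 1) * (10 * C), by positivity, fun σ hσ hσ1 => ?_⟩
  set F : ℝ → ℝ := fun y => ‖thetaSum (σ + y * Complex.I)‖ ^ 4 with hF
  have hFc : Continuous F := (continuous_thetaSum_vertical hσ).norm.pow 4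
  have hF0 : ∀ y, 0 ≤ F y := fun y => by positivity
  set a : ℕ → ℝ := fun j => 2 + 2 * π * j with ha
  have ha2 : ∀ j, 2 ≤ a j := fun j => by simp only [ha]; nlinarith [j.cast_nonneg (α := ℝ)]
  have hamono : ∀ j, a j ≤ a (j + 1) := fun j => by
    simp only [ha]; push_cast; nlinarith
  have hcont : ∀ j, ContinuousOn (fun y => F y * y ^ (-2 : ℝ)) (Set.uIcc (a j) (a (j + 1))) := by
    intro j
    refine hFc.continuousOn.mul (continuousOn_id.rpow_const fun y hy => Or.inl ?_)
    rw [Set.uIcc_of_le (hamono j)] at hy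
    have : 2 ≤ y := (ha2 j).trans hy.1
    simp only [id]
    linarith
  have hper : ∀ j, ∫ y in (a j)..(a (j + 1)), F y = ∫ y in (a 0)..(a 1), F y := by
    intro j
    have h1 := intervalIntegral.integral_comp_add_right (a := a 0) (b := a 1) F (2 * π * j)
    have h2 : ∀ y, F (y + 2 * π * j) = F y := fun y => by
      simp only [hF]
      rw [← thetaSum_add_period (σ + y * Complex.I) j]
      congr 3; push_cast; ring
    simp only [h2] at h1
    rw [h1]
    congr 1 <;> simp only [ha] <;> push_cast <;> ring
  have hM : ∫ y in (a 0)..(a 1), F y ≤ 10 * (C * σ ^ (-(1 + η))) := by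
    have hsq : √σ ≤ 1 / 2 := by
      rw [show (1 / 2 : ℝ) = √(1 / 4) by
        rw [show (1 / 4 : ℝ) = (1 / 2) ^ 2 by norm_num]; exact (Real.sqrt_sq (by norm_num)).symm]
      exact Real.sqrt_le_sqrt hσ1
    have hsq0 : 0 < √σ := Real.sqrt_pos.2 hσ
    have hne : ∀ y : ℝ, (σ + y * Complex.I : ℂ) ≠ 0 := fun y h0 => by
      have := congrArg Complex.re h0
      simp at this; linarith
    have hqc : Continuous fun y : ℝ => F y / ‖(σ + y * Complex.I : ℂ)‖ :=
      hFc.div (by fun_prop) fun y => norm_ne_zero_iff.2 (hne y)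
    have e0 : a 0 = 2 := by simp [ha]
    have e1 : a 1 = 2 + 2 * π := by simp [ha]
    calc ∫ y in (a 0)..(a 1), F y
        ≤ ∫ y in (a 0)..(a 1), 10 * (F y / ‖(σ + y * Complex.I : ℂ)‖) := by
          refine intervalIntegral.integral_mono_on (hamono 0) (hFc.intervalIntegrable _ _)
            ((hqc.const_mul 10).intervalIntegrable _ _) fun y hy => ?_
          have hn0 : 0 < ‖(σ + y * Complex.I : ℂ)‖ := norm_pos_iff.2 (hne y)
          have hn : ‖(σ + y * Complex.I : ℂ)‖ ≤ 10 := by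
            rw [e0, e1] at hy
            refine le_of_sq_le_sq ?_ (by norm_num)
            rw [norm_add_mul_I_sq]
            nlinarith [hy.1, hy.2]
          rw [mul_div_assoc', le_div_iff₀ hn0]
          nlinarith [hF0 y]
      _ = 10 * ∫ y in (a 0)..(a 1), F y / ‖(σ + y * Complex.I : ℂ)‖ := by
          rw [intervalIntegral.integral_const_mul]
      _ ≤ 10 * ∫ y in (√σ)..9, F y / ‖(σ + y * Complex.I : ℂ)‖ := by
          refine mul_le_mul_of_nonneg_left ?_ (by norm_num)
          refine intervalIntegral.integral_mono_interval (by linarith) (hamono 0) (by linarith)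
            (Filter.Eventually.of_forall fun y => by have := hF0 y; simp only [Pi.zero_apply]; positivity)
            (hqc.intervalIntegrable _ _)
      _ ≤ _ := by gcongr; exact h σ hσ hσ1
  have hB0 : 0 ≤ 10 * (C * σ ^ (-(1 + η))) := by positivity
  have hpiece : ∀ j, ∫ y in (a j)..(a (j + 1)), F y * y ^ (-2 : ℝ) ≤
      1 / ((j : ℝ) + 1) ^ 2 * (10 * (C * σ ^ (-(1 + η)))) := by
    intro j
    calc ∫ y in (a j)..(a (j + 1)), F y * y ^ (-2 : ℝ)
        ≤ ∫ y in (a j)..(a (j + 1)), 1 / ((j : ℝ) + 1) ^ 2 * F y := by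
          refine intervalIntegral.integral_mono_on (hamono j) (hcont j).intervalIntegrable
            ((hFc.const_mul _).intervalIntegrable _ _) fun y hy => ?_
          rw [mul_comm]
          refine mul_le_mul_of_nonneg_right ?_ (hF0 y)
          have hj : (0 : ℝ) ≤ j := j.cast_nonneg
          have hyj : (j : ℝ) + 1 ≤ y := by
            refine le_trans ?_ hy.1
            simp only [ha]; nlinarith
          rw [Real.rpow_neg (by linarith), Real.rpow_two, one_div]
          gcongr
      _ = 1 / ((j : ℝ) + 1) ^ 2 * ∫ y in (a 0)..(a 1), F y := by
          rw [intervalIntegral.integral_const_mul, hper]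
      _ ≤ _ := by gcongr
  have hfin : ∀ N : ℕ, ∫ y in (2 : ℝ)..(a N), F y * y ^ (-2 : ℝ) ≤
      (S + 1) * (10 * C) * σ ^ (-(1 + η)) := by
    intro N
    have hadj := intervalIntegral.sum_integral_adjacent_intervals (a := a) (n := N)
      (μ := MeasureTheory.volume) fun j _ => (hcont j).intervalIntegrable
    have e0 : a 0 = 2 := by simp [ha]
    rw [e0] at hadj
    rw [← hadj]
    calc _ ≤ ∑ j ∈ Finset.range N, 1 / ((j : ℝ) + 1) ^ 2 * (10 * (C * σ ^ (-(1 + η)))) :=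
          Finset.sum_le_sum fun j _ => hpiece j
      _ = (∑ j ∈ Finset.range N, 1 / ((j : ℝ) + 1) ^ 2) * (10 * (C * σ ^ (-(1 + η)))) := by
          rw [Finset.sum_mul]
      _ ≤ (S + 1) * (10 * (C * σ ^ (-(1 + η)))) := by
          gcongr
          exact (hsum.sum_le_tsum _ fun _ _ => by positivity).trans (by linarith)
      _ = _ := by ring
  have htend : Filter.Tendsto a Filter.atTop Filter.atTop :=
    Filter.tendsto_atTop_add_const_left _ _
      (tendsto_natCast_atTop_atTop.const_mul_atTop (by positivity))
  exact le_of_tendsto' (MeasureTheory.intervalIntegral_tendsto_integral_Ioi 2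
    (integrableOn_thetaSum_tail hσ) htend) hfin

/-- The mean square of the lattice point discrepancy. -/
lemma integral_Pk_sq_mul_exp_le {k : ℕ} (hk : 3 ≤ k) {η : ℝ} (hη : 0 < η) :
    ∃ C : ℝ, 0 < C ∧ ∀ σ : ℝ, 0 < σ → σ ≤ 1 / 4 →
      ∫ t in Set.Ioi (0 : ℝ), Pk k t ^ 2 * Real.exp (-(2 * σ * t)) ≤
        C * σ ^ (-((k : ℝ) - 1 + η)) := by
  obtain ⟨A, hA, hlow⟩ := norm_laplaceIntegral_Pk_sq_le_low hk
  obtain ⟨B, hB, hhigh⟩ := norm_laplaceIntegral_Pk_sq_le_high hk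
  obtain ⟨D, hD, hmid⟩ := integral_thetaSum_pow_four_le hη
  obtain ⟨E, hE, htail⟩ := integral_thetaSum_tail_le hη
  have hk' : (3 : ℝ) ≤ k := by exact_mod_cast hk
  refine ⟨A + B * (D + E) + B, by positivity, fun σ hσ hσ1 => ?_⟩
  have hpi := Real.pi_gt_three
  obtain ⟨hInt, heq⟩ := integral_norm_laplaceIntegral_sq (polyBounded_Pk k) hσ
  set W : ℝ → ℝ := fun y => ‖laplaceIntegral (Pk k) (σ + y * Complex.I)‖ ^ 2 with hW
  have hr : 0 < √σ := Real.sqrt_pos.2 hσ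
  have hr2 : √σ ≤ 2 := by
    rw [Real.sqrt_le_left (by norm_num)]; linarith
  have habs : ∫ y, W y = 2 * ∫ y in Set.Ioi (0 : ℝ), W y := by
    rw [← integral_comp_abs]
    refine MeasureTheory.integral_congr_ae (Filter.Eventually.of_forall fun y => ?_)
    simp only [hW]
    rw [norm_laplaceIntegral_neg]
  have hsplit : ∫ y in Set.Ioi (0 : ℝ), W y =
      (∫ y in (0 : ℝ)..√σ, W y) + ((∫ y in √σ..2, W y) + ∫ y in Set.Ioi (2 : ℝ), W y) := by
    rw [intervalIntegral.integral_interval_add_Ioi hInt.integrableOn hInt.integrableOn,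
      intervalIntegral.integral_interval_add_Ioi hInt.integrableOn hInt.integrableOn]
  set J : ℝ → ℝ := fun y => y ^ (-2 : ℝ) with hJ
  have hJint : ∀ c : ℝ, 0 < c → MeasureTheory.IntegrableOn J (Set.Ioi c) := fun c hc =>
    integrableOn_Ioi_rpow_of_lt (by norm_num) hc
  have hJsum : (∫ y in √σ..2, J y) + ∫ y in Set.Ioi (2 : ℝ), J y = (√σ)⁻¹ := by
    rw [intervalIntegral.integral_interval_add_Ioi (hJint _ hr) (hJint _ (by norm_num)),
      integral_Ioi_rpow_of_lt (by norm_num) hr]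
    norm_num [Real.rpow_neg_one]
  have hJ' : IntervalIntegrable J MeasureTheory.volume (√σ) 2 := by
    rw [intervalIntegrable_iff_integrableOn_Ioc_of_le hr2]
    exact (hJint _ hr).mono_set Set.Ioc_subset_Ioi_self
  have h1 : ∫ y in (0 : ℝ)..√σ, W y ≤ √σ * (A * σ ^ (-((k : ℝ) / 2 + 1))) := by
    have := intervalIntegral.integral_mono_on (a := 0) (b := √σ) (f := W)
      (g := fun _ => A * σ ^ (-((k : ℝ) / 2 + 1))) (μ := MeasureTheory.volume) hr.le
      hInt.intervalIntegrable intervalIntegrable_const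
      (fun y hy => hlow σ y hσ hσ1 hy.1 hy.2)
    rwa [intervalIntegral.integral_const, sub_zero, smul_eq_mul] at this
  set Q : ℝ → ℝ := fun y => ‖thetaSum (σ + y * Complex.I)‖ ^ 4 / ‖(σ + y * Complex.I : ℂ)‖ with hQ
  have hQc : Continuous Q := by
    refine ((continuous_thetaSum_vertical hσ).norm.pow 4).div (by fun_prop) fun y h => ?_
    have h2 := congrArg Complex.re (norm_eq_zero.1 h)
    rw [re_add_mul_I] at h2
    exact hσ.ne' h2
  have h2 : ∫ y in √σ..2, W y ≤
      B * σ ^ (-((k : ℝ) - 2)) * (D * σ ^ (-(1 + η))) +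
        B * σ ^ (-((k : ℝ) / 2)) * ∫ y in √σ..2, J y := by
    have hi1 : IntervalIntegrable (fun y => B * σ ^ (-((k : ℝ) - 2)) * Q y)
        MeasureTheory.volume (√σ) 2 := (hQc.const_mul _).intervalIntegrable _ _
    have hi2 : IntervalIntegrable (fun y => B * σ ^ (-((k : ℝ) / 2)) * J y)
        MeasureTheory.volume (√σ) 2 := hJ'.const_mul _
    have := intervalIntegral.integral_mono_on hr2 hInt.intervalIntegrable (hi1.add hi2)
      (fun y hy => (hhigh σ y hσ hσ1 hy.1).1)
    refine this.trans ?_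
    rw [intervalIntegral.integral_add hi1 hi2, intervalIntegral.integral_const_mul,
      intervalIntegral.integral_const_mul]
    gcongr
    refine le_trans ?_ (hmid σ hσ hσ1)
    exact intervalIntegral.integral_mono_interval le_rfl hr2 (by norm_num)
      (Filter.Eventually.of_forall fun y => by simp only [hQ]; positivity)
      (hQc.intervalIntegrable _ _)
  have h3 : ∫ y in Set.Ioi (2 : ℝ), W y ≤
      B * σ ^ (-((k : ℝ) - 2)) * (E * σ ^ (-(1 + η))) +
        B * σ ^ (-((k : ℝ) / 2)) * ∫ y in Set.Ioi (2 : ℝ), J y := by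
    have hi1 := (integrableOn_thetaSum_tail hσ).const_mul (B * σ ^ (-((k : ℝ) - 2)))
    have hi2 := (hJint 2 (by norm_num)).const_mul (B * σ ^ (-((k : ℝ) / 2)))
    have := MeasureTheory.setIntegral_mono_on hInt.integrableOn (hi1.add hi2) measurableSet_Ioi
      (fun y hy => (hhigh σ y hσ hσ1 (hr2.trans (le_of_lt hy))).2)
    refine this.trans ?_
    rw [MeasureTheory.integral_add' hi1 hi2, MeasureTheory.integral_const_mul,
      MeasureTheory.integral_const_mul]
    gcongr
    exact htail σ hσ hσ1
  have hsq : √σ = σ ^ (1 / 2 : ℝ) := Real.sqrt_eq_rpow σ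
  have e1 : √σ * (A * σ ^ (-((k : ℝ) / 2 + 1))) ≤ A * σ ^ (-((k : ℝ) - 1 + η)) := by
    rw [mul_left_comm, hsq, ← Real.rpow_add hσ]
    gcongr 1
    exact Real.rpow_le_rpow_of_exponent_ge hσ (by linarith) (by linarith)
  have e2 : σ ^ (-((k : ℝ) - 2)) * σ ^ (-(1 + η)) = σ ^ (-((k : ℝ) - 1 + η)) := by
    rw [← Real.rpow_add hσ]; ring_nf
  have e3 : B * σ ^ (-((k : ℝ) / 2)) * (√σ)⁻¹ ≤ B * σ ^ (-((k : ℝ) - 1 + η)) := by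
    rw [mul_assoc, hsq, ← Real.rpow_neg hσ.le, ← Real.rpow_add hσ]
    gcongr 1
    exact Real.rpow_le_rpow_of_exponent_ge hσ (by linarith) (by linarith)
  have hI : ∫ y in Set.Ioi (0 : ℝ), W y ≤
      (A + B * (D + E) + B) * σ ^ (-((k : ℝ) - 1 + η)) := by
    rw [hsplit]
    have e4 := congrArg (fun z => B * σ ^ (-((k : ℝ) / 2)) * z) hJsum
    simp only [mul_add] at e4
    have e5 : B * σ ^ (-((k : ℝ) - 2)) * (D * σ ^ (-(1 + η))) =
      B * D * σ ^ (-((k : ℝ) - 1 + η)) := by rw [← e2]; ring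
    have e6 : B * σ ^ (-((k : ℝ) - 2)) * (E * σ ^ (-(1 + η))) =
      B * E * σ ^ (-((k : ℝ) - 1 + η)) := by rw [← e2]; ring
    linarith
  rw [heq, habs]
  have hI0 : 0 ≤ ∫ y in Set.Ioi (0 : ℝ), W y :=
    MeasureTheory.setIntegral_nonneg measurableSet_Ioi fun y _ => by simp only [hW]; positivity
  refine le_trans ?_ hI
  rw [inv_mul_le_iff₀ (by positivity)]
  nlinarith

lemma norm_laplaceIntegral_Pk_le_of_norm_le (k : ℕ) :
    ∃ C : ℝ, 0 < C ∧ ∀ s : ℂ, 0 < s.re → ‖s‖ ≤ 3 * s.re →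
      ‖laplaceIntegral (Pk k) s‖ ≤ C * (‖s‖ / (1 + ‖s‖)) ^ k := by
  have hk0 : (0 : ℝ) ≤ k := Nat.cast_nonneg k
  obtain ⟨C, hC, h⟩ := norm_laplaceIntegral_Pk_le k (p := 3 * k / 2 + 1) (by linarith)
  have hpi := Real.pi_gt_three
  have hθ : 0 ≤ realTheta 1 := zero_le_one.trans (one_le_realTheta one_pos)
  refine ⟨C * 3 ^ (3 * (k : ℝ) / 2 + 1) * 4 ^ k + (realTheta 1 ^ k + π ^ ((k : ℝ) / 2)) * 2 ^ k,
    by positivity, fun s hs hs3 => ?_⟩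
  have hn : 0 < ‖s‖ := hs.trans_le ((le_abs_self _).trans (Complex.abs_re_le_norm s))
  rw [add_mul]
  rcases le_or_gt ‖s‖ 3 with hle | hgt
  · have hsq : ‖s‖ ^ 2 ≤ π ^ 2 * s.re := by
      have h1 : ‖s‖ ^ 2 ≤ 9 * s.re := by nlinarith
      have h2 : 9 * s.re ≤ π ^ 2 * s.re := by gcongr; nlinarith
      exact h1.trans h2
    refine le_add_of_le_of_nonneg ((h s hs hsq).trans ?_) (by positivity)
    have h1 : ‖s‖ ^ 2 / s.re ≤ 3 * ‖s‖ := by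
      rw [div_le_iff₀ hs]; nlinarith
    have h2 : ‖s‖ ≤ 4 * (‖s‖ / (1 + ‖s‖)) := by
      rw [mul_div_assoc', le_div_iff₀ (by positivity)]; nlinarith
    calc C * ‖s‖ ^ (-((k : ℝ) / 2 + 1)) * (‖s‖ ^ 2 / s.re) ^ (3 * (k : ℝ) / 2 + 1)
        ≤ C * ‖s‖ ^ (-((k : ℝ) / 2 + 1)) * (3 * ‖s‖) ^ (3 * (k : ℝ) / 2 + 1) := by gcongr
      _ = C * 3 ^ (3 * (k : ℝ) / 2 + 1) *
          (‖s‖ ^ (-((k : ℝ) / 2 + 1)) * ‖s‖ ^ (3 * (k : ℝ) / 2 + 1)) := by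
        rw [Real.mul_rpow (by norm_num) hn.le]; ring
      _ = C * 3 ^ (3 * (k : ℝ) / 2 + 1) * ‖s‖ ^ k := by
        rw [← Real.rpow_add hn, ← Real.rpow_natCast]; ring_nf
      _ ≤ C * 3 ^ (3 * (k : ℝ) / 2 + 1) * (4 * (‖s‖ / (1 + ‖s‖))) ^ k := by gcongr
      _ = _ := by rw [mul_pow]; ring
  · refine le_add_of_nonneg_of_le (by positivity) ?_
    have h2 : 1 ≤ 2 * (‖s‖ / (1 + ‖s‖)) := by
      rw [mul_div_assoc', le_div_iff₀ (by positivity)]; linarith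
    have h3 : ‖thetaSum s‖ ≤ realTheta 1 :=
      (norm_thetaSum_le hs).trans (realTheta_anti one_pos (by linarith))
    have h4 : ‖thetaFactor s ^ k‖ ≤ π ^ ((k : ℝ) / 2) := by
      rw [norm_thetaFactor_pow k hs]
      exact mul_le_of_le_one_right (by positivity)
        (Real.rpow_le_one_of_one_le_of_nonpos (by linarith) (by linarith))
    rw [laplaceIntegral_Pk k hs, norm_div]
    calc ‖thetaSum s ^ k - thetaFactor s ^ k‖ / ‖s‖ ≤ ‖thetaSum s ^ k - thetaFactor s ^ k‖ :=
          div_le_self (norm_nonneg _) (by linarith)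
      _ ≤ ‖thetaSum s‖ ^ k + ‖thetaFactor s ^ k‖ := by
        rw [← norm_pow]; exact norm_sub_le _ _
      _ ≤ (realTheta 1 ^ k + π ^ ((k : ℝ) / 2)) * 1 ^ k := by
        rw [one_pow, mul_one]; gcongr
      _ ≤ (realTheta 1 ^ k + π ^ ((k : ℝ) / 2)) * (2 * (‖s‖ / (1 + ‖s‖))) ^ k := by gcongr
      _ = _ := by rw [mul_pow]; ring

lemma abs_integral_Pk_mul_pow_le (k : ℕ) :
    ∃ C : ℝ, 0 < C ∧ ∀ δ : ℝ, 0 < δ →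
      |∫ t in Set.Ioi (0 : ℝ), Pk k t * t ^ k * Real.exp (-(δ * t))| ≤ C * (1 + δ) ^ (-(k : ℝ)) := by
  obtain ⟨C, hC, h⟩ := norm_laplaceIntegral_Pk_le_of_norm_le k
  refine ⟨k.factorial * (C * 6 ^ k), by positivity, fun δ hδ => ?_⟩
  have hmem : ∀ z ∈ Metric.closedBall (δ : ℂ) (δ / 2),
      δ / 2 ≤ z.re ∧ ‖z‖ ≤ 3 / 2 * δ := fun z hz => by
    rw [Metric.mem_closedBall, Complex.dist_eq] at hz
    constructor
    · have := (abs_le.1 ((Complex.abs_re_le_norm (z - δ)).trans hz)).1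
      rw [Complex.sub_re, Complex.ofReal_re] at this
      linarith
    · have := norm_add_le (z - δ) δ
      rw [sub_add_cancel, Complex.norm_real, Real.norm_of_nonneg hδ.le] at this
      linarith
  have hd : DiffContOnCl ℂ (laplaceIntegral (Pk k)) (Metric.ball (δ : ℂ) (δ / 2)) := by
    refine DifferentiableOn.diffContOnCl_ball (U := {s : ℂ | 0 < s.re}) (fun z hz =>
      (hasDerivAt_laplaceIntegral (polyBounded_Pk k) hz).differentiableAt.differentiableWithinAt)
      fun z hz => ?_
    exact (half_pos hδ).trans_le (hmem z hz).1
  have hM : ∀ z ∈ Metric.sphere (δ : ℂ) (δ / 2),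
      ‖laplaceIntegral (Pk k) z‖ ≤ C * (3 * δ / (1 + δ)) ^ k := fun z hz => by
    obtain ⟨h1, h2⟩ := hmem z (Metric.sphere_subset_closedBall hz)
    refine (h z (by linarith) (by linarith)).trans ?_
    gcongr C * ?_ ^ k
    rw [div_le_div_iff₀ (by positivity) (by positivity)]
    nlinarith [norm_nonneg z]
  have hc := Complex.norm_iteratedDeriv_le_of_forall_mem_sphere_norm_le k (half_pos hδ) hd hM
  rw [iteratedDeriv_laplaceIntegral (polyBounded_Pk k) k δ (by simpa using hδ),
    laplaceIntegral_ofReal, Complex.norm_real, Real.norm_eq_abs] at hc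
  have e : ∫ t in Set.Ioi (0 : ℝ), (-t) ^ k * Pk k t * Real.exp (-(δ * t)) =
      (-1) ^ k * ∫ t in Set.Ioi (0 : ℝ), Pk k t * t ^ k * Real.exp (-(δ * t)) := by
    rw [← MeasureTheory.integral_const_mul]
    congr 1; ext t
    rw [neg_pow]; ring
  rw [e, abs_mul, abs_pow, abs_neg, abs_one, one_pow, one_mul] at hc
  refine hc.trans (le_of_eq ?_)
  rw [Real.rpow_neg (by positivity), Real.rpow_natCast, div_pow, div_pow, mul_pow,
    show (6 : ℝ) = 3 * 2 by norm_num, mul_pow]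
  field_simp

lemma integral_Pk_mul_rpow_eq {k : ℕ} (hk : 3 ≤ k) {δ : ℝ} (hδ : 0 < δ) :
    Real.Gamma ((k : ℝ) / 2 + 1) *
        ∫ t in Set.Ioi (0 : ℝ), Pk k t * t ^ ((k : ℝ) / 2 - 1) * Real.exp (-(δ * t)) =
      ∫ u in Set.Ioi (0 : ℝ), u ^ ((k : ℝ) / 2) *
        ∫ t in Set.Ioi (0 : ℝ), Pk k t * t ^ k * Real.exp (-((u + δ) * t)) := by
  have hk' : (3 : ℝ) ≤ k := by exact_mod_cast hk
  have hG := Real.Gamma_pos_of_pos (show 0 < (k : ℝ) / 2 + 1 by linarith)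
  have hinner : ∀ t : ℝ, 0 < t →
      t ^ k * ∫ u in Set.Ioi (0 : ℝ), u ^ ((k : ℝ) / 2) * Real.exp (-(t * u)) =
        Real.Gamma ((k : ℝ) / 2 + 1) * t ^ ((k : ℝ) / 2 - 1) := fun t ht => by
    rw [integral_rpow_mul_exp (by linarith) ht, one_div, Real.inv_rpow ht.le, ← Real.rpow_neg ht.le,
      ← mul_assoc, ← Real.rpow_natCast, ← Real.rpow_add ht, mul_comm]
    congr 2; ring
  set F : ℝ → ℝ → ℝ := fun t u =>
    Pk k t * t ^ k * Real.exp (-(δ * t)) * (u ^ ((k : ℝ) / 2) * Real.exp (-(t * u))) with hF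
  have hmeas : Measurable (Function.uncurry F) := by
    have := measurable_Pk k
    simp only [hF, Function.uncurry_def]
    fun_prop
  have hintF : MeasureTheory.Integrable (Function.uncurry F)
      ((MeasureTheory.volume.restrict (Set.Ioi (0 : ℝ))).prod
        (MeasureTheory.volume.restrict (Set.Ioi (0 : ℝ)))) := by
    rw [MeasureTheory.integrable_prod_iff hmeas.aestronglyMeasurable]
    constructor
    · filter_upwards [MeasureTheory.ae_restrict_mem measurableSet_Ioi] with t ht
      exact ((polyBounded_rpow (p := (k : ℝ) / 2) (by positivity)).integrableOn_exp_real ht).const_mul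
        (Pk k t * t ^ k * Real.exp (-(δ * t)))
    · have hp : PolyBounded fun t =>
          Pk k t * (Real.Gamma ((k : ℝ) / 2 + 1) * t ^ ((k : ℝ) / 2 - 1)) :=
        (polyBounded_Pk k).mul ((polyBounded_const _).mul (polyBounded_rpow (by linarith)))
      refine (hp.integrableOn_exp_real hδ).norm.congr ?_
      filter_upwards [MeasureTheory.ae_restrict_mem measurableSet_Ioi] with t ht
      have e : ∫ u in Set.Ioi (0 : ℝ), ‖F t u‖ = ∫ u in Set.Ioi (0 : ℝ),
          |Pk k t| * t ^ k * Real.exp (-(δ * t)) * (u ^ ((k : ℝ) / 2) * Real.exp (-(t * u))) := by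
        refine MeasureTheory.setIntegral_congr_fun measurableSet_Ioi fun u hu => ?_
        have hu : 0 < u := hu
        have ht : 0 < t := ht
        simp only [hF, norm_mul, Real.norm_eq_abs, Real.abs_exp, abs_pow, abs_of_pos ht,
          abs_of_pos (Real.rpow_pos_of_pos hu _)]
      simp only [Function.uncurry_apply_pair]
      rw [e, MeasureTheory.integral_const_mul, ← hinner t ht, Real.norm_eq_abs, abs_mul, Real.abs_exp,
        abs_mul, abs_of_nonneg (show 0 ≤ t ^ k * ∫ u in Set.Ioi (0 : ℝ),
          u ^ ((k : ℝ) / 2) * Real.exp (-(t * u)) by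
            rw [hinner t ht]
            exact mul_nonneg hG.le (Real.rpow_nonneg (le_of_lt ht) _))]
      ring
  have hswap := MeasureTheory.integral_integral_swap (f := F) hintF
  calc _ = ∫ t in Set.Ioi (0 : ℝ), ∫ u in Set.Ioi (0 : ℝ), F t u := by
        rw [← MeasureTheory.integral_const_mul]
        refine MeasureTheory.setIntegral_congr_fun measurableSet_Ioi fun t ht => ?_
        simp only [hF]
        rw [MeasureTheory.integral_const_mul]
        linear_combination (-(Pk k t * Real.exp (-(δ * t)))) * hinner t ht
    _ = _ := by
        rw [hswap]
        refine MeasureTheory.setIntegral_congr_fun measurableSet_Ioi fun u hu => ?_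
        simp only [hF]
        rw [← MeasureTheory.integral_const_mul]
        congr 1; ext t
        rw [show -((u + δ) * t) = -(δ * t) + -(t * u) by ring, Real.exp_add]
        ring

/-- The first moment of the discrepancy against the derivative of the volume is bounded. -/
lemma abs_integral_Pk_mul_rpow_le {k : ℕ} (hk : 3 ≤ k) :
    ∃ C : ℝ, 0 < C ∧ ∀ δ : ℝ, 0 < δ →
      |∫ t in Set.Ioi (0 : ℝ), Pk k t * t ^ ((k : ℝ) / 2 - 1) * Real.exp (-(δ * t))| ≤ C := by
  have hk' : (3 : ℝ) ≤ k := by exact_mod_cast hk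
  have hG := Real.Gamma_pos_of_pos (show 0 < (k : ℝ) / 2 + 1 by linarith)
  obtain ⟨C, hC, h⟩ := abs_integral_Pk_mul_pow_le k
  have hInt : MeasureTheory.IntegrableOn (fun u : ℝ => C * (u + 1) ^ (-((k : ℝ) / 2))) (Set.Ioi 0) :=
    (integrableOn_add_rpow_Ioi_of_lt (by linarith) (by norm_num)).const_mul C
  have hnn : 0 ≤ ∫ u in Set.Ioi (0 : ℝ), C * (u + 1) ^ (-((k : ℝ) / 2)) :=
    MeasureTheory.setIntegral_nonneg measurableSet_Ioi fun u hu => by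
      have : (0 : ℝ) < u := hu
      positivity
  refine ⟨(∫ u in Set.Ioi (0 : ℝ), C * (u + 1) ^ (-((k : ℝ) / 2))) / Real.Gamma ((k : ℝ) / 2 + 1) + 1,
    by positivity, fun δ hδ => ?_⟩
  refine le_trans ?_ (le_add_of_nonneg_right zero_le_one)
  rw [le_div_iff₀ hG, mul_comm, ← abs_of_pos hG, ← abs_mul,
    integral_Pk_mul_rpow_eq hk hδ, ← Real.norm_eq_abs]
  refine MeasureTheory.norm_integral_le_of_norm_le hInt ?_
  filter_upwards [MeasureTheory.ae_restrict_mem measurableSet_Ioi] with u hu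
  have hu : 0 < u := hu
  rw [norm_mul, Real.norm_eq_abs, Real.norm_eq_abs, abs_of_pos (Real.rpow_pos_of_pos hu _)]
  calc u ^ ((k : ℝ) / 2) * _ ≤ (u + 1) ^ ((k : ℝ) / 2) * (C * (1 + (u + δ)) ^ (-(k : ℝ))) :=
        mul_le_mul (Real.rpow_le_rpow hu.le (by linarith) (by linarith)) (h _ (by positivity))
          (abs_nonneg _) (by positivity)
    _ ≤ (u + 1) ^ ((k : ℝ) / 2) * (C * (u + 1) ^ (-(k : ℝ))) := by
        gcongr (u + 1) ^ ((k : ℝ) / 2) * (C * ?_)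
        exact Real.rpow_le_rpow_of_nonpos (by positivity) (by linarith) (by linarith)
    _ = C * ((u + 1) ^ ((k : ℝ) / 2) * (u + 1) ^ (-(k : ℝ))) := by ring
    _ = _ := by
        rw [← Real.rpow_add (by positivity)]; ring_nf

lemma floor_cast_nonneg {t : ℝ} (ht : 0 ≤ t) : (0 : ℝ) ≤ (⌊t⌋ : ℝ) := by
  exact_mod_cast Int.floor_nonneg.2 ht

lemma rpow_sub_floor_rpow_nonneg {a t : ℝ} (ha : 0 ≤ a) (ht : 0 ≤ t) :
    0 ≤ t ^ a - (⌊t⌋ : ℝ) ^ a :=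
  sub_nonneg.2 (Real.rpow_le_rpow (floor_cast_nonneg ht) (Int.floor_le t) ha)

lemma rpow_sub_floor_rpow_le_mul {a t : ℝ} (ha : 1 ≤ a) (ht : 0 < t) :
    t ^ a - (⌊t⌋ : ℝ) ^ a ≤ a * t ^ (a - 1) * Int.fract t := by
  have hf := Int.self_sub_floor t
  have hn := floor_cast_nonneg ht.le
  have hs : -1 ≤ -(Int.fract t / t) := by
    rw [neg_le_neg_iff, div_le_one ht]; linarith
  have h := one_add_mul_self_le_rpow_one_add hs ha
  have e : (⌊t⌋ : ℝ) = t * (1 + -(Int.fract t / t)) := by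
    field_simp; linarith
  have e2 : t ^ a = t ^ (a - 1) * t := by
    rw [← Real.rpow_add_one ht.ne']; ring_nf
  have h2 := mul_le_mul_of_nonneg_left h (Real.rpow_nonneg ht.le a)
  rw [← Real.mul_rpow ht.le (by linarith), ← e] at h2
  have e3 : t ^ a * (1 + a * -(Int.fract t / t)) = t ^ a - a * t ^ (a - 1) * Int.fract t := by
    rw [e2]; field_simp; ring
  linarith

lemma mul_le_rpow_sub_floor_rpow {a t : ℝ} (ha : 1 < a) (ht : 0 < t) :
    a * (⌊t⌋ : ℝ) ^ (a - 1) * Int.fract t ≤ t ^ a - (⌊t⌋ : ℝ) ^ a := by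
  have hf := Int.self_sub_floor t
  have hf0 := Int.fract_nonneg t
  rcases (floor_cast_nonneg ht.le).eq_or_lt with h0 | hn
  · rw [← h0, Real.zero_rpow (by linarith), Real.zero_rpow (by linarith)]
    simpa using Real.rpow_nonneg ht.le a
  · have hd : 0 ≤ Int.fract t / (⌊t⌋ : ℝ) := by positivity
    have h := one_add_mul_self_le_rpow_one_add (s := Int.fract t / (⌊t⌋ : ℝ)) (by linarith) ha.le
    have e : t = (⌊t⌋ : ℝ) * (1 + Int.fract t / (⌊t⌋ : ℝ)) := by
      field_simp; linarith
    have e2 : (⌊t⌋ : ℝ) ^ a = (⌊t⌋ : ℝ) ^ (a - 1) * (⌊t⌋ : ℝ) := by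
      rw [← Real.rpow_add_one hn.ne']; ring_nf
    have h2 := mul_le_mul_of_nonneg_left h (Real.rpow_nonneg hn.le a)
    rw [← Real.mul_rpow hn.le (by positivity), ← e] at h2
    have e3 : (⌊t⌋ : ℝ) ^ a * (1 + a * (Int.fract t / (⌊t⌋ : ℝ))) =
        (⌊t⌋ : ℝ) ^ a + a * (⌊t⌋ : ℝ) ^ (a - 1) * Int.fract t := by
      rw [e2]; field_simp
    linarith

lemma rpow_sub_floor_rpow_le {a : ℝ} (ha : 0 < a) :
    ∃ C : ℝ, 0 < C ∧ ∀ t : ℝ, 0 < t → t ^ a - (⌊t⌋ : ℝ) ^ a ≤ C * (1 + t) ^ (a - 1) := by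
  rcases le_or_gt 1 a with h1 | h1
  · refine ⟨a, ha, fun t ht => (rpow_sub_floor_rpow_le_mul h1 ht).trans ?_⟩
    calc a * t ^ (a - 1) * Int.fract t ≤ a * t ^ (a - 1) * 1 := by
          gcongr; exact (Int.fract_lt_one t).le
      _ ≤ _ := by
          rw [mul_one]
          gcongr
          linarith
  · refine ⟨3, by norm_num, fun t ht => ?_⟩
    have hf := Int.self_sub_floor t
    have hf0 := Int.fract_nonneg t
    have hf1 := Int.fract_lt_one t
    have e1 : (1 + t) ^ (a - 1) = (1 + t) ^ a / (1 + t) := Real.rpow_sub_one (by positivity) a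
    rcases (floor_cast_nonneg ht.le).eq_or_lt with h0 | hn
    · rw [← h0, Real.zero_rpow ha.ne', sub_zero, e1, mul_div_assoc', le_div_iff₀ (by positivity)]
      have h2 : t ^ a ≤ (1 + t) ^ a := by gcongr; linarith
      have h3 : 0 ≤ (1 + t) ^ a := by positivity
      have h4 : t < 1 := by linarith
      nlinarith [Real.rpow_nonneg ht.le a]
    · have hn1 : (1 : ℝ) ≤ (⌊t⌋ : ℝ) := by
        exact_mod_cast Int.add_one_le_of_lt (show (0 : ℤ) < ⌊t⌋ by exact_mod_cast hn)
      have hd : 0 ≤ Int.fract t / (⌊t⌋ : ℝ) := by positivity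
      have h := rpow_one_add_le_one_add_mul_self (s := Int.fract t / (⌊t⌋ : ℝ)) (by linarith)
        ha.le h1.le
      have e : t = (⌊t⌋ : ℝ) * (1 + Int.fract t / (⌊t⌋ : ℝ)) := by
        field_simp; linarith
      have h2 := mul_le_mul_of_nonneg_left h (Real.rpow_nonneg hn.le a)
      rw [← Real.mul_rpow hn.le (by positivity), ← e] at h2
      have h3 : (⌊t⌋ : ℝ) ^ a * (a * (Int.fract t / (⌊t⌋ : ℝ))) ≤
          (1 + t) ^ a * (1 * (1 / (⌊t⌋ : ℝ))) := by
        gcongr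
        linarith
      have h4 : 1 / (⌊t⌋ : ℝ) ≤ 3 / (1 + t) := by
        rw [div_le_div_iff₀ hn (by positivity)]; linarith
      have h5 : (1 + t) ^ a * (1 * (1 / (⌊t⌋ : ℝ))) ≤ (1 + t) ^ a * (3 / (1 + t)) := by
        rw [one_mul]; gcongr
      rw [e1, mul_div_assoc', mul_comm 3, ← mul_div_assoc']
      linarith

lemma PolyBounded.comp_floor {g : ℝ → ℝ} (hg : PolyBounded g) : PolyBounded fun t => g ⌊t⌋ := by
  obtain ⟨hm, C, m, hC, h⟩ := hg
  refine ⟨hm.comp (by fun_prop), C + |g 0|, m, by positivity, fun t ht => ?_⟩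
  have h1 : 1 ≤ (1 + t) ^ m := one_le_pow₀ (by linarith)
  rcases (floor_cast_nonneg ht.le).eq_or_lt with h0 | hn
  · simp only [← h0]
    nlinarith [abs_nonneg (g 0)]
  · calc _ ≤ C * (1 + (⌊t⌋ : ℝ)) ^ m := h _ hn
      _ ≤ C * (1 + t) ^ m := by gcongr; exact Int.floor_le t
      _ ≤ _ := by gcongr; linarith [abs_nonneg (g 0)]

lemma polyBounded_fract : PolyBounded Int.fract :=
  ⟨measurable_fract, 1, 0, zero_le_one, fun t _ => by
    rw [abs_of_nonneg (Int.fract_nonneg t)]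
    simpa using (Int.fract_lt_one t).le⟩

lemma polyBounded_exp_fract {δ : ℝ} (hδ : 0 ≤ δ) :
    PolyBounded fun t => Real.exp (δ * Int.fract t) :=
  ⟨Real.measurable_exp.comp (measurable_fract.const_mul δ), Real.exp δ, 0, (Real.exp_pos δ).le,
    fun t _ => by
      rw [Real.abs_exp, pow_zero, mul_one]
      exact Real.exp_le_exp.2 (mul_le_of_le_one_right hδ (Int.fract_lt_one t).le)⟩

lemma polyBounded_one_add_rpow (q : ℝ) : PolyBounded fun t => (1 + t) ^ q := by
  obtain ⟨m, hm⟩ := exists_nat_ge q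
  refine ⟨by fun_prop, 1, m, zero_le_one, fun t ht => ?_⟩
  rw [abs_of_pos (by positivity), one_mul, ← Real.rpow_natCast]
  exact Real.rpow_le_rpow_of_exponent_le (by linarith) hm

lemma integral_one_add_rpow_mul_exp_le {q : ℝ} (hq : -1 < q) :
    ∃ C : ℝ, 0 < C ∧ ∀ δ : ℝ, 0 < δ → δ ≤ 1 →
      ∫ t in Set.Ioi (0 : ℝ), (1 + t) ^ q * Real.exp (-(δ * t)) ≤ C * (1 / δ) ^ (q + 1) := by
  have hG := Real.Gamma_pos_of_pos (show 0 < q + 1 by linarith)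
  refine ⟨Real.exp 1 * Real.Gamma (q + 1), by positivity, fun δ hδ hδ1 => ?_⟩
  have e : ∫ t in Set.Ioi (0 : ℝ), (1 + t) ^ q * Real.exp (-(δ * t)) =
      Real.exp δ * ∫ t in Set.Ioi (1 : ℝ), t ^ q * Real.exp (-(δ * t)) := by
    have h := (MeasureTheory.measurePreserving_add_right MeasureTheory.volume
      (1 : ℝ)).setIntegral_preimage_emb (measurableEmbedding_addRight 1)
      (fun t => t ^ q * Real.exp (-(δ * t))) (Set.Ioi 1)
    rw [Set.preimage_add_const_Ioi, sub_self] at h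
    rw [← h, ← MeasureTheory.integral_const_mul]
    congr 1; ext t
    rw [show -(δ * (t + 1)) = -(δ * t) - δ by ring, Real.exp_sub, add_comm]
    field_simp
  have hInt : MeasureTheory.IntegrableOn (fun t : ℝ => t ^ q * Real.exp (-(δ * t))) (Set.Ioi 0) := by
    simpa using integrableOn_rpow_mul_exp_neg_mul_rpow hq one_pos hδ
  have hmono : ∫ t in Set.Ioi (1 : ℝ), t ^ q * Real.exp (-(δ * t)) ≤
      ∫ t in Set.Ioi (0 : ℝ), t ^ q * Real.exp (-(δ * t)) := by
    refine MeasureTheory.setIntegral_mono_set hInt ?_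
      (Filter.Eventually.of_forall (Set.Ioi_subset_Ioi zero_le_one))
    filter_upwards [MeasureTheory.ae_restrict_mem measurableSet_Ioi] with t ht
    have ht : (0 : ℝ) < t := ht
    simp only [Pi.zero_apply]
    positivity
  have hnn : 0 ≤ ∫ t in Set.Ioi (1 : ℝ), t ^ q * Real.exp (-(δ * t)) :=
    MeasureTheory.setIntegral_nonneg measurableSet_Ioi fun t ht => by
      have : (0 : ℝ) < t := zero_lt_one.trans ht
      positivity
  rw [e]
  calc _ ≤ Real.exp 1 * ∫ t in Set.Ioi (0 : ℝ), t ^ q * Real.exp (-(δ * t)) := by gcongr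
    _ = _ := by rw [integral_rpow_mul_exp hq hδ]; ring

lemma iUnion_Ico_natCast : ⋃ n : ℕ, Set.Ico (n : ℝ) (n + 1) = Set.Ici 0 := by
  ext t
  simp only [Set.mem_iUnion, Set.mem_Ico, Set.mem_Ici]
  exact ⟨fun ⟨n, h, _⟩ => n.cast_nonneg.trans h,
    fun h => ⟨⌊t⌋₊, Nat.floor_le h, Nat.lt_floor_add_one t⟩⟩

lemma hasSum_floor_mul_fract {a b : ℝ → ℝ}
    (h : MeasureTheory.IntegrableOn (fun t : ℝ => a ⌊t⌋ * b (Int.fract t)) (Set.Ioi 0)) :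
    HasSum (fun n : ℕ => a n * ∫ x in (0 : ℝ)..1, b x)
      (∫ t in Set.Ioi (0 : ℝ), a ⌊t⌋ * b (Int.fract t)) := by
  have hd : Pairwise (Function.onFun Disjoint fun n : ℕ => Set.Ico (n : ℝ) (n + 1)) := by
    intro m n hmn
    refine Set.disjoint_left.2 fun t h1 h2 => hmn ?_
    rw [← (Nat.floor_eq_iff (m.cast_nonneg.trans h1.1)).2 h1,
      ← (Nat.floor_eq_iff (n.cast_nonneg.trans h2.1)).2 h2]
  have hI := MeasureTheory.hasSum_integral_iUnion (μ := MeasureTheory.volume)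
    (f := fun t : ℝ => a ⌊t⌋ * b (Int.fract t)) (fun n : ℕ => measurableSet_Ico) hd
    (by rw [iUnion_Ico_natCast]; exact (integrableOn_Ici_iff_integrableOn_Ioi enorm_ne_top).2 h)
  rw [iUnion_Ico_natCast, MeasureTheory.integral_Ici_eq_integral_Ioi] at hI
  have e : (fun n : ℕ => a n * ∫ x in (0 : ℝ)..1, b x) =
      fun n : ℕ => ∫ t in Set.Ico (n : ℝ) (n + 1), a ⌊t⌋ * b (Int.fract t) := by
    ext n
    have h1 : ∫ x in (0 : ℝ)..1, b x = ∫ t in (n : ℝ)..(n + 1), b (t - n) := by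
      rw [intervalIntegral.integral_comp_sub_right]; simp
    rw [h1, intervalIntegral.integral_of_le (by linarith), ← MeasureTheory.integral_Ico_eq_integral_Ioc,
      ← MeasureTheory.integral_const_mul]
    refine MeasureTheory.setIntegral_congr_fun measurableSet_Ico fun t ht => ?_
    have hf : ⌊t⌋ = (n : ℤ) := Int.floor_eq_iff.2 (by exact_mod_cast ht)
    simp only [Int.fract, hf, Int.cast_natCast]
  rwa [e]

set_option maxHeartbeats 400000 in
lemma abs_discrepancy_le {p φ φ₀ R u e δ x y K T P : ℝ} (hδ : 0 < δ) (hu0 : 0 ≤ u) (hu1 : u ≤ 1)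
    (he : 1 ≤ e) (heδ : e ≤ 1 + 3 * δ) (hφ₀ : 0 ≤ φ₀) (hφ : φ₀ ≤ φ) (hφx : φ ≤ K * x)
    (hφy : φ - φ₀ ≤ K * y) (hR : |R| ≤ K * y) (hy : 0 ≤ y) (hyx : y ≤ x) (hK : 0 ≤ K)
    (hT : T = φ * u + R) (hP : P = p - T) :
    |P ^ 2 - p ^ 2 * e + φ ^ 2 / 6 + P * φ + 2 * (p * φ₀ * e * (u - 1 / 2)) -
        φ₀ ^ 2 * e * (u ^ 2 - u + 1 / 6)| ≤
      (12 + 60 * K ^ 2) * (δ * P ^ 2 + δ⁻¹ * y ^ 2 + x * y + δ * x ^ 2) := by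
  have hid : P ^ 2 - p ^ 2 * e + φ ^ 2 / 6 + P * φ + 2 * (p * φ₀ * e * (u - 1 / 2)) -
        φ₀ ^ 2 * e * (u ^ 2 - u + 1 / 6) =
      p ^ 2 * (1 - e) + -(p * ((φ - e * φ₀) * (2 * u - 1))) + -(2 * p * R) +
        R * (T + φ * u - φ) + (φ ^ 2 - e * φ₀ ^ 2) * (u ^ 2 - u + 1 / 6) := by
    rw [hP, hT]; ring
  have hx : 0 ≤ x := hy.trans hyx
  have hKx : 0 ≤ K * x := by positivity
  have hKy : 0 ≤ K * y := by positivity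
  have hφ0 : 0 ≤ φ := hφ₀.trans hφ
  have amgm : ∀ b : ℝ, 2 * (|p| * b) ≤ δ * p ^ 2 + δ⁻¹ * b ^ 2 := fun b => by
    have h : 0 ≤ δ⁻¹ * (δ * |p| - b) ^ 2 := by positivity
    have e1 : δ⁻¹ * (δ * |p| - b) ^ 2 = δ * |p| ^ 2 + δ⁻¹ * b ^ 2 - 2 * (|p| * b) := by
      field_simp; ring
    rw [e1, sq_abs] at h
    linarith
  have b1 : |p ^ 2 * (1 - e)| ≤ 3 * (δ * p ^ 2) := by
    rw [abs_mul, abs_of_nonneg (sq_nonneg p), abs_of_nonpos (by linarith)]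
    nlinarith [sq_nonneg p]
  have b0 : |φ - e * φ₀| ≤ K * y + 3 * δ * (K * x) := by
    rw [show φ - e * φ₀ = (φ - φ₀) + -((e - 1) * φ₀) by ring]
    refine (abs_add_le _ _).trans (add_le_add ?_ ?_)
    · rwa [abs_of_nonneg (by linarith)]
    · rw [abs_neg, abs_of_nonneg (mul_nonneg (by linarith) hφ₀)]
      exact mul_le_mul (by linarith) (by linarith) hφ₀ (by positivity)
  have hu2 : |2 * u - 1| ≤ 1 := abs_le.2 ⟨by linarith, by linarith⟩
  have b2 : |-(p * ((φ - e * φ₀) * (2 * u - 1)))| ≤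
      δ * p ^ 2 + δ⁻¹ * (K * y) ^ 2 + δ * (3 * K * x) ^ 2 := by
    have h1 := amgm (K * y)
    have h2 := amgm (3 * δ * (K * x))
    have e1 : δ⁻¹ * (3 * δ * (K * x)) ^ 2 = δ * (3 * K * x) ^ 2 := by field_simp
    rw [e1] at h2
    rw [abs_neg, abs_mul, abs_mul]
    have h3 : |p| * (|φ - e * φ₀| * |2 * u - 1|) ≤ |p| * ((K * y + 3 * δ * (K * x)) * 1) := by
      gcongr
    have h4 : 0 ≤ δ⁻¹ * (K * y) ^ 2 := by positivity
    have h5 : 0 ≤ δ * (3 * K * x) ^ 2 := by positivity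
    linarith
  have b3 : |-(2 * p * R)| ≤ δ * p ^ 2 + δ⁻¹ * (K * y) ^ 2 := by
    rw [abs_neg, abs_mul, abs_mul, abs_two, mul_assoc]
    refine le_trans ?_ (amgm (K * y))
    gcongr
  have hφu0 : 0 ≤ φ * u := by positivity
  have hφu1 : φ * u ≤ φ := mul_le_of_le_one_right hφ0 hu1
  have hKyx : K * y ≤ K * x := by gcongr
  have hTx : |T| ≤ 2 * (K * x) := by
    rw [hT]
    refine (abs_add_le _ _).trans ?_
    rw [abs_of_nonneg hφu0]
    linarith
  have b4 : |R * (T + φ * u - φ)| ≤ 3 * K ^ 2 * (x * y) := by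
    have h1 : |T + φ * u - φ| ≤ 3 * (K * x) := by
      obtain ⟨h1, h2⟩ := abs_le.1 hTx
      rw [abs_le]
      constructor <;> linarith
    rw [abs_mul]
    calc |R| * |T + φ * u - φ| ≤ (K * y) * (3 * (K * x)) := by gcongr
      _ = _ := by ring
  have b5 : |(φ ^ 2 - e * φ₀ ^ 2) * (u ^ 2 - u + 1 / 6)| ≤ 2 * K ^ 2 * (x * y) + 3 * K ^ 2 * (δ * x ^ 2) := by
    have h1 : |u ^ 2 - u + 1 / 6| ≤ 1 := abs_le.2 ⟨by nlinarith, by nlinarith⟩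
    have h2 : |φ ^ 2 - e * φ₀ ^ 2| ≤ 2 * K ^ 2 * (x * y) + 3 * K ^ 2 * (δ * x ^ 2) := by
      rw [show φ ^ 2 - e * φ₀ ^ 2 = (φ - φ₀) * (φ + φ₀) + -((e - 1) * φ₀ ^ 2) by ring]
      refine (abs_add_le _ _).trans (add_le_add ?_ ?_)
      · rw [abs_of_nonneg (mul_nonneg (by linarith) (by linarith))]
        calc (φ - φ₀) * (φ + φ₀) ≤ (K * y) * (K * x + K * x) := by gcongr; linarith
          _ = _ := by ring
      · rw [abs_neg, abs_of_nonneg (mul_nonneg (by linarith) (sq_nonneg _))]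
        calc (e - 1) * φ₀ ^ 2 ≤ (3 * δ) * (K * x) ^ 2 := by
              gcongr
              · linarith
              · linarith
          _ = _ := by ring
    rw [abs_mul]
    exact (mul_le_of_le_one_right (abs_nonneg _) h1).trans h2
  have hp2 : p ^ 2 ≤ 2 * P ^ 2 + 8 * K ^ 2 * x ^ 2 := by
    have h1 : T ^ 2 ≤ (2 * (K * x)) ^ 2 := sq_le_sq' (abs_le.1 hTx).1 (abs_le.1 hTx).2
    have h2 : p = P + T := by linarith
    have h3 : (P + T) ^ 2 = 2 * P ^ 2 + 2 * T ^ 2 - (P - T) ^ 2 := by ring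
    have h4 := sq_nonneg (P - T)
    rw [mul_pow, mul_pow] at h1
    rw [h2, h3]
    linarith
  have hδp : δ * p ^ 2 ≤ 2 * (δ * P ^ 2) + 8 * (K ^ 2 * (δ * x ^ 2)) := by
    have := mul_le_mul_of_nonneg_left hp2 hδ.le
    linarith
  have n1 : 0 ≤ δ * P ^ 2 := by positivity
  have n2 : 0 ≤ δ⁻¹ * y ^ 2 := by positivity
  have n3 : 0 ≤ x * y := by positivity
  have n4 : 0 ≤ δ * x ^ 2 := by positivity
  have nK := sq_nonneg K
  rw [hid]
  refine (abs_add_le _ _).trans ((add_le_add_left (abs_add_le _ _) _).trans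
    ((add_le_add_left (add_le_add_left (abs_add_le _ _) _) _).trans
    ((add_le_add_left (add_le_add_left (add_le_add_left (abs_add_le _ _) _) _) _).trans ?_)))
  have m1 := mul_nonneg nK n1
  have m2 := mul_nonneg nK n2
  have m3 := mul_nonneg nK n3
  have m4 := mul_nonneg nK n4
  have r1 : δ⁻¹ * (K * y) ^ 2 = K ^ 2 * (δ⁻¹ * y ^ 2) := by ring
  have r2 : δ * (3 * K * x) ^ 2 = 9 * (K ^ 2 * (δ * x ^ 2)) := by ring
  rw [r1] at b2 b3
  rw [r2] at b2
  linarith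

/-- The derivative of the volume `Vk k * t ^ (k / 2)`. -/
noncomputable def volumeDeriv (k : ℕ) (t : ℝ) : ℝ :=
  Vk k * ((k : ℝ) / 2) * t ^ ((k : ℝ) / 2 - 1)

/-- The combination of the squares of the discrepancy at `t` and at `⌊t⌋` (up to terms of mean zero)
that has a small Laplace transform. -/
noncomputable def squareDefect (k : ℕ) (δ t : ℝ) : ℝ :=
  Pk k t ^ 2 - Pk k ⌊t⌋ ^ 2 * Real.exp (δ * Int.fract t) + volumeDeriv k t ^ 2 / 6 +
    Pk k t * volumeDeriv k t +
    2 * (Pk k ⌊t⌋ * volumeDeriv k ⌊t⌋ * Real.exp (δ * Int.fract t) * (Int.fract t - 1 / 2)) -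
    volumeDeriv k ⌊t⌋ ^ 2 * Real.exp (δ * Int.fract t) * (Int.fract t ^ 2 - Int.fract t + 1 / 6)

lemma abs_squareDefect_le {k : ℕ} (hk : 3 ≤ k) :
    ∃ C : ℝ, 0 < C ∧ ∀ δ t : ℝ, 0 < δ → δ ≤ 1 → 0 < t →
      |squareDefect k δ t| ≤ C * (δ * Pk k t ^ 2 + δ⁻¹ * (1 + t) ^ ((k : ℝ) - 4) +
        (1 + t) ^ ((k : ℝ) - 3) + δ * (1 + t) ^ ((k : ℝ) - 2)) := by
  have hk' : (3 : ℝ) ≤ k := by exact_mod_cast hk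
  obtain ⟨D, hD, hdiff⟩ := rpow_sub_floor_rpow_le (a := (k : ℝ) / 2 - 1) (by linarith)
  have hV : 0 ≤ Vk k * ((k : ℝ) / 2) := mul_nonneg (Vk_nonneg k) (by positivity)
  set v := Vk k * ((k : ℝ) / 2) with hv
  refine ⟨12 + 60 * (v * (D + 1)) ^ 2, by positivity, fun δ t hδ hδ1 ht => ?_⟩
  have hu0 := Int.fract_nonneg t
  have hu1 := (Int.fract_lt_one t).le
  have hn := floor_cast_nonneg ht.le
  have hw : 0 < 1 + t := by linarith
  set x := (1 + t) ^ ((k : ℝ) / 2 - 1) with hx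
  set y := (1 + t) ^ ((k : ℝ) / 2 - 1 - 1) with hy
  have hy0 : 0 ≤ y := by positivity
  have hx0 : 0 ≤ x := by positivity
  have hyx : y ≤ x := Real.rpow_le_rpow_of_exponent_le (by linarith) (by linarith)
  have hy2 : (1 + t) ^ ((k : ℝ) - 4) = y ^ 2 := by
    rw [hy, sq, ← Real.rpow_add hw]; ring_nf
  have hxy : (1 + t) ^ ((k : ℝ) - 3) = x * y := by
    rw [hx, hy, ← Real.rpow_add hw]; ring_nf
  have hx2 : (1 + t) ^ ((k : ℝ) - 2) = x ^ 2 := by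
    rw [hx, sq, ← Real.rpow_add hw]; ring_nf
  have hd0 := rpow_sub_floor_rpow_nonneg (a := (k : ℝ) / 2 - 1) (by linarith) ht.le
  have hd1 : t ^ ((k : ℝ) / 2 - 1) - (⌊t⌋ : ℝ) ^ ((k : ℝ) / 2 - 1) ≤ D * y := hdiff t ht
  have hdK : v * (t ^ ((k : ℝ) / 2 - 1) - (⌊t⌋ : ℝ) ^ ((k : ℝ) / 2 - 1)) ≤ v * (D + 1) * y :=
    (mul_le_mul_of_nonneg_left (show _ ≤ (D + 1) * y by linarith) hV).trans_eq (by ring)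
  have hfloor : Pk k t = Pk k ⌊t⌋ - Vk k * (t ^ ((k : ℝ) / 2) - (⌊t⌋ : ℝ) ^ ((k : ℝ) / 2)) := by
    rw [Pk, Pk, Sk_floor]; ring
  have hup := rpow_sub_floor_rpow_le_mul (a := (k : ℝ) / 2) (by linarith) ht
  have hlo := mul_le_rpow_sub_floor_rpow (a := (k : ℝ) / 2) (by linarith) ht
  have hexp : Real.exp (δ * Int.fract t) ≤ 1 + 3 * δ := by
    have h1 : δ * Int.fract t ≤ δ := mul_le_of_le_one_right hδ.le hu1
    have h2 : 0 ≤ δ * Int.fract t := by positivity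
    have h3 := Real.abs_exp_sub_one_le (x := δ * Int.fract t) (by rw [abs_of_nonneg h2]; linarith)
    rw [abs_of_nonneg h2] at h3
    linarith [le_abs_self (Real.exp (δ * Int.fract t) - 1)]
  rw [hy2, hxy, hx2]
  refine abs_discrepancy_le (R := Vk k * (t ^ ((k : ℝ) / 2) - (⌊t⌋ : ℝ) ^ ((k : ℝ) / 2)) -
      volumeDeriv k t * Int.fract t) hδ hu0 hu1 (Real.one_le_exp (by positivity)) hexp ?_ ?_ ?_ ?_ ?_
    hy0 hyx (by positivity) (by ring) hfloor
  · rw [volumeDeriv]; positivity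
  · rw [volumeDeriv, volumeDeriv]; nlinarith
  · have h1 : t ^ ((k : ℝ) / 2 - 1) ≤ x := Real.rpow_le_rpow ht.le (by linarith) (by linarith)
    rw [volumeDeriv, ← hv, mul_assoc v]
    gcongr
    nlinarith
  · rw [volumeDeriv, volumeDeriv, ← hv, ← mul_sub]; exact hdK
  · have h1 := mul_le_mul_of_nonneg_left hup (Vk_nonneg k)
    have h2 := mul_le_mul_of_nonneg_left hlo (Vk_nonneg k)
    have h3 : v * (t ^ ((k : ℝ) / 2 - 1) - (⌊t⌋ : ℝ) ^ ((k : ℝ) / 2 - 1)) * Int.fract t ≤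
        v * (t ^ ((k : ℝ) / 2 - 1) - (⌊t⌋ : ℝ) ^ ((k : ℝ) / 2 - 1)) :=
      mul_le_of_le_one_right (mul_nonneg hV hd0) hu1
    have e1 : Vk k * ((k : ℝ) / 2 * t ^ ((k : ℝ) / 2 - 1) * Int.fract t) =
      volumeDeriv k t * Int.fract t := by rw [volumeDeriv]; ring
    have e2 : Vk k * ((k : ℝ) / 2 * (⌊t⌋ : ℝ) ^ ((k : ℝ) / 2 - 1) * Int.fract t) =
      volumeDeriv k t * Int.fract t -
        v * (t ^ ((k : ℝ) / 2 - 1) - (⌊t⌋ : ℝ) ^ ((k : ℝ) / 2 - 1)) * Int.fract t := by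
      rw [volumeDeriv]; ring
    rw [e1] at h1
    rw [e2] at h2
    rw [abs_le]
    constructor <;> linarith [mul_nonneg (show 0 ≤ v * (D + 1) by positivity) hy0]

lemma polyBounded_volumeDeriv {k : ℕ} (hk : 3 ≤ k) : PolyBounded (volumeDeriv k) := by
  have hk' : (3 : ℝ) ≤ k := by exact_mod_cast hk
  exact (polyBounded_const _).mul (polyBounded_rpow (by linarith))

lemma integral_volumeDeriv_sq {k : ℕ} (hk : 3 ≤ k) {δ : ℝ} (hδ : 0 < δ) :
    ∫ t in Set.Ioi (0 : ℝ), volumeDeriv k t ^ 2 * Real.exp (-(δ * t)) =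
      Real.Gamma ((k : ℝ) - 1) * π ^ (k : ℝ) / Real.Gamma ((k : ℝ) / 2) ^ 2 *
        (1 / δ) ^ ((k : ℝ) - 1) := by
  have hk' : (3 : ℝ) ≤ k := by exact_mod_cast hk
  have hG := Real.Gamma_pos_of_pos (show 0 < (k : ℝ) / 2 by linarith)
  have e : ∫ t in Set.Ioi (0 : ℝ), volumeDeriv k t ^ 2 * Real.exp (-(δ * t)) =
      ∫ t in Set.Ioi (0 : ℝ), (Vk k * ((k : ℝ) / 2)) ^ 2 *
        (t ^ ((k : ℝ) - 2) * Real.exp (-(δ * t))) := by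
    refine MeasureTheory.setIntegral_congr_fun measurableSet_Ioi fun t ht => ?_
    have h : (t ^ ((k : ℝ) / 2 - 1)) ^ 2 = t ^ ((k : ℝ) - 2) := by
      rw [sq, ← Real.rpow_add ht]; ring_nf
    simp only [volumeDeriv]
    rw [mul_pow, h]; ring
  have h2 : (π ^ ((k : ℝ) / 2)) ^ 2 = π ^ (k : ℝ) := by
    rw [sq, ← Real.rpow_add Real.pi_pos]; ring_nf
  rw [e, MeasureTheory.integral_const_mul, integral_rpow_mul_exp (by linarith) hδ, Vk,
    Real.Gamma_add_one (by linarith), ← h2, show (k : ℝ) - 2 + 1 = k - 1 by ring]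
  field_simp

section Defect

variable {k : ℕ} {δ : ℝ}

lemma exp_fract_mul_exp (δ t : ℝ) :
    Real.exp (δ * Int.fract t) * Real.exp (-(δ * t)) = Real.exp (-(δ * ⌊t⌋)) := by
  rw [← Real.exp_add, Int.fract]; ring_nf

lemma hasSum_Pk_sq (k : ℕ) (hδ : 0 < δ) :
    HasSum (fun n : ℕ => Pk k n ^ 2 * Real.exp (-(δ * n)))
      (∫ t in Set.Ioi (0 : ℝ), Pk k ⌊t⌋ ^ 2 * Real.exp (δ * Int.fract t) * Real.exp (-(δ * t))) := by
  have hInt := ((((polyBounded_Pk k).comp_floor).pow 2).mul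
    (polyBounded_exp_fract hδ.le)).integrableOn_exp_real hδ
  have e : ∀ t : ℝ, Pk k ⌊t⌋ ^ 2 * Real.exp (δ * Int.fract t) * Real.exp (-(δ * t)) =
      (fun z : ℝ => Pk k z ^ 2 * Real.exp (-(δ * z))) ⌊t⌋ * (fun _ => 1) (Int.fract t) := fun t => by
    rw [mul_assoc, exp_fract_mul_exp, mul_one]
  simp only [e] at hInt ⊢
  simpa using hasSum_floor_mul_fract (a := fun z => Pk k z ^ 2 * Real.exp (-(δ * z)))
    (b := fun _ => 1) hInt

lemma integral_floor_mul_fract_eq_zero {a b : ℝ → ℝ} (hb : ∫ x in (0 : ℝ)..1, b x = 0)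
    (ha : PolyBounded fun t => a ⌊t⌋) (hb' : PolyBounded fun t => b (Int.fract t)) (hδ : 0 < δ) :
    ∫ t in Set.Ioi (0 : ℝ), a ⌊t⌋ * Real.exp (δ * Int.fract t) * b (Int.fract t) *
      Real.exp (-(δ * t)) = 0 := by
  have hInt := ((ha.mul (polyBounded_exp_fract hδ.le)).mul hb').integrableOn_exp_real hδ
  have e : ∀ t : ℝ, a ⌊t⌋ * Real.exp (δ * Int.fract t) * b (Int.fract t) * Real.exp (-(δ * t)) =
      (fun z : ℝ => a z * Real.exp (-(δ * z))) ⌊t⌋ * b (Int.fract t) := fun t => by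
    simp only
    rw [← exp_fract_mul_exp]; ring
  simp only [e] at hInt ⊢
  have h := hasSum_floor_mul_fract (a := fun z => a z * Real.exp (-(δ * z))) hInt
  simp only [hb, mul_zero] at h
  exact h.unique hasSum_zero

end Defect

lemma integral_squareDefect {k : ℕ} (hk : 3 ≤ k) {δ : ℝ} (hδ : 0 < δ) :
    MeasureTheory.IntegrableOn (fun t => squareDefect k δ t * Real.exp (-(δ * t))) (Set.Ioi 0) ∧
    ∫ t in Set.Ioi (0 : ℝ), squareDefect k δ t * Real.exp (-(δ * t)) =
      (∫ t in Set.Ioi (0 : ℝ), Pk k t ^ 2 * Real.exp (-(δ * t))) -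
        (∑' n : ℕ, Pk k n ^ 2 * Real.exp (-(δ * n))) +
        Real.Gamma ((k : ℝ) - 1) * π ^ (k : ℝ) / (6 * Real.Gamma ((k : ℝ) / 2) ^ 2) *
          (1 / δ) ^ ((k : ℝ) - 1) +
        Vk k * ((k : ℝ) / 2) *
          ∫ t in Set.Ioi (0 : ℝ), Pk k t * t ^ ((k : ℝ) / 2 - 1) * Real.exp (-(δ * t)) := by
  have hP := polyBounded_Pk k
  have hD := polyBounded_volumeDeriv hk
  have hE := polyBounded_exp_fract hδ.le
  have hU1 : PolyBounded fun t => Int.fract t - 1 / 2 := polyBounded_fract.sub (polyBounded_const _)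
  have hU2 : PolyBounded fun t => Int.fract t ^ 2 - Int.fract t + 1 / 6 :=
    ((polyBounded_fract.pow 2).sub polyBounded_fract).add (polyBounded_const _)
  have i1 := (hP.pow 2).integrableOn_exp_real hδ
  have i2 := ((hP.comp_floor.pow 2).mul hE).integrableOn_exp_real hδ
  have i3 := (hD.pow 2).integrableOn_exp_real hδ
  have i4 := (hP.mul hD).integrableOn_exp_real hδ
  have i5 := (((hP.comp_floor.mul hD.comp_floor).mul hE).mul hU1).integrableOn_exp_real hδ
  have i6 := (((hD.comp_floor.pow 2).mul hE).mul hU2).integrableOn_exp_real hδ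
  have z5 : ∫ t in Set.Ioi (0 : ℝ), Pk k ⌊t⌋ * volumeDeriv k ⌊t⌋ * Real.exp (δ * Int.fract t) *
      (Int.fract t - 1 / 2) * Real.exp (-(δ * t)) = 0 :=
    integral_floor_mul_fract_eq_zero (a := fun z => Pk k z * volumeDeriv k z)
      (b := fun x => x - 1 / 2) (by simp)
      (hP.comp_floor.mul hD.comp_floor) hU1 hδ
  have z6 : ∫ t in Set.Ioi (0 : ℝ), volumeDeriv k ⌊t⌋ ^ 2 * Real.exp (δ * Int.fract t) *
      (Int.fract t ^ 2 - Int.fract t + 1 / 6) * Real.exp (-(δ * t)) = 0 :=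
    integral_floor_mul_fract_eq_zero (a := fun z => volumeDeriv k z ^ 2)
      (b := fun x => x ^ 2 - x + 1 / 6) (by
        rw [intervalIntegral.integral_add, intervalIntegral.integral_sub]
        · simp; norm_num
        all_goals exact Continuous.intervalIntegrable (by fun_prop) _ _)
      (hD.comp_floor.pow 2) hU2 hδ
  have hfun : (fun t => squareDefect k δ t * Real.exp (-(δ * t))) = fun t =>
      Pk k t ^ 2 * Real.exp (-(δ * t)) -
        Pk k ⌊t⌋ ^ 2 * Real.exp (δ * Int.fract t) * Real.exp (-(δ * t)) +
        1 / 6 * (volumeDeriv k t ^ 2 * Real.exp (-(δ * t))) +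
        Pk k t * volumeDeriv k t * Real.exp (-(δ * t)) +
        2 * (Pk k ⌊t⌋ * volumeDeriv k ⌊t⌋ * Real.exp (δ * Int.fract t) *
          (Int.fract t - 1 / 2) * Real.exp (-(δ * t))) -
        volumeDeriv k ⌊t⌋ ^ 2 * Real.exp (δ * Int.fract t) *
          (Int.fract t ^ 2 - Int.fract t + 1 / 6) * Real.exp (-(δ * t)) := by
    ext t; rw [squareDefect]; ring
  have j2 := i1.sub i2
  have j3 := j2.add (i3.const_mul (1 / 6))
  have j4 := j3.add i4
  have j5 := j4.add (i5.const_mul 2)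
  have hlin : ∫ t in Set.Ioi (0 : ℝ), Pk k t * volumeDeriv k t * Real.exp (-(δ * t)) =
      Vk k * ((k : ℝ) / 2) *
        ∫ t in Set.Ioi (0 : ℝ), Pk k t * t ^ ((k : ℝ) / 2 - 1) * Real.exp (-(δ * t)) := by
    rw [← MeasureTheory.integral_const_mul]
    congr 1; ext t
    rw [volumeDeriv]; ring
  rw [hfun]
  refine ⟨j5.sub i6, ?_⟩
  erw [MeasureTheory.integral_sub j5 i6, MeasureTheory.integral_add j4 (i5.const_mul 2),
    MeasureTheory.integral_add j3 i4, MeasureTheory.integral_add j2 (i3.const_mul (1 / 6)),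
    MeasureTheory.integral_sub i1 i2]
  rw [MeasureTheory.integral_const_mul, MeasureTheory.integral_const_mul, z5, z6,
    integral_volumeDeriv_sq hk hδ, hlin, (hasSum_Pk_sq k hδ).tsum_eq]
  field_simp
  ring

lemma abs_integral_squareDefect_le {k : ℕ} (hk : 3 ≤ k) {ε : ℝ} (hε : 0 < ε) :
    ∃ C : ℝ, 0 < C ∧ ∀ δ : ℝ, 0 < δ → δ ≤ 1 / 2 →
      |∫ t in Set.Ioi (0 : ℝ), squareDefect k δ t * Real.exp (-(δ * t))| ≤
        C * (1 / δ) ^ ((k : ℝ) - 2 + ε) := by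
  have hk' : (3 : ℝ) ≤ k := by exact_mod_cast hk
  obtain ⟨A, hA, hbound⟩ := abs_squareDefect_le hk
  obtain ⟨B, hB, hmean⟩ := integral_Pk_sq_mul_exp_le hk hε
  obtain ⟨C₁, hC₁, hm1⟩ := integral_one_add_rpow_mul_exp_le (q := (k : ℝ) - 4 + ε) (by linarith)
  obtain ⟨C₂, hC₂, hm2⟩ := integral_one_add_rpow_mul_exp_le (q := (k : ℝ) - 3) (by linarith)
  obtain ⟨C₃, hC₃, hm3⟩ := integral_one_add_rpow_mul_exp_le (q := (k : ℝ) - 2) (by linarith)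
  refine ⟨A * (B * 2 ^ ((k : ℝ) - 1 + ε) + C₁ + C₂ + C₃), by positivity, fun δ hδ hδ1 => ?_⟩
  have hX : 0 < 1 / δ := by positivity
  have hX1 : 1 ≤ 1 / δ := by rw [le_div_iff₀ hδ]; linarith
  have i1 := ((polyBounded_Pk k).pow 2).integrableOn_exp_real hδ
  have w1 := (polyBounded_one_add_rpow ((k : ℝ) - 4 + ε)).integrableOn_exp_real hδ
  have w2 := (polyBounded_one_add_rpow ((k : ℝ) - 3)).integrableOn_exp_real hδ
  have w3 := (polyBounded_one_add_rpow ((k : ℝ) - 2)).integrableOn_exp_real hδ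
  set I1 := ∫ t in Set.Ioi (0 : ℝ), Pk k t ^ 2 * Real.exp (-(δ * t)) with hI1
  set M1 := ∫ t in Set.Ioi (0 : ℝ), (1 + t) ^ ((k : ℝ) - 4 + ε) * Real.exp (-(δ * t)) with hM1
  set M2 := ∫ t in Set.Ioi (0 : ℝ), (1 + t) ^ ((k : ℝ) - 3) * Real.exp (-(δ * t)) with hM2
  set M3 := ∫ t in Set.Ioi (0 : ℝ), (1 + t) ^ ((k : ℝ) - 2) * Real.exp (-(δ * t)) with hM3
  have j1 := (i1.const_mul δ).add (w1.const_mul δ⁻¹)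
  have j2 := j1.add w2
  have j3 := j2.add (w3.const_mul δ)
  have hle : |∫ t in Set.Ioi (0 : ℝ), squareDefect k δ t * Real.exp (-(δ * t))| ≤
      A * (δ * I1 + δ⁻¹ * M1 + M2 + δ * M3) := by
    rw [← Real.norm_eq_abs]
    refine (MeasureTheory.norm_integral_le_of_norm_le (j3.const_mul A) ?_).trans_eq ?_
    · filter_upwards [MeasureTheory.ae_restrict_mem measurableSet_Ioi] with t ht
      have ht : 0 < t := ht
      rw [norm_mul, Real.norm_eq_abs, Real.norm_eq_abs, Real.abs_exp]
      have h1 : (1 + t) ^ ((k : ℝ) - 4) ≤ (1 + t) ^ ((k : ℝ) - 4 + ε) :=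
        Real.rpow_le_rpow_of_exponent_le (by linarith) (by linarith)
      calc |squareDefect k δ t| * Real.exp (-(δ * t)) ≤
          A * (δ * Pk k t ^ 2 + δ⁻¹ * (1 + t) ^ ((k : ℝ) - 4 + ε) +
            (1 + t) ^ ((k : ℝ) - 3) + δ * (1 + t) ^ ((k : ℝ) - 2)) * Real.exp (-(δ * t)) := by
            gcongr
            refine (hbound δ t hδ (by linarith) ht).trans ?_
            gcongr
        _ = _ := by simp only [Pi.add_apply]; ring
    · rw [MeasureTheory.integral_const_mul]
      erw [MeasureTheory.integral_add j2 (w3.const_mul δ), MeasureTheory.integral_add j1 w2,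
        MeasureTheory.integral_add (i1.const_mul δ) (w1.const_mul δ⁻¹)]
      simp only [MeasureTheory.integral_const_mul]
      rfl
  have hinv : δ⁻¹ = (1 / δ) ^ (1 : ℝ) := by rw [Real.rpow_one, one_div]
  have hδ' : δ = (1 / δ) ^ (-1 : ℝ) := by rw [Real.rpow_neg_one, one_div, inv_inv]
  have hd1 : δ * (1 / δ) ^ ((k : ℝ) - 1 + ε) = (1 / δ) ^ ((k : ℝ) - 2 + ε) := by
    nth_rewrite 1 [hδ']
    rw [← Real.rpow_add hX]; ring_nf
  have b1 : δ * I1 ≤ B * 2 ^ ((k : ℝ) - 1 + ε) * (1 / δ) ^ ((k : ℝ) - 2 + ε) := by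
    have h := hmean (δ / 2) (by positivity) (by linarith)
    simp only [show ∀ t : ℝ, 2 * (δ / 2) * t = δ * t from fun t => by ring] at h
    have e : (δ / 2) ^ (-((k : ℝ) - 1 + ε)) = 2 ^ ((k : ℝ) - 1 + ε) * (1 / δ) ^ ((k : ℝ) - 1 + ε) := by
      rw [Real.rpow_neg (by positivity), ← Real.inv_rpow (by positivity),
        ← Real.mul_rpow (by norm_num) hX.le]
      congr 1; field_simp
    rw [e] at h
    calc δ * I1 ≤ δ * (B * (2 ^ ((k : ℝ) - 1 + ε) * (1 / δ) ^ ((k : ℝ) - 1 + ε))) := by gcongr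
      _ = B * 2 ^ ((k : ℝ) - 1 + ε) * (δ * (1 / δ) ^ ((k : ℝ) - 1 + ε)) := by ring
      _ = _ := by rw [hd1]
  have b2 : δ⁻¹ * M1 ≤ C₁ * (1 / δ) ^ ((k : ℝ) - 2 + ε) := by
    calc δ⁻¹ * M1 ≤ δ⁻¹ * (C₁ * (1 / δ) ^ ((k : ℝ) - 4 + ε + 1)) := by
          gcongr; exact hm1 δ hδ (by linarith)
      _ = C₁ * ((1 / δ) ^ (1 : ℝ) * (1 / δ) ^ ((k : ℝ) - 4 + ε + 1)) := by rw [← hinv]; ring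
      _ = _ := by rw [← Real.rpow_add hX]; ring_nf
  have hmono : (1 / δ) ^ ((k : ℝ) - 2) ≤ (1 / δ) ^ ((k : ℝ) - 2 + ε) :=
    Real.rpow_le_rpow_of_exponent_le hX1 (by linarith)
  have b3 : M2 ≤ C₂ * (1 / δ) ^ ((k : ℝ) - 2 + ε) := by
    refine (hm2 δ hδ (by linarith)).trans ?_
    rw [show (k : ℝ) - 3 + 1 = k - 2 by ring]
    gcongr
  have b4 : δ * M3 ≤ C₃ * (1 / δ) ^ ((k : ℝ) - 2 + ε) := by
    calc δ * M3 ≤ δ * (C₃ * (1 / δ) ^ ((k : ℝ) - 2 + 1)) := by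
          gcongr; exact hm3 δ hδ (by linarith)
      _ = C₃ * ((1 / δ) ^ (-1 : ℝ) * (1 / δ) ^ ((k : ℝ) - 2 + 1)) := by rw [← hδ']; ring
      _ = C₃ * (1 / δ) ^ ((k : ℝ) - 2) := by rw [← Real.rpow_add hX]; ring_nf
      _ ≤ _ := by gcongr
  refine hle.trans ?_
  rw [mul_assoc]
  gcongr
  linarith

/-- the continuous Laplace transform of `P_k(t)²` differs from its discrete
analogue by `−(Γ(k−1) π^k/(6 Γ(k/2)²)) X^{k−1}` up to an error `O(X^{k−2+ε})`. -/
theorem laplace_transform_vs_discrete (k : ℕ) (hk : 3 ≤ k) :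
    ∀ ε : ℝ, 0 < ε → ∃ A : ℝ, 0 < A ∧ ∀ X : ℝ, 2 ≤ X →
      MeasureTheory.IntegrableOn (fun t : ℝ => Pk k t ^ 2 * Real.exp (-t / X))
        (Set.Ioi 0) ∧
      Summable (fun n : ℕ => Pk k ((n : ℝ) + 1) ^ 2 * Real.exp (-((n : ℝ) + 1) / X)) ∧
      |(∫ t in Set.Ioi (0 : ℝ), Pk k t ^ 2 * Real.exp (-t / X))
          - (∑' n : ℕ, Pk k ((n : ℝ) + 1) ^ 2 * Real.exp (-((n : ℝ) + 1) / X))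
          + (Real.Gamma ((k : ℝ) - 1) * Real.pi ^ (k : ℝ)
              / (6 * (Real.Gamma ((k : ℝ) / 2)) ^ 2)) * X ^ ((k : ℝ) - 1)|
        ≤ A * X ^ ((k : ℝ) - 2 + ε) := by
  intro ε hε
  have hk' : (3 : ℝ) ≤ k := by exact_mod_cast hk
  obtain ⟨C, hC, hdefect⟩ := abs_integral_squareDefect_le hk hε
  obtain ⟨D, hD, hlin⟩ := abs_integral_Pk_mul_rpow_le hk
  have hV := Vk_nonneg k
  refine ⟨C + Vk k * ((k : ℝ) / 2) * D + Pk k 0 ^ 2, by positivity, fun X hX => ?_⟩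
  have hX0 : 0 < X := by linarith
  have hδ : 0 < 1 / X := by positivity
  have hδ1 : 1 / X ≤ 1 / 2 := one_div_le_one_div_of_le two_pos hX
  have hexp : ∀ t : ℝ, -t / X = -(1 / X * t) := fun t => by ring
  have hXX : 1 / (1 / X) = X := one_div_one_div X
  simp only [hexp]
  have hS := hasSum_Pk_sq k hδ
  have hsum : Summable fun n : ℕ => Pk k ((n : ℝ) + 1) ^ 2 * Real.exp (-(1 / X * ((n : ℝ) + 1))) := by
    simpa using (summable_nat_add_iff 1).2 hS.summable
  refine ⟨((polyBounded_Pk k).pow 2).integrableOn_exp_real hδ, hsum, ?_⟩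
  have htsum := hS.summable.tsum_eq_zero_add
  simp only [Nat.cast_zero, mul_zero, neg_zero, Real.exp_zero, mul_one, Nat.cast_add,
    Nat.cast_one] at htsum
  have heq := (integral_squareDefect hk hδ).2
  have hb := hdefect (1 / X) hδ hδ1
  have hl := hlin (1 / X) hδ
  rw [hXX] at heq hb
  rw [htsum] at heq
  have hone : 1 ≤ X ^ ((k : ℝ) - 2 + ε) := Real.one_le_rpow (by linarith) (by linarith)
  set Λ := ∫ t in Set.Ioi (0 : ℝ), Pk k t * t ^ ((k : ℝ) / 2 - 1) * Real.exp (-(1 / X * t))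
  set W := ∫ t in Set.Ioi (0 : ℝ), squareDefect k (1 / X) t * Real.exp (-(1 / X * t))
  have hW : ∀ z : ℝ, z = W - Vk k * ((k : ℝ) / 2) * Λ + Pk k 0 ^ 2 →
      |z| ≤ (C + Vk k * ((k : ℝ) / 2) * D + Pk k 0 ^ 2) * X ^ ((k : ℝ) - 2 + ε) := by
    rintro z rfl
    have h1 : |Vk k * ((k : ℝ) / 2) * Λ| ≤ Vk k * ((k : ℝ) / 2) * D * X ^ ((k : ℝ) - 2 + ε) := by
      rw [abs_mul, abs_of_nonneg (show 0 ≤ Vk k * ((k : ℝ) / 2) by positivity)]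
      calc _ ≤ Vk k * ((k : ℝ) / 2) * D := by gcongr
        _ ≤ _ := le_mul_of_one_le_right (by positivity) hone
    have h2 : |Pk k 0 ^ 2| ≤ Pk k 0 ^ 2 * X ^ ((k : ℝ) - 2 + ε) := by
      rw [abs_of_nonneg (sq_nonneg _)]
      exact le_mul_of_one_le_right (sq_nonneg _) hone
    calc |W - Vk k * ((k : ℝ) / 2) * Λ + Pk k 0 ^ 2|
        ≤ |W| + |Vk k * ((k : ℝ) / 2) * Λ| + |Pk k 0 ^ 2| :=
          (abs_add_le _ _).trans (add_le_add_left (abs_sub _ _) _)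
      _ ≤ _ := by linarith
  refine hW _ ?_
  linarith
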